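/- arXiv:1404.0271 — 4 statements merged into one kernel-verified Lean document; each statement's English description precedes it below -/
import Mathlib

section
/- Let U be an open neighbourhood of 0 in ℝ^m, let g : U → ℝ be real analytic, define f : U → ℝ by f(x) = (x_1²+⋯+x_m²)^{1/2}·g(x), and let k ≥ 0 be an integer. Then there exist an open neighbourhood V of 0 with V ⊆ U and a constant C ≥ 0 such that for all x = (x_1,…,x_m) ∈ V with x ≠ 0: | f(0) − Σ_{j=0}^{k} Σ_{i_1,…,i_j = 1}^{m} ((−1)^j / j!) · x_{i_1}⋯x_{i_j} · (∂^j f / ∂x_{i_1}⋯∂x_{i_j})(x) | ≤ C · (x_1² + ⋯ + x_m²)^{(k+1)/2} · ( Σ_{i_1,…,i_{k+1} = 1}^{m} ((∂^{k+1} f / ∂x_{i_1}⋯∂x_{i_{k+1}})(x))² )^{1/2}. (Note f(0) = 0, and f is smooth on U ∖ {0}, so all the partial derivatives appearing are defined for x ≠ 0.) -/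
section Part1
open Filter Topology Asymptotics

namespace RT

/-- Hadamard lemma for analytic functions. -/
theorem hadamard_aux {E : Type*} [NormedAddCommGroup E] [NormedSpace ℝ E]
    (P : E →L[ℝ] E) (hP : ‖P‖ ≤ 1) (e : E) (he : ‖e‖ ≤ 1) (l : E → ℝ) (hl : ∀ x, x - P x = l x • e)
    (f : E → ℝ) (hf : AnalyticAt ℝ f 0) :
    ∃ g : E → ℝ, AnalyticAt ℝ g 0 ∧ ∀ᶠ x in 𝓝 0, f x = f (P x) + l x * g x := by
  obtain ⟨p, r, hp⟩ := hf
  let q : FormalMultilinearSeries ℝ E ℝ := fun n => ∑ k : Fin (n+1),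
    (((p (n+1)).compContinuousLinearMap
      (fun j : Fin (n+1) => if j < k then P else ContinuousLinearMap.id ℝ E)).curryMid k e)
  have hq : ∀ n, ‖q n‖ ≤ (n+1) * ‖p (n+1)‖ := by
    intro n
    refine (norm_sum_le _ _).trans ?_
    have : ∀ k ∈ (Finset.univ : Finset (Fin (n+1))), ‖(((p (n+1)).compContinuousLinearMap
      (fun j : Fin (n+1) => if j < k then P else ContinuousLinearMap.id ℝ E)).curryMid k e)‖
        ≤ ‖p (n+1)‖ := by
      intro k _
      refine (ContinuousLinearMap.le_opNorm _ _).trans ?_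
      rw [ContinuousMultilinearMap.norm_curryMid]
      refine (mul_le_of_le_one_right (norm_nonneg _) he).trans ?_
      refine (ContinuousMultilinearMap.norm_compContinuousLinearMap_le _ _).trans ?_
      refine mul_le_of_le_one_right (norm_nonneg _) ?_
      refine Finset.prod_le_one (fun _ _ => norm_nonneg _) ?_
      intro j _
      split_ifs
      · exact hP
      · exact ContinuousLinearMap.norm_id_le
    refine (Finset.sum_le_sum this).trans ?_
    simp
  have hr : 0 < q.radius := by
    obtain ⟨C, b, hC, hb, h⟩ := p.le_mul_pow_of_radius_pos (hp.r_pos.trans_le hp.r_le)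
    have hb0 : (0:ℝ) < b := hb
    have : ∀ n, ‖q n‖ * ((1/(2*b) : ℝ))^n ≤ C * b := by
      intro n
      calc ‖q n‖ * ((1/(2*b) : ℝ))^n ≤ ((n+1) * (C * b^(n+1))) * ((1/(2*b) : ℝ))^n := by
            gcongr
            exact (hq n).trans (by gcongr; exact h _)
        _ = C * b * ((n+1) / 2^n) := by
            rw [div_pow, one_pow, mul_pow, pow_succ]
            field_simp
        _ ≤ C * b * 1 := by
            gcongr
            rw [div_le_one (by positivity)]
            exact_mod_cast Nat.succ_le_of_lt (Nat.lt_two_pow_self)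
        _ = _ := mul_one _
    have h2 := q.le_radius_of_bound (r := ⟨1/(2*b), by positivity⟩) (C*b) this
    refine lt_of_lt_of_le ?_ h2
    have : (0:NNReal) < ⟨1/(2*b), by positivity⟩ := by
      show (0:ℝ) < 1/(2*b)
      positivity
    exact ENNReal.coe_pos.mpr this
  have hqs := q.hasFPowerSeriesOnBall hr
  refine ⟨q.sum, ⟨q, _, hqs⟩, ?_⟩
  have hev : ∀ᶠ x : E in 𝓝 0, x ∈ Metric.eball (0:E) r ∧ x ∈ Metric.eball (0:E) q.radius :=
    Filter.Eventually.and (Metric.eball_mem_nhds _ hp.r_pos) (Metric.eball_mem_nhds _ hr)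
  filter_upwards [hev] with x ⟨hx, hxq⟩
  have hPx : P x ∈ Metric.eball (0:E) r := by
    rw [mem_eball_zero_iff] at hx ⊢
    refine lt_of_le_of_lt ?_ hx
    rw [enorm_le_iff_norm_le]
    exact (P.le_opNorm x).trans (mul_le_of_le_one_left (norm_nonneg _) hP)
  have h1 := hp.hasSum hx
  have h2 := hp.hasSum hPx
  have h3 := (hqs.hasSum hxq).mul_left (l x)
  simp only [zero_add] at h1 h2 h3
  have key : ∀ n, l x * (q n fun _ => x) = (p (n+1) fun _ => x) - (p (n+1) fun _ => P x) := by
    intro n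
    let F : ℕ → ℝ := fun k => p (n+1) (fun j => if (j:ℕ) < k then P x else x)
    have hk : ∀ k : Fin (n+1), l x * ((((p (n+1)).compContinuousLinearMap
      (fun j : Fin (n+1) => if j < k then P else ContinuousLinearMap.id ℝ E)).curryMid k e)
        (fun _ => x)) = F k - F (k+1) := by
      intro k
      have e1 : (fun j : Fin (n+1) => if (j:ℕ) < k then P x else x) =
          Function.update (fun j : Fin (n+1) => if j < k then P x else x) k x := by
        funext j
        by_cases h : j = k
        · subst h; simp
        · simp [h]
      have e2 : (fun j : Fin (n+1) => if (j:ℕ) < k+1 then P x else x) =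
          Function.update (fun j : Fin (n+1) => if j < k then P x else x) k (P x) := by
        funext j
        by_cases h : j = k
        · subst h; simp
        · have : (j:ℕ) ≠ k := fun h' => h (Fin.ext h')
          simp only [Function.update_of_ne h, Fin.lt_def]
          have : (j:ℕ) < k+1 ↔ (j:ℕ) < k := by omega
          simp [this]
      simp only [F]
      rw [e1, e2, ← ContinuousMultilinearMap.map_update_sub, hl,
        ContinuousMultilinearMap.map_update_smul, smul_eq_mul]
      congr 1
      rw [ContinuousMultilinearMap.curryMid_apply,
        ContinuousMultilinearMap.compContinuousLinearMap_apply]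
      congr 1
      funext j
      by_cases h : j = k
      · subst h; simp
      · obtain ⟨i, rfl⟩ := Fin.exists_succAbove_eq h
        simp only [Function.update_of_ne h, Fin.insertNth_apply_succAbove]
        split_ifs <;> rfl
    simp only [q, _root_.sum_apply, Finset.mul_sum]
    rw [Finset.sum_congr rfl (fun k _ => hk k), Fin.sum_univ_eq_sum_range (fun k => F k - F (k+1)),
      Finset.sum_range_sub']
    simp only [F]
    congr 2
    funext j
    simp [j.2]
  simp only [key] at h3
  have h4 := (h1.sub h2)
  rw [← hasSum_nat_add_iff' 1] at h4
  simp only [Finset.range_one, Finset.sum_singleton] at h4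
  have h5 : (p 0 fun _ => x) - (p 0 fun _ => P x) = 0 := by
    rw [sub_eq_zero]; congr 1; funext i; exact i.elim0
  rw [h5, sub_zero] at h4
  have := h3.unique h4
  linarith

variable {m : ℕ}

/-- Coordinate projection. -/
def P (S : Finset (Fin m)) : (Fin m → ℝ) →L[ℝ] (Fin m → ℝ) :=
  ContinuousLinearMap.pi (fun i => if i ∈ S then ContinuousLinearMap.proj i else 0)

theorem P_apply (S : Finset (Fin m)) (x : Fin m → ℝ) (i : Fin m) :
    P S x i = if i ∈ S then x i else 0 := by
  simp only [P, ContinuousLinearMap.coe_pi']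
  split_ifs <;> simp

theorem P_P (S T : Finset (Fin m)) (x : Fin m → ℝ) : P S (P T x) = P (S ∩ T) x := by
  funext i
  simp only [P_apply, Finset.mem_inter]
  split_ifs <;> simp_all

theorem P_P_of_subset {S T : Finset (Fin m)} (h : S ⊆ T) (x : Fin m → ℝ) :
    P S (P T x) = P S x := by
  rw [P_P, Finset.inter_eq_left.mpr h]

theorem P_P_of_subset' {S T : Finset (Fin m)} (h : S ⊆ T) (x : Fin m → ℝ) :
    P T (P S x) = P S x := by
  rw [P_P, Finset.inter_eq_right.mpr h]

theorem P_norm_le (S : Finset (Fin m)) : ‖P S‖ ≤ 1 := by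
  refine ContinuousLinearMap.opNorm_le_bound _ zero_le_one ?_
  intro x
  rw [one_mul, pi_norm_le_iff_of_nonneg (norm_nonneg _)]
  intro i
  rw [P_apply]
  split_ifs
  · exact norm_le_pi_norm x i
  · simp

theorem P_analytic (S : Finset (Fin m)) (x : Fin m → ℝ) : AnalyticAt ℝ (P S) x :=
  (P S).analyticAt x

/-- `f` depends only on the coordinates in `S`. -/
def Dep (S : Finset (Fin m)) (f : (Fin m → ℝ) → ℝ) : Prop := ∀ x, f (P S x) = f x

/-- projection killing the coordinate `i` -/
abbrev Q (i : Fin m) : (Fin m → ℝ) →L[ℝ] (Fin m → ℝ) := P (Finset.univ.erase i)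

theorem Q_apply (i j : Fin m) (x : Fin m → ℝ) : Q i x j = if j = i then 0 else x j := by
  simp only [Q, P_apply, Finset.mem_erase, Finset.mem_univ, and_true]
  split_ifs <;> simp_all

theorem hadamard (i : Fin m) (f : (Fin m → ℝ) → ℝ) (hf : AnalyticAt ℝ f 0) :
    ∃ g : (Fin m → ℝ) → ℝ, AnalyticAt ℝ g 0 ∧ ∀ᶠ x in 𝓝 0, f x = f (Q i x) + x i * g x := by
  refine hadamard_aux (Q i) (P_norm_le _) (Pi.single i 1) ?_ (fun x => x i) ?_ f hf
  · rw [pi_norm_le_iff_of_nonneg zero_le_one]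
    intro j
    by_cases h : j = i
    · subst h; simp
    · simp [h]
  · intro x
    funext j
    by_cases h : j = i
    · subst h; simp [Q_apply]
    · simp [Q_apply, h]

/-- germs of analytic functions form a domain -/
theorem domain {E : Type*} [NormedAddCommGroup E] [NormedSpace ℝ E] {f g : E → ℝ}
    (hf : AnalyticAt ℝ f 0) (hg : AnalyticAt ℝ g 0)
    (h : ∀ᶠ x in 𝓝 0, f x * g x = 0) :
    (∀ᶠ x in 𝓝 0, f x = 0) ∨ (∀ᶠ x in 𝓝 0, g x = 0) := by
  by_cases h1 : ∀ᶠ x in 𝓝 0, f x = 0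
  · exact Or.inl h1
  right
  obtain ⟨r, hr, H⟩ := Metric.eventually_nhds_iff_ball.mp
    ((hf.eventually_analyticAt.and hg.eventually_analyticAt).and h)
  have h2 : ∃ᶠ x in 𝓝 0, f x ≠ 0 := Filter.not_eventually.mp h1
  obtain ⟨x, hx, hxr⟩ := (h2.and_eventually (Metric.ball_mem_nhds 0 hr)).exists
  have hgx : g =ᶠ[𝓝 x] 0 := by
    have c : ∀ᶠ y in 𝓝 x, f y ≠ 0 := (H x hxr).1.1.continuousAt.eventually_ne hx
    filter_upwards [c, Metric.isOpen_ball.mem_nhds hxr] with y hy hyr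
    exact (mul_eq_zero.mp (H y hyr).2).resolve_left hy
  have h3 : AnalyticOnNhd ℝ g (Metric.ball 0 r) := fun y hy => (H y hy).1.2
  have h4 := h3.eqOn_zero_of_preconnected_of_eventuallyEq_zero
    (convex_ball _ _).isPreconnected hxr hgx
  filter_upwards [Metric.ball_mem_nhds (0:E) hr] with y hy
  exact h4 hy

end RT

end Part1

section Part2
open Filter Topology Asymptotics

namespace RT
variable {m : ℕ}

/-- monomial -/
noncomputable def mon (α : Fin m → ℕ) (x : Fin m → ℝ) : ℝ := ∏ i, x i ^ α i

theorem coord_analytic (i : Fin m) (x : Fin m → ℝ) : AnalyticAt ℝ (fun x : Fin m → ℝ => x i) x :=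
  (ContinuousLinearMap.proj (R := ℝ) (φ := fun _ : Fin m => ℝ) i).analyticAt x

theorem mon_analytic (α : Fin m → ℕ) (x : Fin m → ℝ) : AnalyticAt ℝ (mon α) x := by
  unfold mon
  exact Finset.analyticAt_fun_prod _ (fun i _ => (coord_analytic i x).pow _)

theorem mon_add (α β : Fin m → ℕ) (x : Fin m → ℝ) : mon (α + β) x = mon α x * mon β x := by
  simp [mon, pow_add, Finset.prod_mul_distrib]

theorem mon_zero (x : Fin m → ℝ) : mon 0 x = 1 := by simp [mon]

theorem mon_single (i : Fin m) (x : Fin m → ℝ) : mon (Pi.single i 1) x = x i := by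
  unfold mon
  rw [Finset.prod_eq_single i]
  · simp
  · intro j _ h; simp [h]
  · simp

theorem mon_nsmul (n : ℕ) (α : Fin m → ℕ) (x : Fin m → ℝ) : mon (n • α) x = mon α x ^ n := by
  simp [mon, ← Finset.prod_pow, mul_comm n, pow_mul]

theorem mon_ne_zero {α : Fin m → ℕ} {x : Fin m → ℝ} (h : ∀ i, α i ≠ 0 → x i ≠ 0) : mon α x ≠ 0 := by
  unfold mon
  refine Finset.prod_ne_zero_iff.mpr (fun i _ => ?_)
  by_cases h0 : α i = 0
  · simp [h0]
  · exact pow_ne_zero _ (h i h0)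

theorem mon_eq_zero {α : Fin m → ℕ} {x : Fin m → ℝ} {i : Fin m} (h : α i ≠ 0) (hx : x i = 0) :
    mon α x = 0 := by
  unfold mon
  exact Finset.prod_eq_zero (Finset.mem_univ i) (by simp [hx, h])

theorem mon_at_zero {α : Fin m → ℕ} (h : α ≠ 0) : mon α 0 = 0 := by
  obtain ⟨i, hi⟩ := Function.ne_iff.mp h
  exact mon_eq_zero hi rfl

theorem dense_ne (x : Fin m → ℝ) : ∃ᶠ y in 𝓝 x, ∀ i, y i ≠ 0 := by
  have h1 : Tendsto (fun t : ℝ => x + fun _ => t) (𝓝[≠] 0) (𝓝 x) := by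
    have : Continuous (fun t : ℝ => x + fun _ => t) := by fun_prop
    have h := this.tendsto 0
    have h0 : (x + fun _ => (0:ℝ)) = x := by funext; simp
    rw [h0] at h
    exact h.mono_left nhdsWithin_le_nhds
  refine h1.frequently (Filter.Eventually.frequently ?_)
  simp only [Pi.add_apply]
  rw [Filter.eventually_all]
  intro i
  by_cases h : x i = 0
  · filter_upwards [self_mem_nhdsWithin] with t ht
    simpa [h] using ht
  · have : ContinuousAt (fun t : ℝ => x i + t) 0 := by fun_prop
    have h2 := this.eventually_ne (y := 0) (by simpa using h)
    exact h2.filter_mono nhdsWithin_le_nhds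

theorem mon_not_zero (α : Fin m → ℕ) : ¬ ∀ᶠ x in 𝓝 (0 : Fin m → ℝ), mon α x = 0 := by
  intro h
  obtain ⟨x, hx, hx'⟩ := ((dense_ne 0).and_eventually h).exists
  exact mon_ne_zero (fun i _ => hx i) hx'

theorem mon_cancel (α : Fin m → ℕ) {f g : (Fin m → ℝ) → ℝ} (hf : AnalyticAt ℝ f 0)
    (hg : AnalyticAt ℝ g 0) (h : ∀ᶠ x in 𝓝 0, mon α x * f x = mon α x * g x) :
    ∀ᶠ x in 𝓝 0, f x = g x := by
  have := domain (mon_analytic α 0) (hf.sub hg) (by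
    filter_upwards [h] with x hx
    simp only [Pi.sub_apply]
    rw [mul_sub, hx, sub_self])
  have := this.resolve_left (mon_not_zero α)
  filter_upwards [this] with x hx
  exact sub_eq_zero.mp hx

/-- monomial times unit -/
def Normal (f : (Fin m → ℝ) → ℝ) : Prop :=
  ∃ α u, AnalyticAt ℝ u 0 ∧ u 0 ≠ 0 ∧ ∀ᶠ x in 𝓝 0, f x = mon α x * u x

/-- zero germ or normal -/
def NZ (f : (Fin m → ℝ) → ℝ) : Prop := (∀ᶠ x in 𝓝 0, f x = 0) ∨ Normal f

theorem Normal.congr {f g : (Fin m → ℝ) → ℝ} (h : Normal f) (hfg : ∀ᶠ x in 𝓝 0, f x = g x) :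
    Normal g := by
  obtain ⟨α, u, hu, hu0, h⟩ := h
  exact ⟨α, u, hu, hu0, by filter_upwards [h, hfg] with x h1 h2; rw [← h2, h1]⟩

theorem NZ.congr {f g : (Fin m → ℝ) → ℝ} (h : NZ f) (hfg : ∀ᶠ x in 𝓝 0, f x = g x) :
    NZ g := by
  rcases h with h | h
  · left; filter_upwards [h, hfg] with x h1 h2; rw [← h2, h1]
  · exact Or.inr (h.congr hfg)

theorem Normal.mul {f g : (Fin m → ℝ) → ℝ} (hf : Normal f) (hg : Normal g) :
    Normal (fun x => f x * g x) := by
  obtain ⟨α, u, hu, hu0, h⟩ := hf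
  obtain ⟨β, v, hv, hv0, h'⟩ := hg
  refine ⟨α + β, fun x => u x * v x, hu.mul hv, mul_ne_zero hu0 hv0, ?_⟩
  filter_upwards [h, h'] with x h1 h2
  rw [h1, h2, mon_add]; ring

theorem NZ.mul {f g : (Fin m → ℝ) → ℝ} (hf : NZ f) (hg : NZ g) :
    NZ (fun x => f x * g x) := by
  rcases hf with h | h
  · left; filter_upwards [h] with x hx; simp [hx]
  rcases hg with h' | h'
  · left; filter_upwards [h'] with x hx; simp [hx]
  exact Or.inr (h.mul h')

theorem Normal.of_unit {f : (Fin m → ℝ) → ℝ} (hf : AnalyticAt ℝ f 0) (h0 : f 0 ≠ 0) : Normal f :=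
  ⟨0, f, hf, h0, by simp [mon_zero]⟩

theorem Normal.mon (α : Fin m → ℕ) : Normal (mon α) :=
  ⟨α, fun _ => 1, analyticAt_const, one_ne_zero, by simp⟩

theorem NZ.pow {f : (Fin m → ℝ) → ℝ} (hf : NZ f) (n : ℕ) : NZ (fun x => f x ^ n) := by
  induction n with
  | zero => right; simpa using Normal.of_unit (m := m) (f := fun _ => 1) analyticAt_const one_ne_zero
  | succ n ih => simpa [pow_succ] using ih.mul hf

theorem Normal.not_zero {f : (Fin m → ℝ) → ℝ} (hf : Normal f) : ¬ ∀ᶠ x in 𝓝 0, f x = 0 := by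
  intro h
  obtain ⟨α, u, hu, hu0, h'⟩ := hf
  have h2 := hu.continuousAt.eventually_ne hu0
  obtain ⟨x, hx, hx'⟩ := ((dense_ne 0).and_eventually (h.and (h'.and h2))).exists
  have := hx'.1
  rw [hx'.2.1] at this
  exact mul_ne_zero (mon_ne_zero (fun i _ => hx i)) hx'.2.2 this

theorem sub_single_add {α : Fin m → ℕ} {i : Fin m} (h : α i ≠ 0) :
    α = Pi.single i 1 + (α - Pi.single i 1) := by
  funext j
  by_cases hj : j = i
  · subst hj; simp; omega
  · simp [hj]

theorem Q_tendsto (S : Finset (Fin m)) : Tendsto (P S) (𝓝 0) (𝓝 0) := by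
  have := (P S).continuous.tendsto 0
  simpa using this

theorem divide {i : Fin m} {f : (Fin m → ℝ) → ℝ} (hf : AnalyticAt ℝ f 0)
    (h : ∀ᶠ x in 𝓝 0, f (Q i x) = 0) :
    ∃ g, AnalyticAt ℝ g 0 ∧ ∀ᶠ x in 𝓝 0, f x = x i * g x := by
  obtain ⟨g, hg, h2⟩ := hadamard i f hf
  refine ⟨g, hg, ?_⟩
  filter_upwards [h, h2] with x h1 h2
  rw [h2, h1, zero_add]

theorem comp_P_analytic {f : (Fin m → ℝ) → ℝ} (hf : AnalyticAt ℝ f 0) (S : Finset (Fin m)) :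
    AnalyticAt ℝ (fun x => f (P S x)) 0 := by
  have h : AnalyticAt ℝ f (P S 0) := by simpa using hf
  exact h.comp (P_analytic S 0)

theorem normal_of_mul_aux (n : ℕ) : ∀ (α : Fin m → ℕ) (f g u : (Fin m → ℝ) → ℝ), ∑ i, α i = n →
    AnalyticAt ℝ f 0 → AnalyticAt ℝ g 0 → AnalyticAt ℝ u 0 → u 0 ≠ 0 →
    (∀ᶠ x in 𝓝 0, f x * g x = mon α x * u x) → Normal f := by
  induction n with
  | zero =>
    intro α f g u hα hf hg hu hu0 h
    have : α = 0 := by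
      funext i
      exact (Finset.sum_eq_zero_iff.mp hα) i (Finset.mem_univ i)
    subst this
    refine Normal.of_unit hf ?_
    have h0 := h.self_of_nhds
    rw [mon_zero, one_mul] at h0
    intro hf0
    rw [hf0, zero_mul] at h0
    exact hu0 h0.symm
  | succ n ih =>
    intro α f g u hα hf hg hu hu0 h
    obtain ⟨i, hi⟩ : ∃ i, α i ≠ 0 := by
      by_contra hc
      push Not at hc
      simp [hc] at hα
    set β := α - Pi.single i 1 with hβ
    have hαβ : α = Pi.single i 1 + β := sub_single_add hi
    have hsum : ∑ j, β j = n := by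
      have : ∑ j, α j = ∑ j, (Pi.single i 1 + β : Fin m → ℕ) j := by rw [← hαβ]
      simp only [Pi.add_apply, Finset.sum_add_distrib] at this
      simp at this
      omega
    have hz : ∀ᶠ x in 𝓝 0, f (Q i x) * g (Q i x) = 0 := by
      filter_upwards [(Q_tendsto (Finset.univ.erase i)).eventually h] with x hx
      rw [hx, mon_eq_zero hi (by simp [Q_apply]), zero_mul]
    rcases domain (comp_P_analytic hf _) (comp_P_analytic hg _) hz with h1 | h1
    · obtain ⟨f1, hf1, h2⟩ := divide hf h1
      have : ∀ᶠ x in 𝓝 0, f1 x * g x = mon β x * u x := by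
        refine mon_cancel (Pi.single i 1) (hf1.mul hg) ((mon_analytic β 0).mul hu) ?_
        filter_upwards [h, h2] with x h3 h4
        rw [h4, hαβ, mon_add] at h3
        rw [← mul_assoc, ← mul_assoc, ← h3, mon_single]
      have h5 := ih β f1 g u hsum hf1 hg hu hu0 this
      refine ((Normal.mon (Pi.single i 1)).mul h5).congr ?_
      filter_upwards [h2] with x h2
      rw [h2, mon_single]
    · obtain ⟨g1, hg1, h2⟩ := divide hg h1
      refine ih β f g1 u hsum hf hg1 hu hu0 ?_
      refine mon_cancel (Pi.single i 1) (hf.mul hg1) ((mon_analytic β 0).mul hu) ?_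
      filter_upwards [h, h2] with x h3 h4
      rw [h4, hαβ, mon_add] at h3
      rw [← mul_assoc (mon _ x) (mon _ x), ← h3, mon_single]; ring

theorem normal_of_mul {f g : (Fin m → ℝ) → ℝ} (hf : AnalyticAt ℝ f 0) (hg : AnalyticAt ℝ g 0)
    (h : Normal (fun x => f x * g x)) : Normal f := by
  obtain ⟨α, u, hu, hu0, h⟩ := h
  exact normal_of_mul_aux _ α f g u rfl hf hg hu hu0 h

theorem Normal.restrict {f : (Fin m → ℝ) → ℝ} {S : Finset (Fin m)} (h : Normal f) (hS : Dep S f) :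
    ∃ α u, AnalyticAt ℝ u 0 ∧ u 0 ≠ 0 ∧ Dep S u ∧ (∀ i ∉ S, α i = 0) ∧
      ∀ᶠ x in 𝓝 0, f x = RT.mon α x * u x := by
  have hnz := h.not_zero
  obtain ⟨α, u, hu, hu0, h⟩ := h
  have h' := (Q_tendsto S).eventually h
  have hα : ∀ i ∉ S, α i = 0 := by
    intro i hi
    by_contra hc
    apply hnz
    filter_upwards [h'] with x hx
    rw [← hS, hx, mon_eq_zero hc (by simp [P_apply, hi]), zero_mul]
  refine ⟨α, fun x => u (P S x), comp_P_analytic hu S, by simpa using hu0, ?_, hα, ?_⟩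
  · intro x
    simp only [P_P_of_subset (Finset.Subset.refl S)]
  · filter_upwards [h'] with x hx
    rw [← hS, hx]
    congr 1
    unfold RT.mon
    refine Finset.prod_congr rfl (fun i _ => ?_)
    by_cases hi : i ∈ S
    · simp [P_apply, hi]
    · simp [hα i hi]

theorem comparable {α β : Fin m → ℕ} {u v : (Fin m → ℝ) → ℝ} (hu : AnalyticAt ℝ u 0)
    (hv : AnalyticAt ℝ v 0) (hu0 : u 0 ≠ 0) (hv0 : v 0 ≠ 0)
    (h : NZ (fun x => mon α x * u x - mon β x * v x)) : α ≤ β ∨ β ≤ α := by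
  by_contra hc
  push Not at hc
  obtain ⟨hc1, hc2⟩ := hc
  simp only [Pi.le_def, not_forall, not_le] at hc1 hc2
  obtain ⟨i, hi⟩ := hc1
  obtain ⟨j, hj⟩ := hc2
  let μ : Fin m → ℕ := fun k => min (α k) (β k)
  have hα : α = μ + (α - μ) := by funext k; simp [μ]
  have hβ : β = μ + (β - μ) := by funext k; simp [μ]
  set a := α - μ with ha
  set b := β - μ with hb
  have hdisj : ∀ k, a k = 0 ∨ b k = 0 := by intro k; simp [ha, hb, μ]; omega
  have hai : a ≠ 0 := Function.ne_iff.mpr ⟨i, by simp [ha, μ]; omega⟩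
  have hbj : b ≠ 0 := Function.ne_iff.mpr ⟨j, by simp [hb, μ]; omega⟩
  have hgan : AnalyticAt ℝ (fun x => mon a x * u x - mon b x * v x) 0 :=
    ((mon_analytic a 0).mul hu).sub ((mon_analytic b 0).mul hv)
  -- key: restricted to a = 0 locus
  have key : ∀ (T : Finset (Fin m)), (∀ k, b k ≠ 0 → k ∈ T) → (∃ k, a k ≠ 0 ∧ k ∉ T) →
      ¬ ∀ᶠ x in 𝓝 (0 : Fin m → ℝ), mon a (P T x) * u (P T x) - mon b (P T x) * v (P T x) = 0 := by
    intro T hT ⟨k, hk, hkT⟩ hz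
    have h2 := (Q_tendsto T).eventually (hv.continuousAt.eventually_ne hv0)
    obtain ⟨x, hx, hx', hx''⟩ := ((dense_ne 0).and_eventually (hz.and h2)).exists
    rw [mon_eq_zero hk (by simp [P_apply, hkT]), zero_mul, zero_sub, neg_eq_zero] at hx'
    refine mul_ne_zero (mon_ne_zero ?_) hx'' hx'
    intro l hl
    simp [P_apply, hT l hl, hx l]
  have key' : ∀ (T : Finset (Fin m)), (∀ k, a k ≠ 0 → k ∈ T) → (∃ k, b k ≠ 0 ∧ k ∉ T) →
      ¬ ∀ᶠ x in 𝓝 (0 : Fin m → ℝ), mon a (P T x) * u (P T x) - mon b (P T x) * v (P T x) = 0 := by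
    intro T hT ⟨k, hk, hkT⟩ hz
    have h2 := (Q_tendsto T).eventually (hu.continuousAt.eventually_ne hu0)
    obtain ⟨x, hx, hx', hx''⟩ := ((dense_ne 0).and_eventually (hz.and h2)).exists
    rw [mon_eq_zero hk (by simp [P_apply, hkT]), zero_mul, sub_zero] at hx'
    refine mul_ne_zero (mon_ne_zero ?_) hx'' hx'
    intro l hl
    simp [P_apply, hT l hl, hx l]
  have keyQ : ∀ k, ¬ ∀ᶠ x in 𝓝 (0 : Fin m → ℝ),
      mon a (Q k x) * u (Q k x) - mon b (Q k x) * v (Q k x) = 0 := by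
    intro k hz
    by_cases hak : a k = 0
    · by_cases hbk : b k = 0
      · -- further restrict
        obtain ⟨i', hi'⟩ := Function.ne_iff.mp hai
        have h3 := (Q_tendsto (Finset.univ.erase i')).eventually hz
        simp only [Q, P_P] at h3
        refine key _ ?_ ⟨i', hi', ?_⟩ h3
        · intro l hl
          have h1 : l ≠ k := by rintro rfl; exact hl hbk
          have h2 : l ≠ i' := by
            rintro rfl
            rcases hdisj l with h | h
            · exact hi' h
            · exact hl h
          simp [h1, h2]
        · simp
      · refine key' _ ?_ ⟨k, hbk, by simp⟩ hz
        intro l hl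
        have : l ≠ k := by rintro rfl; exact hl hak
        simp [this]
    · refine key _ ?_ ⟨k, hak, by simp⟩ hz
      intro l hl
      have : l ≠ k := by rintro rfl; rcases hdisj l with h | h; exact hak h; exact hl h
      simp [this]
  have hfac : ∀ x, mon α x * u x - mon β x * v x = mon μ x * (mon a x * u x - mon b x * v x) := by
    intro x
    have e1 : mon α x = mon μ x * mon a x := by rw [← mon_add, ← hα]
    have e2 : mon β x = mon μ x * mon b x := by rw [← mon_add, ← hβ]
    rw [e1, e2]; ring
  have hN : NZ (fun x => mon a x * u x - mon b x * v x) := by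
    simp only [hfac] at h
    rcases h with h | h
    · left
      have := mon_cancel μ (f := fun x => mon a x * u x - mon b x * v x) (g := fun _ => 0) hgan
        analyticAt_const (by simpa using h)
      exact this
    · right
      refine normal_of_mul hgan (mon_analytic μ 0) (h.congr ?_)
      filter_upwards with x
      ring
  rcases hN with hN | ⟨δ, w, hw, hw0, hN⟩
  · obtain ⟨i', hi'⟩ := Function.ne_iff.mp hai
    exact keyQ i' ((Q_tendsto _).eventually hN)
  · by_cases hδ : δ = 0
    · subst hδ
      have h0 := hN.self_of_nhds
      simp only at h0
      rw [mon_at_zero hai, mon_at_zero hbj, mon_zero] at h0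
      apply hw0
      linarith
    · obtain ⟨k, hk⟩ := Function.ne_iff.mp hδ
      refine keyQ k ?_
      filter_upwards [(Q_tendsto (Finset.univ.erase k)).eventually hN] with x hx
      rw [hx, mon_eq_zero hk (by simp [Q_apply]), zero_mul]

end RT

end Part2

section Part3
open Filter Topology Asymptotics

namespace RT
variable {m : ℕ}

/-- basis vector -/
noncomputable abbrev ee (i : Fin m) : Fin m → ℝ := Pi.single i 1

/-- partial derivative -/
noncomputable def D (i : Fin m) (f : (Fin m → ℝ) → ℝ) : (Fin m → ℝ) → ℝ :=
  fun x => fderiv ℝ f x (ee i)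

theorem D_analytic {i : Fin m} {f : (Fin m → ℝ) → ℝ} {x : Fin m → ℝ} (hf : AnalyticAt ℝ f x) :
    AnalyticAt ℝ (D i f) x :=
  ((ContinuousLinearMap.apply ℝ ℝ (ee i)).analyticAt _).comp hf.fderiv

theorem Dn_analytic {i : Fin m} {f : (Fin m → ℝ) → ℝ} {x : Fin m → ℝ} (hf : AnalyticAt ℝ f x)
    (n : ℕ) : AnalyticAt ℝ ((D i)^[n] f) x := by
  induction n with
  | zero => exact hf
  | succ n ih => rw [Function.iterate_succ_apply']; exact D_analytic ih

theorem D_congr {i : Fin m} {f g : (Fin m → ℝ) → ℝ} {x : Fin m → ℝ} (h : f =ᶠ[𝓝 x] g) :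
    D i f =ᶠ[𝓝 x] D i g := by
  filter_upwards [h.fderiv (𝕜 := ℝ)] with y hy
  simp only [D, hy]

theorem Q_ee (i : Fin m) : Q i (ee i) = 0 := by
  funext j
  rw [Q_apply]
  split_ifs with h
  · rfl
  · simp [h]

theorem diff_ev {f : (Fin m → ℝ) → ℝ} (hf : AnalyticAt ℝ f 0) :
    ∀ᶠ x in 𝓝 0, DifferentiableAt ℝ f x :=
  hf.eventually_analyticAt.mono (fun _ h => h.differentiableAt)

theorem hadD0 {i : Fin m} {f g : (Fin m → ℝ) → ℝ} (hf : AnalyticAt ℝ f 0) (hg : AnalyticAt ℝ g 0)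
    (h : ∀ᶠ x in 𝓝 0, f x = f (Q i x) + x i * g x) :
    D i f =ᶠ[𝓝 0] fun x => g x + x i * D i g x := by
  refine (D_congr (g := fun x => f (Q i x) + x i * g x) h).trans ?_
  filter_upwards [(Q_tendsto (Finset.univ.erase i)).eventually (diff_ev hf), diff_ev hg] with x h1 h2
  have e1 : HasFDerivAt (fun x => f (Q i x)) ((fderiv ℝ f (Q i x)).comp (Q i)) x :=
    h1.hasFDerivAt.comp x (Q i).hasFDerivAt
  have e2 : HasFDerivAt (fun x : Fin m → ℝ => x i)
    (ContinuousLinearMap.proj (R := ℝ) (φ := fun _ : Fin m => ℝ) i) x :=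
    (ContinuousLinearMap.proj (R := ℝ) (φ := fun _ : Fin m => ℝ) i).hasFDerivAt
  have e3 := e1.add (e2.mul h2.hasFDerivAt)
  have e4 : fderiv ℝ (fun x => f (Q i x) + x i * g x) x = _ := e3.fderiv
  simp only [D, e4]
  simp [Q_ee]
  ring

theorem hadDn {i : Fin m} {f g : (Fin m → ℝ) → ℝ} (hf : AnalyticAt ℝ f 0) (hg : AnalyticAt ℝ g 0)
    (h : ∀ᶠ x in 𝓝 0, f x = f (Q i x) + x i * g x) (n : ℕ) :
    (D i)^[n+1] f =ᶠ[𝓝 0] fun x => (n+1) * (D i)^[n] g x + x i * (D i)^[n+1] g x := by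
  induction n with
  | zero =>
    simpa using hadD0 hf hg h
  | succ n ih =>
    rw [Function.iterate_succ_apply']
    refine (D_congr ih).trans ?_
    filter_upwards [diff_ev (Dn_analytic (i := i) hg n), diff_ev (Dn_analytic (i := i) hg (n+1))]
      with x h1 h2
    have e2 : HasFDerivAt (fun x : Fin m → ℝ => x i)
      (ContinuousLinearMap.proj (R := ℝ) (φ := fun _ : Fin m => ℝ) i) x :=
      (ContinuousLinearMap.proj (R := ℝ) (φ := fun _ : Fin m => ℝ) i).hasFDerivAt
    have e3 := (h1.hasFDerivAt.const_mul ((n:ℝ)+1)).add (e2.mul h2.hasFDerivAt)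
    have e4 : fderiv ℝ (fun x => ((n:ℝ)+1) * (D i)^[n] g x + x i * (D i)^[n+1] g x) x = _ :=
      e3.fderiv
    rw [Function.iterate_succ_apply' (D i) (n+1), Function.iterate_succ_apply' (D i) n]
    rw [Function.iterate_succ_apply' (D i) n] at e4
    simp only [D]
    simp only [D] at e4
    rw [e4]
    simp
    ring

theorem taylor (i : Fin m) (d : ℕ) : ∀ (f : (Fin m → ℝ) → ℝ), AnalyticAt ℝ f 0 →
    ∃ u, AnalyticAt ℝ u 0 ∧ u 0 = (D i)^[d] f 0 / d.factorial ∧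
    ∀ᶠ x in 𝓝 0, f x = ∑ j ∈ Finset.range d, ((D i)^[j] f (Q i x) / j.factorial) * x i ^ j
      + x i ^ d * u x := by
  induction d with
  | zero => intro f hf; exact ⟨f, hf, by simp, by simp⟩
  | succ d ih =>
    intro f hf
    obtain ⟨g, hg, h⟩ := hadamard i f hf
    obtain ⟨u, hu, hu0, h2⟩ := ih g hg
    refine ⟨u, hu, ?_, ?_⟩
    · have := (hadDn hf hg h d).self_of_nhds
      rw [this, hu0, Nat.factorial_succ]
      push_cast
      simp
      field_simp
    · have h3 : ∀ᶠ x in 𝓝 0, ∀ j ∈ Finset.range d,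
          (D i)^[j+1] f (Q i x) = (j+1) * (D i)^[j] g (Q i x) := by
        rw [Filter.eventually_all_finset]
        intro j _
        filter_upwards [(Q_tendsto (Finset.univ.erase i)).eventually (hadDn hf hg h j)] with x hx
        rw [hx]
        simp [Q_apply]
      filter_upwards [h, h2, h3] with x h h2 h3
      rw [h, h2, Finset.sum_range_succ', mul_add, Finset.mul_sum]
      have : ∑ j ∈ Finset.range d, x i * ((D i)^[j] g (Q i x) / j.factorial * x i ^ j) =
          ∑ j ∈ Finset.range d, ((D i)^[j+1] f (Q i x) / (j+1).factorial) * x i ^ (j+1) := by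
        refine Finset.sum_congr rfl (fun j hj => ?_)
        rw [h3 j hj, Nat.factorial_succ]
        push_cast
        field_simp
        ring
      rw [this]
      simp
      ring

/-- shift in direction `i` by a function -/
noncomputable def shift (i : Fin m) (a : (Fin m → ℝ) → ℝ) (x : Fin m → ℝ) : Fin m → ℝ :=
  x + a x • ee i

theorem shift_analytic {i : Fin m} {a : (Fin m → ℝ) → ℝ} {x : Fin m → ℝ} (ha : AnalyticAt ℝ a x) :
    AnalyticAt ℝ (shift i a) x := analyticAt_id.add (ha.smul analyticAt_const)

theorem Q_add_ee (i : Fin m) (x : Fin m → ℝ) (t : ℝ) : Q i (x + t • ee i) = Q i x := by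
  rw [map_add, map_smul, Q_ee, smul_zero, add_zero]

theorem D_shift {i : Fin m} {a f : (Fin m → ℝ) → ℝ} (ha : AnalyticAt ℝ a 0)
    (hf : AnalyticAt ℝ f 0) (ha0 : a 0 = 0) (hdep : Dep (Finset.univ.erase i) a) (n : ℕ) :
    (D i)^[n] (fun x => f (shift i a x)) =ᶠ[𝓝 0] fun x => (D i)^[n] f (shift i a x) := by
  induction n with
  | zero => rfl
  | succ n ih =>
    rw [Function.iterate_succ_apply', Function.iterate_succ_apply']
    refine (D_congr ih).trans ?_
    set h := (D i)^[n] f with hh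
    have hh' : AnalyticAt ℝ h 0 := Dn_analytic hf n
    have s0 : shift i a 0 = 0 := by simp [shift, ha0]
    have st : Tendsto (shift i a) (𝓝 0) (𝓝 0) := by
      have := (shift_analytic (i := i) ha).continuousAt
      rwa [ContinuousAt, s0] at this
    filter_upwards [st.eventually (diff_ev hh'), ha.eventually_analyticAt] with x h1 h2
    have h3 : DifferentiableAt ℝ (fun x => h (shift i a x)) x :=
      h1.comp x (shift_analytic h2).differentiableAt
    simp only [D]
    rw [← h3.lineDeriv_eq_fderiv, ← h1.lineDeriv_eq_fderiv]
    unfold lineDeriv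
    congr 1
    funext t
    have : a (x + t • ee i) = a x := by
      rw [← hdep, ← hdep x]
      congr 1
      exact Q_add_ee i x t
    simp only [shift, this]
    rw [add_right_comm]

theorem implicit {i : Fin m} {S : Finset (Fin m)} {G : (Fin m → ℝ) → ℝ} (hG : AnalyticAt ℝ G 0)
    (hG0 : G 0 = 0) (hD : D i G 0 ≠ 0) (hS : ∀ x, G (P S x) = G x) :
    ∃ a, AnalyticAt ℝ a 0 ∧ a 0 = 0 ∧ Dep (S.erase i) a ∧
      ∀ᶠ x in 𝓝 0, G (shift i a (Q i x)) = 0 := by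
  let L : (Fin m → ℝ) × ℝ →L[ℝ] (Fin m → ℝ) :=
    (Q i).coprod ((ContinuousLinearMap.id ℝ ℝ).smulRight (ee i))
  have hL : ∀ x t, L (x, t) = Q i x + t • ee i := by intro x t; simp [L]
  have hL0 : L 0 = 0 := map_zero _
  have hG' : AnalyticAt ℝ G (L 0) := by rwa [hL0]
  have hφ : AnalyticAt ℝ (fun p => G (L p)) (0 : (Fin m → ℝ) × ℝ) := hG'.comp (L.analyticAt 0)
  have cdf : ContDiffAt ℝ ⊤ (fun p => G (L p)) (0 : (Fin m → ℝ) × ℝ) := hφ.contDiffAt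
  have if2 : (fderiv ℝ (fun p => G (L p)) 0 ∘L .inr ℝ (Fin m → ℝ) ℝ).IsInvertible := by
    refine ⟨ContinuousLinearEquiv.unitsEquivAut ℝ (Units.mk0 _ hD), ?_⟩
    ext
    have e : HasFDerivAt (fun p => G (L p)) ((fderiv ℝ G (L 0)).comp L) 0 :=
      hG'.differentiableAt.hasFDerivAt.comp 0 L.hasFDerivAt
    rw [e.fderiv, hL0]
    simp [L, D]
  let ψ := cdf.implicitFunction (by simp) if2
  have hψ : AnalyticAt ℝ ψ 0 := by
    have := (cdf.contDiffAt_implicitFunction (by simp) if2).analyticAt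
    exact this
  have hψ0 : ψ 0 = 0 := cdf.implicitFunction_apply_self (by simp) if2
  have hψe : ∀ᶠ x in 𝓝 (0 : Fin m → ℝ), G (L (x, ψ x)) = G (L 0) :=
    cdf.eventually_apply_implicitFunction (by simp) if2
  refine ⟨fun x => ψ (P (S.erase i) x), comp_P_analytic hψ _, by simpa using hψ0, ?_, ?_⟩
  · intro x
    simp only [P_P_of_subset (Finset.Subset.refl (S.erase i))]
  · filter_upwards [(Q_tendsto (S.erase i)).eventually hψe] with x hx
    rw [hL0, hG0, hL, ← hS] at hx
    rw [← hS, ← hx]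
    congr 1
    simp only [shift, map_add, map_smul]
    have h1 : P (S.erase i) (Q i x) = P (S.erase i) x :=
      P_P_of_subset (Finset.erase_subset_erase _ (Finset.subset_univ _)) x
    rw [h1]
    congr 1
    rw [P_P, P_P, P_P]
    congr 1
    congr 1
    ext j
    simp
    tauto

end RT

end Part3

section Part4
open Filter Topology Asymptotics

namespace RT
variable {m : ℕ}

/-- local lifting of a sequence through an analytic map -/
structure Lift (𝒰 : Ultrafilter ℕ) (S : Finset (Fin m)) (y : ℕ → Fin m → ℝ)
    (π : (Fin m → ℝ) → (Fin m → ℝ)) (y' : ℕ → Fin m → ℝ) : Prop where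
  an : AnalyticAt ℝ π 0
  zero : π 0 = 0
  off : ∀ i ∉ S, ∀ x, π x i = x i
  dep : ∀ x, P S (π (P S x)) = P S (π x)
  tend : Tendsto y' 𝒰 (𝓝 0)
  eq : ∀ᶠ n in (𝒰 : Filter ℕ), π (y' n) = y n

variable {𝒰 : Ultrafilter ℕ} {S T : Finset (Fin m)} {y y' y'' : ℕ → Fin m → ℝ}
  {π ρ : (Fin m → ℝ) → (Fin m → ℝ)}

theorem Lift.tendsto (h : Lift 𝒰 S y π y') : Tendsto π (𝓝 0) (𝓝 0) := by
  have := h.an.continuousAt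
  rwa [ContinuousAt, h.zero] at this

theorem Lift.comp (h : Lift 𝒰 S y π y') (h' : Lift 𝒰 S y' ρ y'') :
    Lift 𝒰 S y (fun x => π (ρ x)) y'' where
  an := by
    have : AnalyticAt ℝ π (ρ 0) := by rw [h'.zero]; exact h.an
    exact this.comp h'.an
  zero := by rw [h'.zero, h.zero]
  off := fun i hi x => by rw [h.off i hi, h'.off i hi]
  dep := fun x => by rw [← h.dep, h'.dep, h.dep]
  tend := h'.tend
  eq := by filter_upwards [h.eq, h'.eq] with n h1 h2; rw [h2, h1]

theorem Lift.refl (hy : Tendsto y 𝒰 (𝓝 0)) : Lift 𝒰 S y id y where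
  an := analyticAt_id
  zero := rfl
  off := fun _ _ _ => rfl
  dep := fun x => P_P_of_subset (Finset.Subset.refl S) x
  tend := hy
  eq := by simp

theorem Lift.mono (h : Lift 𝒰 T y π y') (hTS : T ⊆ S) : Lift 𝒰 S y π y' where
  an := h.an
  zero := h.zero
  off := fun i hi x => h.off i (fun h' => hi (hTS h')) x
  dep := fun x => by
    funext j
    simp only [P_apply S (π _)]
    split_ifs with hj
    · by_cases hT : j ∈ T
      · have h1 := congrFun (h.dep (P S x)) j
        have h2 := congrFun (h.dep x) j
        rw [P_P_of_subset hTS] at h1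
        simp only [P_apply T (π _), hT, if_true] at h1 h2
        rw [← h1, h2]
      · rw [h.off j hT, h.off j hT, P_apply, if_pos hj]
    · rfl
  tend := h.tend
  eq := h.eq

theorem Lift.dep_comp (h : Lift 𝒰 S y π y') {f : (Fin m → ℝ) → ℝ} (hf : Dep S f) :
    Dep S (fun x => f (π x)) := fun x => by
  simp only
  rw [← hf, h.dep, hf]

theorem Lift.an_comp (h : Lift 𝒰 S y π y') {f : (Fin m → ℝ) → ℝ} (hf : AnalyticAt ℝ f 0) :
    AnalyticAt ℝ (fun x => f (π x)) 0 := by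
  have : AnalyticAt ℝ f (π 0) := by rw [h.zero]; exact hf
  exact this.comp h.an

theorem Dep.mono {f : (Fin m → ℝ) → ℝ} (hf : Dep T f) (hTS : T ⊆ S) : Dep S f := fun x => by
  rw [← hf, P_P_of_subset hTS, hf]

theorem Lift.update {i : Fin m} (hi : i ∈ S) {φ : (Fin m → ℝ) → ℝ} (hφ : AnalyticAt ℝ φ 0)
    (h0 : φ 0 = 0) (hd : Dep S φ) (hy' : Tendsto y' 𝒰 (𝓝 0))
    (he : ∀ᶠ n in (𝒰 : Filter ℕ), Function.update (y' n) i (φ (y' n)) = y n) :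
    Lift 𝒰 S y (fun x => Function.update x i (φ x)) y' where
  an := by
    rw [analyticAt_pi_iff]
    intro j
    by_cases h : j = i
    · subst h; simpa using hφ
    · simpa [h] using coord_analytic j 0
  zero := by rw [h0]; simp
  off := fun j hj x => by
    have : j ≠ i := fun h => hj (h ▸ hi)
    simp [this]
  dep := fun x => by
    funext j
    simp only [P_apply S (Function.update _ _ _)]
    split_ifs with hj
    · by_cases h : j = i
      · subst h; simp [hd x]
      · simp [h, P_apply, hj]
    · rfl
  tend := hy'
  eq := he

theorem shift_eq_update (i : Fin m) (a : (Fin m → ℝ) → ℝ) (x : Fin m → ℝ) :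
    shift i a x = Function.update x i (x i + a x) := by
  funext j
  by_cases h : j = i
  · subst h; simp [shift]
  · simp [shift, h]

theorem update_tendsto {i : Fin m} {b : ℕ → ℝ} (hy : Tendsto y 𝒰 (𝓝 0))
    (hb : Tendsto b 𝒰 (𝓝 0)) : Tendsto (fun n => Function.update (y n) i (b n)) 𝒰 (𝓝 0) := by
  rw [tendsto_pi_nhds] at hy ⊢
  intro j
  by_cases h : j = i
  · subst h; simpa using hb
  · simpa [h] using hy j

theorem P_update {i : Fin m} (hi : i ∉ T) (x : Fin m → ℝ) (b : ℝ) :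
    P T (Function.update x i b) = P T x := by
  funext j
  simp only [P_apply]
  split_ifs with hj
  · have : j ≠ i := fun h => hi (h ▸ hj)
    simp [this]
  · rfl

theorem Dep.update {f : (Fin m → ℝ) → ℝ} (hf : Dep T f) {i : Fin m} (hi : i ∉ T)
    (x : Fin m → ℝ) (b : ℝ) : f (Function.update x i b) = f x := by
  rw [← hf, P_update hi, hf]

theorem coord_tendsto (hy : Tendsto y 𝒰 (𝓝 0)) (i : Fin m) :
    Tendsto (fun n => y n i) 𝒰 (𝓝 0) := (tendsto_pi_nhds.mp hy) i

theorem Lift.shift {i : Fin m} (hi : i ∈ S) {a : (Fin m → ℝ) → ℝ} (ha : AnalyticAt ℝ a 0)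
    (h0 : a 0 = 0) (hd : Dep (S.erase i) a) (hy : Tendsto y 𝒰 (𝓝 0)) :
    ∃ y', Lift 𝒰 S y (shift i a) y' := by
  have e : RT.shift i a = fun x => Function.update x i (x i + a x) := by
    funext x; exact shift_eq_update i a x
  rw [e]
  refine ⟨fun n => Function.update (y n) i (y n i - a (y n)), ?_⟩
  refine Lift.update hi ((coord_analytic i 0).add ha) (by simp [h0]) ?_ ?_ ?_
  · intro x
    simp only [P_apply, if_pos hi, (hd.mono (Finset.erase_subset i S)) x]
  · refine update_tendsto hy ?_
    have h1 : Tendsto (fun n => a (y n)) 𝒰 (𝓝 0) := by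
      have := ha.continuousAt.tendsto
      rw [h0] at this
      exact this.comp hy
    simpa using (coord_tendsto hy i).sub h1
  · refine Eventually.of_forall (fun n => ?_)
    rw [hd.update (Finset.notMem_erase i S)]
    simp

/-- monomial map with coefficients -/
noncomputable def mmap (ε : Fin m → ℝ) (M : Fin m → Fin m → ℕ) (x : Fin m → ℝ) : Fin m → ℝ :=
  fun j => ε j * mon (M j) x

theorem mmap_analytic (ε : Fin m → ℝ) (M : Fin m → Fin m → ℕ) : AnalyticAt ℝ (mmap ε M) 0 := by
  rw [analyticAt_pi_iff]
  intro j
  exact analyticAt_const.mul (mon_analytic _ _)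

theorem mmap_zero {ε : Fin m → ℝ} {M : Fin m → Fin m → ℕ} (hM : ∀ j, M j ≠ 0) :
    mmap ε M 0 = 0 := by
  funext j
  simp [mmap, mon_at_zero (hM j)]

theorem mon_mmap (ε : Fin m → ℝ) (M : Fin m → Fin m → ℕ) (α : Fin m → ℕ) (x : Fin m → ℝ) :
    mon α (mmap ε M x) = mon α ε * mon (∑ j, α j • M j) x := by
  have h : mon (∑ j, α j • M j) x = ∏ j, mon (M j) x ^ α j := by
    have : ∀ s : Finset (Fin m), mon (∑ j ∈ s, α j • M j) x = ∏ j ∈ s, mon (M j) x ^ α j := by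
      intro s
      induction s using Finset.induction_on with
      | empty => simp [mon_zero]
      | insert a s ha ih => rw [Finset.sum_insert ha, Finset.prod_insert ha, mon_add, ih, mon_nsmul]
    exact this _
  rw [h]
  simp [mon, mmap, mul_pow, Finset.prod_mul_distrib]

theorem NZ.mmap {f : (Fin m → ℝ) → ℝ} (hf : NZ f) {ε : Fin m → ℝ} (hε : ∀ j, ε j ≠ 0)
    {M : Fin m → Fin m → ℕ} (hM : ∀ j, M j ≠ 0) : NZ (fun x => f (mmap ε M x)) := by
  have t : Tendsto (RT.mmap ε M) (𝓝 0) (𝓝 0) := by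
    have := (mmap_analytic ε M).continuousAt.tendsto
    rwa [mmap_zero hM] at this
  rcases hf with hf | ⟨α, u, hu, hu0, hf⟩
  · exact Or.inl (t.eventually hf)
  · right
    refine ⟨∑ j, α j • M j, fun x => mon α ε * u (RT.mmap ε M x), ?_, ?_, ?_⟩
    · refine analyticAt_const.mul ?_
      have : AnalyticAt ℝ u (RT.mmap ε M 0) := by rwa [mmap_zero hM]
      exact this.comp (mmap_analytic ε M)
    · show RT.mon α ε * u (RT.mmap ε M 0) ≠ 0
      rw [mmap_zero hM]
      exact mul_ne_zero (mon_ne_zero (fun i _ => hε i)) hu0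
    · filter_upwards [t.eventually hf] with x hx
      rw [hx, mon_mmap]; ring

theorem NZ.update {f : (Fin m → ℝ) → ℝ} (hf : NZ f) {i j : Fin m} :
    NZ (fun x => f (Function.update x j (x i * x j))) := by
  have h := hf.mmap (ε := fun _ => 1) (fun _ => one_ne_zero)
    (M := fun k => if k = j then Pi.single i 1 + Pi.single j 1 else Pi.single k 1) (by
      intro k hk
      have := congrFun hk k
      split_ifs at this with h
      · subst h; simp at this
      · simp at this)
  convert h using 3 with x
  funext k
  by_cases hk : k = j
  · subst hk; simp [RT.mmap, mon_add, mon_single]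
  · simp [hk, RT.mmap, mon_single]

end RT

end Part4

section Part5
open Filter Topology Asymptotics

namespace RT
variable {m : ℕ}

theorem slice {f : (Fin m → ℝ) → ℝ} (hf : AnalyticAt ℝ f 0) (i : Fin m) (n : ℕ) :
    ∀ᶠ t in 𝓝 (0:ℝ), iteratedDeriv n (fun t : ℝ => f (t • ee i)) t = (D i)^[n] f (t • ee i) := by
  have ht : Tendsto (fun t : ℝ => t • ee i) (𝓝 0) (𝓝 (0 : Fin m → ℝ)) := by
    have : Continuous (fun t : ℝ => t • ee i) := by fun_prop
    simpa using this.tendsto 0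
  induction n with
  | zero => simp
  | succ n ih =>
    filter_upwards [ih.eventually_nhds, ht.eventually (diff_ev (Dn_analytic (i := i) hf n))]
      with t h1 h2
    rw [iteratedDeriv_succ, Function.iterate_succ_apply']
    have h3 : iteratedDeriv n (fun t : ℝ => f (t • ee i)) =ᶠ[𝓝 t]
      fun t => (D i)^[n] f (t • ee i) := h1
    rw [h3.deriv_eq]
    have e : HasDerivAt (fun t : ℝ => t • ee i) (ee i) t := by
      simpa using (hasDerivAt_id t).smul_const (ee i)
    exact (h2.hasFDerivAt.comp_hasDerivAt t e).deriv

theorem iteratedDeriv_pow_mul (n : ℕ) : ∀ (d : ℕ) (w : ℝ → ℝ), AnalyticAt ℝ w 0 → n < d →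
    iteratedDeriv n (fun t => t ^ d * w t) 0 = 0 := by
  induction n with
  | zero => intro d w _ hd; simp [hd.ne']
  | succ n ih =>
    intro d w hw hd
    obtain ⟨d, rfl⟩ : ∃ e, d = e + 1 := ⟨d - 1, by omega⟩
    rw [iteratedDeriv_succ']
    have h : deriv (fun t => t ^ (d+1) * w t) =ᶠ[𝓝 0]
        fun t => t ^ d * ((d+1) * w t + t * deriv w t) := by
      filter_upwards [hw.eventually_analyticAt] with t ht
      have e1 : HasDerivAt (fun t : ℝ => t ^ (d+1)) (((d+1:ℕ):ℝ) * t ^ d) t := by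
        simpa using hasDerivAt_pow (d+1) t
      have e4 : deriv (fun t => t ^ (d+1) * w t) t = _ :=
        (e1.mul ht.differentiableAt.hasDerivAt).deriv
      rw [e4]
      push_cast; ring
    rw [h.iteratedDeriv_eq]
    refine ih d _ ?_ (by omega)
    exact (analyticAt_const.mul hw).add (analyticAt_id.mul hw.deriv)

theorem iteratedDeriv_poly (q : Polynomial ℝ) (n : ℕ) :
    iteratedDeriv n (fun t => q.eval t) = fun t => (Polynomial.derivative^[n] q).eval t := by
  induction n with
  | zero => simp
  | succ n ih =>
    rw [iteratedDeriv_succ, ih, Function.iterate_succ_apply']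
    funext t
    simp

theorem slice_coeff {f : (Fin m → ℝ) → ℝ} (hf : AnalyticAt ℝ f 0) {i : Fin m} {n d : ℕ}
    (q : Polynomial ℝ) {w : ℝ → ℝ} (hw : AnalyticAt ℝ w 0) (hn : n < d)
    (h : ∀ᶠ t in 𝓝 (0:ℝ), f (t • ee i) = q.eval t + t ^ d * w t) :
    (D i)^[n] f 0 = n.factorial * q.coeff n := by
  have h1 := (slice hf i n).self_of_nhds
  simp only [zero_smul] at h1
  rw [← h1]
  have h2 : (fun t : ℝ => f (t • ee i)) =ᶠ[𝓝 0] fun t => q.eval t + t ^ d * w t := h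
  rw [h2.iteratedDeriv_eq]
  have e1 : ContDiffAt ℝ n (fun t => q.eval t) 0 := by
    have : ContDiff ℝ n (fun t => q.eval t) := by
      simpa [Polynomial.coe_aeval_eq_eval] using q.contDiff_aeval (𝕜 := ℝ) n
    exact this.contDiffAt
  have e2 : ContDiffAt ℝ n (fun t => t ^ d * w t) 0 :=
    ((analyticAt_id.pow d).mul hw).contDiffAt
  rw [iteratedDeriv_fun_add e1 e2, iteratedDeriv_pow_mul n d w hw hn, iteratedDeriv_poly, add_zero]
  simp only
  rw [← Polynomial.coeff_zero_eq_eval_zero, Polynomial.coeff_iterate_derivative]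
  simp [Nat.descFactorial_self]

/-- simultaneous monomialization -/
def NN (𝒰 : Ultrafilter ℕ) (S : Finset (Fin m)) : Prop :=
  ∀ L : List ((Fin m → ℝ) → ℝ), (∀ f ∈ L, AnalyticAt ℝ f 0 ∧ Dep S f) →
  ∀ y : ℕ → Fin m → ℝ, Tendsto y 𝒰 (𝓝 0) →
    ∃ π y', Lift 𝒰 S y π y' ∧ ∀ f ∈ L, NZ (fun x => f (π x))

/-- monomialization of a regular function together with functions of fewer variables -/
def RR (𝒰 : Ultrafilter ℕ) (S : Finset (Fin m)) (i : Fin m) (d : ℕ) : Prop :=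
  ∀ f : (Fin m → ℝ) → ℝ, AnalyticAt ℝ f 0 → Dep S f → (D i)^[d] f 0 ≠ 0 →
  ∀ L : List ((Fin m → ℝ) → ℝ), (∀ p ∈ L, AnalyticAt ℝ p 0 ∧ Dep (S.erase i) p) →
  ∀ y : ℕ → Fin m → ℝ, Tendsto y 𝒰 (𝓝 0) →
    ∃ π y', Lift 𝒰 S y π y' ∧ NZ (fun x => f (π x)) ∧ ∀ p ∈ L, NZ (fun x => p (π x))

end RT

end Part5

section Part6
open Filter Topology Asymptotics

namespace RT
variable {m : ℕ}

/-- the prepared shape of a regular function -/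
structure Sh (S : Finset (Fin m)) (i : Fin m) (d : ℕ) (γ : Fin m → ℕ)
    (f u : (Fin m → ℝ) → ℝ) (c : ℕ → (Fin m → ℝ) → ℝ) : Prop where
  hf : AnalyticAt ℝ f 0
  fd : Dep S f
  hu : AnalyticAt ℝ u 0
  ud : Dep S u
  u0 : u 0 ≠ 0
  hc : ∀ j, AnalyticAt ℝ (c j) 0
  cd : ∀ j, Dep (S.erase i) (c j)
  γs : ∀ j ∉ S.erase i, γ j = 0
  top : ∀ x, c (d-1) x = 0
  eq : ∀ᶠ x in 𝓝 0, f x = ∑ j ∈ Finset.range d, mon ((d-j) • γ) x * c j x * x i ^ j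
    + x i ^ d * u x

theorem P_ee {T : Finset (Fin m)} {i : Fin m} (hi : i ∉ T) (t : ℝ) : P T (t • ee i) = 0 := by
  funext j
  rw [P_apply]
  split_ifs with h
  · have : j ≠ i := fun h' => hi (h' ▸ h)
    simp [this]
  · rfl

theorem Dep.ee {T : Finset (Fin m)} {i : Fin m} {f : (Fin m → ℝ) → ℝ} (hf : Dep T f) (hi : i ∉ T)
    (t : ℝ) : f (t • ee i) = f 0 := by
  rw [← hf, P_ee hi]

theorem mon_dep {T : Finset (Fin m)} {γ : Fin m → ℕ} (h : ∀ j ∉ T, γ j = 0) : Dep T (mon γ) := by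
  intro x
  unfold mon
  refine Finset.prod_congr rfl (fun j _ => ?_)
  rw [P_apply]
  split_ifs with hj
  · rfl
  · simp [h j hj]

theorem ee_an (i : Fin m) {f : (Fin m → ℝ) → ℝ} (hf : AnalyticAt ℝ f 0) :
    AnalyticAt ℝ (fun t : ℝ => f (t • ee i)) 0 := by
  have : AnalyticAt ℝ f ((0:ℝ) • ee i) := by simpa using hf
  exact this.comp (f := fun t : ℝ => t • ee i) (analyticAt_id.smul analyticAt_const)

theorem ee_tendsto (i : Fin m) : Tendsto (fun t : ℝ => t • ee i) (𝓝 0) (𝓝 (0 : Fin m → ℝ)) := by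
  have : Continuous (fun t : ℝ => t • ee i) := by fun_prop
  simpa using this.tendsto 0

variable {𝒰 : Ultrafilter ℕ} {S : Finset (Fin m)} {i : Fin m} {d : ℕ} {γ : Fin m → ℕ}
  {f u : (Fin m → ℝ) → ℝ} {c : ℕ → (Fin m → ℝ) → ℝ}

theorem Sh.base (h : Sh S i d 0 f u c) {j1 : ℕ} (hj : j1 < d) (hc : c j1 0 ≠ 0) :
    (D i)^[j1] f 0 ≠ 0 := by
  rw [slice_coeff h.hf (i := i) (d := d) (∑ j ∈ Finset.range d, Polynomial.C (c j 0) * Polynomial.X ^ j)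
    (ee_an i h.hu) hj]
  · simp only [Polynomial.finsetSum_coeff, Polynomial.coeff_C_mul_X_pow]
    simp [hj, hc, Nat.factorial_ne_zero]
  · filter_upwards [(ee_tendsto i).eventually h.eq] with t ht
    rw [ht]
    simp only [Polynomial.eval_finsetSum, Polynomial.eval_mul, Polynomial.eval_pow,
      Polynomial.eval_C, Polynomial.eval_X, smul_zero, mon_zero]
    simp [fun j => (h.cd j).ee (Finset.notMem_erase i S) t]

/-- the transform in the bounded case -/
noncomputable def ftr (i l : Fin m) (d : ℕ) (γ : Fin m → ℕ) (c0 : ℝ) (u : (Fin m → ℝ) → ℝ)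
    (c : ℕ → (Fin m → ℝ) → ℝ) (x : Fin m → ℝ) : ℝ :=
  ∑ j ∈ Finset.range d, mon ((d-j) • (γ - Pi.single l 1)) x * c j x * (c0 + x i) ^ j
    + (c0 + x i) ^ d * u (Function.update x i (x l * (c0 + x i)))

theorem upd_an {i : Fin m} {φ : (Fin m → ℝ) → ℝ} (hφ : AnalyticAt ℝ φ 0) :
    AnalyticAt ℝ (fun x => Function.update x i (φ x)) 0 := by
  rw [analyticAt_pi_iff]
  intro j
  by_cases h : j = i
  · subst h; simpa using hφ
  · simpa [h] using coord_analytic j 0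

theorem upd_tendsto {i : Fin m} {φ : (Fin m → ℝ) → ℝ} (hφ : AnalyticAt ℝ φ 0) (h0 : φ 0 = 0) :
    Tendsto (fun x => Function.update x i (φ x)) (𝓝 0) (𝓝 0) := by
  have := (upd_an (i := i) hφ).continuousAt.tendsto
  simpa [h0] using this

theorem upd_comp {i : Fin m} {φ : (Fin m → ℝ) → ℝ} (hφ : AnalyticAt ℝ φ 0) (h0 : φ 0 = 0)
    {u : (Fin m → ℝ) → ℝ} (hu : AnalyticAt ℝ u 0) :
    AnalyticAt ℝ (fun x => u (Function.update x i (φ x))) 0 := by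
  have : AnalyticAt ℝ u (Function.update (0 : Fin m → ℝ) i (φ 0)) := by simpa [h0] using hu
  exact this.comp (f := fun x => Function.update x i (φ x)) (upd_an hφ)

theorem bφ_an (i l : Fin m) (c0 : ℝ) : AnalyticAt ℝ (fun x : Fin m → ℝ => x l * (c0 + x i)) 0 :=
  (coord_analytic l 0).mul (analyticAt_const.add (coord_analytic i 0))

theorem bφ_dep {i l : Fin m} (hi : i ∈ S) (hl : l ∈ S) (c0 : ℝ) :
    Dep S (fun x : Fin m → ℝ => x l * (c0 + x i)) := by
  intro x; simp [P_apply, hi, hl]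

theorem upd_dep {φ : (Fin m → ℝ) → ℝ} (hi : i ∈ S) (hφ : Dep S φ) (hu : Dep S u) :
    Dep S (fun x => u (Function.update x i (φ x))) := by
  intro x
  simp only
  rw [← hu, ← hu (Function.update x i (φ x)), hφ x]
  congr 1
  funext j
  simp only [P_apply S (Function.update _ _ _)]
  split_ifs with hj
  · by_cases h : j = i
    · subst h; simp
    · simp [h, P_apply, hj]
  · rfl

theorem Sh.ftr_an (h : Sh S i d γ f u c) (l : Fin m) (c0 : ℝ) :
    AnalyticAt ℝ (ftr i l d γ c0 u c) 0 := by
  unfold ftr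
  have h1 : AnalyticAt ℝ (fun x : Fin m → ℝ => c0 + x i) 0 :=
    analyticAt_const.add (coord_analytic i 0)
  refine AnalyticAt.add ?_ ((h1.pow d).mul (upd_comp (bφ_an i l c0) (by simp) h.hu))
  refine Finset.analyticAt_fun_sum _ (fun j _ => ?_)
  exact ((mon_analytic _ 0).mul (h.hc j)).mul (h1.pow j)

theorem Sh.γs' (h : Sh S i d γ f u c) (n : ℕ) (l : Fin m) :
    ∀ j ∉ S.erase i, (n • (γ - Pi.single l 1) : Fin m → ℕ) j = 0 := by
  intro j hj
  simp [h.γs j hj]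

theorem Sh.ftr_dep (h : Sh S i d γ f u c) (hi : i ∈ S) {l : Fin m} (hl : l ∈ S) (c0 : ℝ) :
    Dep S (ftr i l d γ c0 u c) := by
  intro x
  unfold ftr
  have h1 := upd_dep hi (bφ_dep hi hl c0) h.ud x
  simp only at h1
  rw [h1]
  have h2 : P S x i = x i := by simp [P_apply, hi]
  rw [h2]
  congr 1
  refine Finset.sum_congr rfl (fun j _ => ?_)
  rw [(mon_dep (h.γs' (d-j) l)).mono (Finset.erase_subset i S) x,
    (h.cd j).mono (Finset.erase_subset i S) x]

theorem Sh.ftr_eq (h : Sh S i d γ f u c) {l : Fin m} (hl : γ l ≠ 0) (c0 : ℝ) :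
    ∀ᶠ x in 𝓝 0, f (Function.update x i (x l * (c0 + x i))) = x l ^ d * ftr i l d γ c0 u c x := by
  have ht : Tendsto (fun x : Fin m → ℝ => Function.update x i (x l * (c0 + x i))) (𝓝 0) (𝓝 0) :=
    upd_tendsto (bφ_an i l c0) (by simp)
  filter_upwards [ht.eventually h.eq] with x hx
  rw [hx]
  unfold ftr
  rw [mul_add (x l ^ d), Finset.mul_sum]
  congr 1
  · refine Finset.sum_congr rfl (fun j hj => ?_)
    have hj' : j < d := Finset.mem_range.mp hj
    rw [(h.cd j).update (Finset.notMem_erase i S)]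
    have h1 : Dep (S.erase i) (mon ((d-j) • γ)) := mon_dep (fun k hk => by simp [h.γs k hk])
    rw [h1.update (Finset.notMem_erase i S)]
    have h2 : mon ((d-j) • γ) x = x l ^ (d-j) * mon ((d-j) • (γ - Pi.single l 1)) x := by
      conv_lhs => rw [sub_single_add hl]
      rw [smul_add, mon_add, mon_nsmul, mon_single]
    rw [h2]
    have h3 : x l ^ d = x l ^ (d-j) * x l ^ j := by rw [← pow_add]; congr 1; omega
    rw [h3]
    simp only [Function.update_self, mul_pow]
    ring
  · simp only [Function.update_self, mul_pow]
    ring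

theorem Sh.step_zero (h : Sh S i d γ f u c) (hi : i ∈ S) {l : Fin m} (hlS : l ∈ S)
    (_hl : γ l ≠ 0) :
    Sh S i d (γ - Pi.single l 1) (ftr i l d γ 0 u c)
      (fun x => u (Function.update x i (x l * (0 + x i)))) c where
  hf := h.ftr_an l 0
  fd := h.ftr_dep hi hlS 0
  hu := upd_comp (bφ_an i l 0) (by simp) h.hu
  ud := upd_dep hi (bφ_dep hi hlS 0) h.ud
  u0 := by simpa using h.u0
  hc := h.hc
  cd := h.cd
  γs := fun j hj => by simp [h.γs j hj]
  top := h.top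
  eq := by
    refine Eventually.of_forall (fun x => ?_)
    simp [ftr]

theorem Sh.step_ne (h : Sh S i d γ f u c) (hd : 0 < d) {l : Fin m}
    (hl : l ∈ S.erase i) {c0 : ℝ} (hc0 : c0 ≠ 0) :
    (D i)^[d-1] (ftr i l d γ c0 u c) 0 ≠ 0 := by
  rw [slice_coeff (h.ftr_an l c0) (i := i) (d := d)
    (∑ j ∈ Finset.range d, Polynomial.C (mon ((d-j) • (γ - Pi.single l 1)) 0 * c j 0) *
      (Polynomial.X + Polynomial.C c0) ^ j + Polynomial.C (u 0) * (Polynomial.X + Polynomial.C c0) ^ d)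
    (w := fun _ => 0) analyticAt_const (by omega)]
  · refine mul_ne_zero (by exact_mod_cast Nat.factorial_ne_zero _) ?_
    simp only [Polynomial.coeff_add, Polynomial.finsetSum_coeff, Polynomial.coeff_C_mul,
      Polynomial.coeff_X_add_C_pow]
    rw [Finset.sum_eq_zero, zero_add]
    · obtain ⟨e, rfl⟩ : ∃ e, d = e + 1 := ⟨d-1, by omega⟩
      simp [hc0, h.u0]
      positivity
    · intro j hj
      have hj' : j < d := Finset.mem_range.mp hj
      by_cases hjd : j = d - 1
      · subst hjd; simp [h.top]
      · rw [Nat.choose_eq_zero_of_lt (by omega)]; simp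
  · refine Eventually.of_forall (fun t => ?_)
    have hne : l ≠ i := Finset.ne_of_mem_erase hl
    have e1 : Function.update (t • ee i) i 0 = (0 : Fin m → ℝ) := by
      funext k
      by_cases hk : k = i
      · subst hk; simp
      · simp [hk]
    simp only [ftr, Polynomial.eval_add, Polynomial.eval_finsetSum, Polynomial.eval_mul,
      Polynomial.eval_pow, Polynomial.eval_C, Polynomial.eval_X]
    have e2 : (t • ee i) l = (0:ℝ) := by simp [hne]
    have e3 : (t • ee i) i = t := by simp
    rw [e2, e3, zero_mul, e1, mul_zero, add_zero]
    congr 1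
    · refine Finset.sum_congr rfl (fun j hj => ?_)
      rw [(h.cd j).ee (Finset.notMem_erase i S),
        (mon_dep (h.γs' (d-j) l)).ee (Finset.notMem_erase i S), add_comm c0 t]
    · rw [add_comm c0 t, mul_comm]

theorem Sh.step_unb (h : Sh S i d γ f u c) {l : Fin m} (hli : l ≠ i)
    (hl : γ l ≠ 0) : NZ (fun x => f (Function.update x l (x i * x l))) := by
  have han : AnalyticAt ℝ (fun x : Fin m → ℝ => x i * x l) 0 :=
    (coord_analytic i 0).mul (coord_analytic l 0)
  have ht : Tendsto (fun x : Fin m → ℝ => Function.update x l (x i * x l)) (𝓝 0) (𝓝 0) :=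
    upd_tendsto han (by simp)
  right
  refine ⟨d • Pi.single i 1, fun x => ∑ j ∈ Finset.range d, x i ^ ((d-j) * (γ l - 1)) *
    mon ((d-j) • γ) x * c j (Function.update x l (x i * x l)) + u (Function.update x l (x i * x l)),
    ?_, ?_, ?_⟩
  · refine AnalyticAt.add ?_ (upd_comp han (by simp) h.hu)
    refine Finset.analyticAt_fun_sum _ (fun j _ => ?_)
    exact (((coord_analytic i 0).pow _).mul (mon_analytic _ 0)).mul
      (upd_comp han (by simp) (h.hc j))
  · simp only
    rw [Finset.sum_eq_zero]
    · simpa using h.u0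
    · intro j hj
      have hj' : j < d := Finset.mem_range.mp hj
      rw [mon_at_zero]
      · simp
      · intro h'
        have := congrFun h' l
        simp [hl] at this
        omega
  · filter_upwards [ht.eventually h.eq] with x hx
    rw [hx, mul_add, mon_nsmul, mon_single, Finset.mul_sum]
    congr 1
    · refine Finset.sum_congr rfl (fun j hj => ?_)
      have hj' : j < d := Finset.mem_range.mp hj
      have h1 : mon γ (Function.update x l (x i * x l)) = x i ^ γ l * mon γ x := by
        unfold mon
        rw [← Finset.mul_prod_erase Finset.univ _ (Finset.mem_univ l),
          ← Finset.mul_prod_erase Finset.univ (fun k => x k ^ γ k) (Finset.mem_univ l)]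
        simp only [Function.update_self, mul_pow]
        rw [Finset.prod_congr rfl (g := fun k => x k ^ γ k)]
        · ring
        · intro k hk
          rw [Function.update_of_ne (Finset.ne_of_mem_erase hk)]
      rw [mon_nsmul, h1, mul_pow, ← mon_nsmul, ← pow_mul]
      have h3 : x i ^ (γ l * (d-j)) * x i ^ j = x i ^ d * x i ^ ((d-j) * (γ l - 1)) := by
        rw [← pow_add, ← pow_add]
        congr 1
        obtain ⟨e, he⟩ : ∃ e, γ l = e + 1 := ⟨γ l - 1, by omega⟩
        obtain ⟨q, rfl⟩ : ∃ q, d = j + q := ⟨d - j, by omega⟩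
        rw [he]; simp; ring
      rw [Function.update_of_ne hli.symm]
      calc _ = (x i ^ (γ l * (d-j)) * x i ^ j) * (mon ((d-j) • γ) x *
            c j (Function.update x l (x i * x l))) := by ring
        _ = _ := by rw [h3]; ring
    · rw [Function.update_of_ne hli.symm]

end RT

end Part6

section Part7
open Filter Topology Asymptotics

namespace RT
variable {m : ℕ}

variable {𝒰 : Ultrafilter ℕ} {S : Finset (Fin m)} {i : Fin m} {d : ℕ}

theorem GG (hN : ∀ T, T ⊂ S → NN 𝒰 T) (hi : i ∈ S) (hR : ∀ d' < d, RR 𝒰 S i d') (n : ℕ) :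
    ∀ (γ : Fin m → ℕ) (f u : (Fin m → ℝ) → ℝ) (c : ℕ → (Fin m → ℝ) → ℝ),
    ∑ j, γ j = n → Sh S i d γ f u c → (∃ j1 < d, c j1 0 ≠ 0) →
    ∀ L : List ((Fin m → ℝ) → ℝ), (∀ p ∈ L, AnalyticAt ℝ p 0 ∧ Dep (S.erase i) p ∧ NZ p) →
    ∀ y : ℕ → Fin m → ℝ, Tendsto y 𝒰 (𝓝 0) →
    ∃ π y', Lift 𝒰 S y π y' ∧ NZ (fun x => f (π x)) ∧ ∀ p ∈ L, NZ (fun x => p (π x)) := by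
  induction n with
  | zero =>
    intro γ f u c hγ h ⟨j1, hj1, hc⟩ L hL y hy
    have : γ = 0 := by
      funext j
      have := (Finset.sum_eq_zero_iff.mp hγ) j (Finset.mem_univ j)
      simpa using this
    subst this
    exact hR j1 hj1 f h.hf h.fd (h.base hj1 hc) L (fun p hp => ⟨(hL p hp).1, (hL p hp).2.1⟩) y hy
  | succ n ih =>
    intro γ f u c hγ h ⟨j1, hj1, hc⟩ L hL y hy
    obtain ⟨l, hl⟩ : ∃ l, γ l ≠ 0 := by
      by_contra hcon
      push Not at hcon
      simp [hcon] at hγ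
    have hlS' : l ∈ S.erase i := by
      by_contra hcon
      exact hl (h.γs l hcon)
    have hlS : l ∈ S := Finset.mem_of_mem_erase hlS'
    have hli : l ≠ i := Finset.ne_of_mem_erase hlS'
    rcases 𝒰.em (fun n => y n l = 0) with h0 | h0
    · -- the coordinate vanishes along the sequence
      have hQ : ∀ x, P S (Q l x) = P (S.erase l) x := by
        intro x
        rw [P_P]
        congr 1
        congr 1
        ext j; simp; tauto
      have hQ' : ∀ x, Q l (P (S.erase l) x) = P (S.erase l) x := fun x =>
        P_P_of_subset' (Finset.erase_subset_erase _ (Finset.subset_univ _)) x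
      obtain ⟨π, y', hπ, hLπ⟩ := hN (S.erase l) (Finset.erase_ssubset hlS)
        ((f :: L).map (fun p => fun x => p (P (S.erase l) x))) (by
          intro p hp
          rw [List.mem_map] at hp
          obtain ⟨q, hq, rfl⟩ := hp
          refine ⟨comp_P_analytic ?_ _, fun x => ?_⟩
          · rcases List.mem_cons.mp hq with rfl | hq
            · exact h.hf
            · exact (hL q hq).1
          · simp only [P_P_of_subset (Finset.Subset.refl _)]) y hy
      have hd : ∀ q ∈ f :: L, Dep S q := by
        intro q hq
        rcases List.mem_cons.mp hq with rfl | hq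
        · exact h.fd
        · exact (hL q hq).2.1.mono (Finset.erase_subset _ _)
      have hall : ∀ q ∈ f :: L, NZ (fun x => q (Q l (π x))) := by
        intro q hq
        have := hLπ _ (List.mem_map.mpr ⟨q, hq, rfl⟩)
        simp only [← hQ] at this
        have e : ∀ x, q (P S (Q l (π x))) = q (Q l (π x)) := fun x => hd q hq _
        simpa only [e] using this
      have hπS := hπ.mono (Finset.erase_subset l S)
      refine ⟨fun x => Q l (π x), y', ?_, hall f (List.mem_cons_self ..),
        fun p hp => hall p (List.mem_cons_of_mem _ hp)⟩
      exact
        { an := ((Q l).analyticAt _).comp hπ.an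
          zero := by rw [hπ.zero, map_zero]
          off := fun j hj x => by
            have : j ≠ l := fun e => hj (e ▸ hlS)
            rw [Q_apply, if_neg this, hπS.off j hj]
          dep := fun x => by
            have e : ∀ z, P S (Q l z) = Q l (P S z) := by
              intro z; rw [P_P, P_P, Finset.inter_comm]
            rw [e, hπS.dep, e]
          tend := hπ.tend
          eq := by
            filter_upwards [hπ.eq, h0] with n h1 h2
            rw [h1]
            funext j
            rw [Q_apply]
            split_ifs with hj
            · rw [hj, h2]
            · rfl }
    · by_cases hb : ∃ M : ℝ, ∀ᶠ n in (𝒰 : Filter ℕ), |y n i / y n l| ≤ M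
      · obtain ⟨M, hM⟩ := hb
        obtain ⟨c0, -, hc0⟩ : ∃ c0 ∈ Set.Icc (-M) M, Tendsto (fun n => y n i / y n l) 𝒰 (𝓝 c0) := by
          have := (isCompact_Icc (a := -M) (b := M)).ultrafilter_le_nhds'
            (𝒰.map (fun n => y n i / y n l)) (by
              rw [Ultrafilter.mem_map]
              filter_upwards [hM] with n hn
              exact abs_le.mp hn)
          exact this
        have hlift : Lift 𝒰 S y (fun x => Function.update x i (x l * (c0 + x i)))
            (fun n => Function.update (y n) i (y n i / y n l - c0)) := by
          refine Lift.update hi (bφ_an i l c0) (by simp) (bφ_dep hi hlS c0) ?_ ?_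
          · exact update_tendsto hy (by simpa using hc0.sub_const c0)
          · filter_upwards [h0] with n hn
            funext j
            by_cases hj : j = i
            · subst hj
              simp [hli]
              field_simp
            · simp [hj]
        have hlan : AnalyticAt ℝ (fun x : Fin m → ℝ => x l) 0 := coord_analytic l 0
        have hldep : Dep (S.erase i) (fun x : Fin m → ℝ => x l) := by
          intro x; simp only [P_apply, if_pos hlS']
        have hlnz : NZ (fun x : Fin m → ℝ => x l) := by
          have := Normal.mon (m := m) (Pi.single l 1)
          exact Or.inr (this.congr (Eventually.of_forall (fun x => mon_single l x)))
        have key : ∃ π y', Lift 𝒰 S (fun n => Function.update (y n) i (y n i / y n l - c0)) π y' ∧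
            NZ (fun x => ftr i l d γ c0 u c (π x)) ∧
            ∀ p ∈ (fun x => x l) :: L, NZ (fun x => p (π x)) := by
          by_cases hz : c0 = 0
          · subst hz
            refine ih (γ - Pi.single l 1) _ _ c ?_ (h.step_zero hi hlS hl) ⟨j1, hj1, hc⟩ _ ?_ _
              hlift.tend
            · have e := sub_single_add hl
              rw [e] at hγ
              simp [Finset.sum_add_distrib] at hγ
              simp only [Pi.sub_apply]
              omega
            · intro p hp
              rcases List.mem_cons.mp hp with rfl | hp
              · exact ⟨hlan, hldep, hlnz⟩
              · exact hL p hp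
          · refine hR (d-1) (by omega) _ (h.ftr_an l c0) (h.ftr_dep hi hlS c0)
              (h.step_ne (by omega) hlS' hz) _ ?_ _ hlift.tend
            intro p hp
            rcases List.mem_cons.mp hp with rfl | hp
            · exact ⟨hlan, hldep⟩
            · exact ⟨(hL p hp).1, (hL p hp).2.1⟩
        obtain ⟨π, y', hπ, hf, hp⟩ := key
        refine ⟨_, y', hlift.comp hπ, ?_, ?_⟩
        · have h1 := (hp _ (List.mem_cons_self ..)).pow d
          refine (h1.mul hf).congr ?_
          filter_upwards [hπ.tendsto.eventually (h.ftr_eq hl c0)] with x hx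
          exact hx.symm
        · intro p hpL
          have h1 := hp p (List.mem_cons_of_mem _ hpL)
          refine h1.congr (Eventually.of_forall (fun x => ?_))
          exact ((hL p hpL).2.1.update (Finset.notMem_erase i S) _ _).symm
      · push Not at hb
        have hb' : ∀ M : ℝ, ∀ᶠ n in (𝒰 : Filter ℕ), M < |y n i / y n l| := hb
        have hlift : Lift 𝒰 S y (fun x => Function.update x l (x i * x l))
            (fun n => Function.update (y n) l (y n l / y n i)) := by
          refine Lift.update hlS ((coord_analytic i 0).mul (coord_analytic l 0)) (by simp) ?_ ?_ ?_
          · intro x; simp [P_apply, hi, hlS]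
          · refine update_tendsto hy ?_
            rw [Metric.tendsto_nhds]
            intro ε hε
            filter_upwards [hb' (1/ε), h0] with n hn hn0
            rw [Real.dist_eq, sub_zero]
            have e : y n l / y n i = (y n i / y n l)⁻¹ := by rw [inv_div]
            rw [e, abs_inv]
            have : 0 < 1/ε := by positivity
            rw [inv_lt_comm₀ (by linarith) hε]
            simpa using hn
          · filter_upwards [hb' 0, h0] with n hn hn0
            have hyi : y n i ≠ 0 := by
              intro e; rw [e] at hn; simp at hn
            funext j
            by_cases hj : j = l
            · subst hj
              simp [hli.symm]
              field_simp
            · simp [hj]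
        refine ⟨_, _, hlift, h.step_unb hli hl, fun p hp => (hL p hp).2.2.update⟩

end RT

end Part7

section Part8
open Filter Topology Asymptotics

namespace RT
variable {m : ℕ}

variable {𝒰 : Ultrafilter ℕ} {S T : Finset (Fin m)} {i : Fin m} {d : ℕ}

theorem prep {f : (Fin m → ℝ) → ℝ} (hf : AnalyticAt ℝ f 0) (fd : Dep S f) (hi : i ∈ S) (hd : 0 < d)
    (hD : (D i)^[d] f 0 ≠ 0) (hD1 : (D i)^[d-1] f 0 = 0) :
    ∃ a, AnalyticAt ℝ a 0 ∧ a 0 = 0 ∧ Dep (S.erase i) a ∧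
    ∃ (A : ℕ → (Fin m → ℝ) → ℝ) (u : (Fin m → ℝ) → ℝ),
      (∀ j, AnalyticAt ℝ (A j) 0 ∧ Dep (S.erase i) (A j)) ∧ (A (d-1) = fun _ => 0) ∧
      (∀ j, d ≤ j → A j = fun _ => 0) ∧
      AnalyticAt ℝ u 0 ∧ Dep S u ∧ u 0 ≠ 0 ∧
      ∀ᶠ x in 𝓝 0, f (shift i a x) = ∑ j ∈ Finset.range d, A j x * x i ^ j + x i ^ d * u x := by
  set G := (D i)^[d-1] f with hG
  have Gan : AnalyticAt ℝ G 0 := Dn_analytic hf _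
  have Pee : P S (ee i) = ee i := by
    funext j
    rw [P_apply]
    split_ifs with h
    · rfl
    · have : j ≠ i := fun e => h (e ▸ hi)
      simp [this]
  have hDG : D i (fun x => G (P S x)) 0 ≠ 0 := by
    have e : HasFDerivAt (fun x => G (P S x)) ((fderiv ℝ G (P S 0)).comp (P S)) 0 := by
      have : AnalyticAt ℝ G (P S 0) := by simpa using Gan
      exact this.differentiableAt.hasFDerivAt.comp 0 (P S).hasFDerivAt
    have h2 : D i (fun x => G (P S x)) 0 = (D i)^[d] f 0 := by
      simp only [D, e.fderiv]
      have : d = (d-1)+1 := by omega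
      rw [this, Function.iterate_succ_apply']
      simp [D, Pee, hG]
    rwa [h2]
  obtain ⟨a, ha, ha0, had, hag⟩ := implicit (i := i) (S := S) (comp_P_analytic Gan S)
    (by simpa using hD1) hDG (fun x => by simp only [P_P_of_subset (Finset.Subset.refl S)])
  refine ⟨a, ha, ha0, had, ?_⟩
  have had' : Dep (Finset.univ.erase i) a :=
    had.mono (Finset.erase_subset_erase _ (Finset.subset_univ _))
  have s0 : shift i a 0 = 0 := by simp [shift, ha0]
  set F := fun x => f (shift i a x) with hF
  have Fan : AnalyticAt ℝ F 0 := by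
    have : AnalyticAt ℝ f (shift i a 0) := by rwa [s0]
    exact this.comp (shift_analytic ha)
  have hFd : Dep S F := by
    intro x
    simp only [hF]
    rw [← fd, ← fd (shift i a x)]
    congr 1
    simp only [shift, map_add, map_smul, P_P_of_subset (Finset.Subset.refl S)]
    rw [had.mono (Finset.erase_subset i S) x]
  obtain ⟨u, hu, hu0, ht⟩ := taylor i d F Fan
  have hz : ∀ᶠ x in 𝓝 0, (D i)^[d-1] F (P (S.erase i) x) = 0 := by
    filter_upwards [(Q_tendsto (S.erase i)).eventually (D_shift (i := i) ha hf ha0 had' (d-1)),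
      (Q_tendsto (S.erase i)).eventually hag] with x h1 h2
    rw [h1]
    rw [← h2]
    have e1 : Q i (P (S.erase i) x) = P (S.erase i) x :=
      P_P_of_subset' (Finset.erase_subset_erase _ (Finset.subset_univ _)) x
    rw [e1]
    simp only [shift, map_add, map_smul, Pee, P_P_of_subset' (Finset.erase_subset i S)]
    rfl
  refine ⟨fun j => if j < d - 1 then fun x => (D i)^[j] F (P (S.erase i) x) / j.factorial
    else fun _ => 0, fun x => u (P S x), ?_, ?_, ?_, comp_P_analytic hu S, ?_, ?_, ?_⟩
  · intro j
    dsimp only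
    split_ifs
    · refine ⟨(comp_P_analytic (Dn_analytic Fan j) _).div_const, fun x => ?_⟩
      simp only [P_P_of_subset (Finset.Subset.refl _)]
    · exact ⟨analyticAt_const, fun x => rfl⟩
  · simp
  · intro j hj
    have : ¬ j < d - 1 := by omega
    simp [this]
  · intro x; simp only [P_P_of_subset (Finset.Subset.refl _)]
  · simp only [map_zero]
    rw [hu0, (D_shift (i := i) ha hf ha0 had' d).self_of_nhds]
    simp only [s0]
    exact div_ne_zero hD (by exact_mod_cast Nat.factorial_ne_zero _)
  · filter_upwards [(Q_tendsto S).eventually ht, hz] with x h1 h2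
    have e0 : f (shift i a x) = F (P S x) := (hFd x).symm
    have e1 : Q i (P S x) = P (S.erase i) x := by
      rw [P_P]; congr 1; congr 1; ext j; simp
    have e2 : P S x i = x i := by simp [P_apply, hi]
    rw [e0, h1, e1, e2]
    congr 1
    refine Finset.sum_congr rfl (fun j hj => ?_)
    have hj' : j < d := Finset.mem_range.mp hj
    split_ifs with hjd
    · rfl
    · have : j = d - 1 := by omega
      rw [this, h2]; simp

theorem powsub (hy : ∀ y : ℕ → Fin m → ℝ, Tendsto y 𝒰 (𝓝 0) →
    ∃ ε y', (∀ k, ε k ≠ 0) ∧ Lift 𝒰 T y (mmap ε (fun k => if k ∈ T then d.factorial • Pi.single k 1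
      else Pi.single k 1)) y')
    {A : ℕ → (Fin m → ℝ) → ℝ} (hA : ∀ j, AnalyticAt ℝ (A j) 0 ∧ Dep T (A j))
    (hNZ : ∀ j, NZ (A j))
    (hdiff : ∀ j < d, ∀ k < d, NZ (fun x => A j x ^ (d.factorial / (d-j)) -
      A k x ^ (d.factorial / (d-k))))
    (hne : ∃ j < d, ¬ ∀ᶠ x in 𝓝 0, A j x = 0) (htop : A (d-1) = fun _ => 0)
    {y : ℕ → Fin m → ℝ} (hyy : Tendsto y 𝒰 (𝓝 0)) :
    ∃ (ρ : (Fin m → ℝ) → (Fin m → ℝ)) (y' : ℕ → Fin m → ℝ), Lift 𝒰 T y ρ y' ∧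
      (∀ p, NZ p → NZ (fun x => p (ρ x))) ∧
      ∃ (γ : Fin m → ℕ) (c : ℕ → (Fin m → ℝ) → ℝ),
        (∀ j, AnalyticAt ℝ (c j) 0 ∧ Dep T (c j)) ∧ (∀ j ∉ T, γ j = 0) ∧
        (∀ x, c (d-1) x = 0) ∧ (∃ j1 < d, c j1 0 ≠ 0) ∧
        ∀ j < d, ∀ᶠ x in 𝓝 0, A j (ρ x) = mon ((d-j) • γ) x * c j x := by
  have h1 : ∀ j, ∃ α w, AnalyticAt ℝ w 0 ∧ Dep T w ∧ (∀ k ∉ T, α k = 0) ∧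
      (∀ᶠ x in 𝓝 0, A j x = mon α x * w x) ∧ (w 0 = 0 → w = fun _ => 0) := by
    intro j
    rcases hNZ j with h | h
    · exact ⟨0, fun _ => 0, analyticAt_const, fun _ => rfl, fun _ _ => rfl, by simpa using h,
        fun _ => rfl⟩
    · obtain ⟨α, w, hw, hw0, hwd, hα, he⟩ := h.restrict (hA j).2
      exact ⟨α, w, hw, hwd, hα, he, fun h => absurd h hw0⟩
  choose α w hw hwd hα he hw0 using h1
  obtain ⟨ε, y', hε, hL⟩ := hy y hyy
  set M : Fin m → Fin m → ℕ := fun k => if k ∈ T then d.factorial • Pi.single k 1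
      else Pi.single k 1 with hM
  have hM0 : ∀ k, M k ≠ 0 := by
    intro k hk
    have := congrFun hk k
    simp only [hM] at this
    split_ifs at this
    · simp at this
      exact Nat.factorial_ne_zero _ this
    · simp at this
  set g : ℕ → Fin m → ℕ := fun j => (d.factorial / (d-j)) • α j with hg
  have hcomp : ∀ j < d, ∀ k < d, w j 0 ≠ 0 → w k 0 ≠ 0 → g j ≤ g k ∨ g k ≤ g j := by
    intro j hj k hk hj0 hk0
    refine comparable (u := fun x => w j x ^ (d.factorial / (d-j)))
      (v := fun x => w k x ^ (d.factorial / (d-k))) ((hw j).pow _) ((hw k).pow _)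
      (pow_ne_zero _ hj0) (pow_ne_zero _ hk0) ?_
    refine (hdiff j hj k hk).congr ?_
    filter_upwards [he j, he k] with x h2 h3
    rw [h2, h3, mul_pow, mul_pow, hg, mon_nsmul, mon_nsmul]
  obtain ⟨j0, hj0, hj0'⟩ := hne
  have hj0w : w j0 0 ≠ 0 := by
    intro h
    apply hj0'
    filter_upwards [he j0] with x hx
    rw [hx, hw0 j0 h, mul_zero]
  classical
  obtain ⟨j1, hj1, hmin⟩ := Finset.exists_min_image ((Finset.range d).filter (fun j => w j 0 ≠ 0))
    (fun j => ∑ k, g j k) ⟨j0, by simp [hj0, hj0w]⟩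
  simp only [Finset.mem_filter, Finset.mem_range] at hj1 hmin
  have hle : ∀ j < d, w j 0 ≠ 0 → g j1 ≤ g j := by
    intro j hj hj0
    rcases hcomp j hj j1 hj1.1 hj0 hj1.2 with h | h
    · have h2 := hmin j ⟨hj, hj0⟩
      have h3 : ∑ k, g j k = ∑ k, g j1 k := le_antisymm (Finset.sum_le_sum (fun k _ => h k)) h2
      have h4 := (Finset.sum_eq_sum_iff_of_le (fun k _ => h k)).mp h3
      intro k
      exact (h4 k (Finset.mem_univ k)).ge
    · exact h
  have hgT : ∀ j, ∀ k ∉ T, g j k = 0 := by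
    intro j k hk; simp [hg, hα j k hk]
  refine ⟨mmap ε M, y', hL, fun p hp => hp.mmap hε hM0, g j1,
    fun j => if w j 0 = 0 then fun _ => 0 else
      fun x => mon (α j) ε * mon ((d-j) • (g j - g j1)) x * w j (mmap ε M x), ?_, hgT j1, ?_, ?_, ?_⟩
  · intro j
    dsimp only
    split_ifs with h
    · exact ⟨analyticAt_const, fun _ => rfl⟩
    · refine ⟨(analyticAt_const.mul (mon_analytic _ 0)).mul (hL.an_comp (hw j)), fun x => ?_⟩
      have e1 := hL.dep_comp (hwd j) x
      simp only at e1
      simp only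
      rw [e1, mon_dep (T := T) (fun k hk => ?_) x]
      simp [hgT j k hk]
  · intro x
    have : w (d-1) 0 = 0 := by
      by_contra hc
      have h2 : Normal (A (d-1)) := ⟨α (d-1), w (d-1), hw _, hc, he _⟩
      apply h2.not_zero
      rw [htop]; simp
    simp [this]
  · refine ⟨j1, hj1.1, ?_⟩
    dsimp only
    rw [if_neg hj1.2]
    simp only [tsub_self, smul_zero, mon_zero, mul_one]
    rw [mmap_zero hM0]
    exact mul_ne_zero (mon_ne_zero (fun k _ => hε k)) hj1.2
  · intro j hj
    filter_upwards [hL.tendsto.eventually (he j)] with x hx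
    rw [hx]
    split_ifs with h0
    · rw [hw0 j h0]; simp
    · rw [mon_mmap]
      have e1 : ∑ k, α j k • M k = d.factorial • α j := by
        funext l
        rw [Finset.sum_apply, Finset.sum_eq_single l]
        · by_cases hl : l ∈ T
          · simp [hM, hl, mul_comm]
          · simp [hM, hl, hα j l hl]
        · intro k _ hk
          by_cases hkT : k ∈ T
          · simp [hM, hkT, hk.symm]
          · simp [hM, hkT, hk.symm]
        · simp
      have e2 : d.factorial • α j = (d-j) • g j := by
        rw [hg, smul_smul, Nat.mul_div_cancel']
        exact Nat.dvd_factorial (by omega) (by omega)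
      have e3 : g j = g j1 + (g j - g j1) := by
        funext l
        have h5 : g j1 l ≤ g j l := hle j hj h0 l
        simp only [Pi.add_apply, Pi.sub_apply]
        omega
      have e4 : mon ((d-j) • g j) x = mon ((d-j) • g j1) x * mon ((d-j) • (g j - g j1)) x := by
        conv_lhs => rw [e3]
        rw [smul_add, mon_add]
      rw [e1, e2, e4]
      ring

theorem powlift {N : ℕ} (hN : N ≠ 0) (y : ℕ → Fin m → ℝ) (hy : Tendsto y 𝒰 (𝓝 0)) :
    ∃ ε y', (∀ k, ε k ≠ 0) ∧ Lift 𝒰 T y (mmap ε (fun k => if k ∈ T then N • Pi.single k 1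
      else Pi.single k 1)) y' := by
  classical
  have h1 : ∀ k : Fin m, ∃ e : ℝ, e ≠ 0 ∧ (k ∉ T → e = 1) ∧
      (k ∈ T → ∀ᶠ n in (𝒰 : Filter ℕ), e * |y n k| = y n k) := by
    intro k
    by_cases hk : k ∈ T
    · rcases 𝒰.em (fun n => 0 ≤ y n k) with h | h
      · exact ⟨1, one_ne_zero, fun h => absurd hk h, fun _ => by
          filter_upwards [h] with n hn; rw [abs_of_nonneg hn, one_mul]⟩
      · exact ⟨-1, by norm_num, fun h => absurd hk h, fun _ => by
          filter_upwards [h] with n hn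
          rw [abs_of_neg (not_le.mp hn)]; ring⟩
    · exact ⟨1, one_ne_zero, fun _ => rfl, fun h => absurd h hk⟩
  choose ε hε0 hε1 hε using h1
  set M : Fin m → Fin m → ℕ := fun k => if k ∈ T then N • Pi.single k 1
      else Pi.single k 1 with hM
  have hM0 : ∀ k, M k ≠ 0 := by
    intro k hk
    have := congrFun hk k
    simp only [hM] at this
    split_ifs at this
    · simp at this
      exact hN this
    · simp at this
  refine ⟨ε, fun n k => if k ∈ T then |y n k| ^ ((N:ℝ)⁻¹) else y n k, hε0, ?_⟩
  exact
    { an := mmap_analytic _ _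
      zero := mmap_zero hM0
      off := fun k hk x => by simp [mmap, hM, hk, mon_single, hε1 k hk]
      dep := fun x => by
        funext k
        rw [P_apply, P_apply]
        split_ifs with hk
        · simp only [mmap, hM, hk, if_true, mon_nsmul, mon_single, P_apply]
        · rfl
      tend := by
        rw [tendsto_pi_nhds] at hy ⊢
        intro k
        by_cases hk : k ∈ T
        · simp only [if_pos hk]
          have h2 : Tendsto (fun n => |y n k|) 𝒰 (𝓝 0) := by simpa using (hy k).abs
          have h3 := h2.rpow_const (p := (N:ℝ)⁻¹) (Or.inr (by positivity))
          simpa [hN] using h3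
        · simpa only [if_neg hk] using hy k
      eq := by
        have : ∀ᶠ n in (𝒰 : Filter ℕ), ∀ k : Fin m, k ∈ T → ε k * |y n k| = y n k := by
          rw [Filter.eventually_all]
          intro k
          by_cases hk : k ∈ T
          · filter_upwards [hε k hk] with n hn _; exact hn
          · exact Eventually.of_forall (fun n h => absurd h hk)
        filter_upwards [this] with n hn
        funext k
        by_cases hk : k ∈ T
        · simp only [mmap, hM, hk, if_true, mon_nsmul, mon_single]
          rw [Real.rpow_inv_natCast_pow (abs_nonneg _) hN]
          exact hn k hk
        · simp [mmap, hM, hk, mon_single, hε1 k hk] }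

end RT

end Part8

section Part9
open Filter Topology Asymptotics

namespace RT
variable {m : ℕ}

variable {𝒰 : Ultrafilter ℕ} {S T : Finset (Fin m)} {i : Fin m} {d : ℕ}

theorem RR_of (hN : ∀ T, T ⊂ S → NN 𝒰 T) (hi : i ∈ S) (d : ℕ) : RR 𝒰 S i d := by
  induction d using Nat.strong_induction_on with
  | _ d ih =>
  intro f hf fd hD L hL y hy
  have hT : S.erase i ⊂ S := Finset.erase_ssubset hi
  have hTs : S.erase i ⊆ S := Finset.erase_subset i S
  rcases Nat.eq_zero_or_pos d with rfl | hd
  · obtain ⟨π, y', hπ, h⟩ := hN _ hT L hL y hy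
    have hπS := hπ.mono hTs
    refine ⟨π, y', hπS, Or.inr (Normal.of_unit (hπS.an_comp hf) ?_), h⟩
    simp only [hπ.zero]
    exact hD
  by_cases hD1 : (D i)^[d-1] f 0 = 0
  swap
  · exact ih (d-1) (by omega) f hf fd hD1 L hL y hy
  obtain ⟨a, ha, ha0, had, A, u, hA, hAtop, hAbig, hu, ud, hu0, hfe⟩ := prep hf fd hi hd hD hD1
  obtain ⟨y1, hl1⟩ := Lift.shift (𝒰 := 𝒰) hi ha ha0 had hy
  let B : List ((Fin m → ℝ) → ℝ) := (List.range d).map A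
  let B2 : List ((Fin m → ℝ) → ℝ) := (List.range d).flatMap (fun j => (List.range d).map (fun k =>
    fun x => A j x ^ (d.factorial / (d-j)) - A k x ^ (d.factorial / (d-k))))
  obtain ⟨π, y2, hπ, hπL⟩ := hN _ hT (B ++ B2 ++ L) (by
    intro p hp
    simp only [List.mem_append] at hp
    rcases hp with (hp | hp) | hp
    · obtain ⟨j, -, rfl⟩ := List.mem_map.mp hp
      exact hA j
    · obtain ⟨j, -, hp⟩ := List.mem_flatMap.mp hp
      obtain ⟨k, -, rfl⟩ := List.mem_map.mp hp
      refine ⟨((hA j).1.pow _).sub ((hA k).1.pow _), fun x => ?_⟩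
      simp only [(hA j).2 x, (hA k).2 x]
    · exact hL p hp) y1 hl1.tend
  have hπS := hπ.mono hTs
  have hπi : ∀ x, π x i = x i := hπ.off i (Finset.notMem_erase i S)
  have hAπ : ∀ j, NZ (fun x => A j (π x)) := by
    intro j
    by_cases hj : j < d
    · refine hπL _ ?_
      simp only [List.mem_append]
      exact Or.inl (Or.inl (List.mem_map.mpr ⟨j, List.mem_range.mpr hj, rfl⟩))
    · rw [hAbig j (by omega)]; left; simp
  have hdiff : ∀ j < d, ∀ k < d, NZ (fun x => A j (π x) ^ (d.factorial / (d-j)) -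
      A k (π x) ^ (d.factorial / (d-k))) := by
    intro j hj k hk
    refine hπL (fun x => A j x ^ (d.factorial / (d-j)) - A k x ^ (d.factorial / (d-k))) ?_
    simp only [List.mem_append]
    exact Or.inl (Or.inr (List.mem_flatMap.mpr ⟨j, List.mem_range.mpr hj,
      List.mem_map.mpr ⟨k, List.mem_range.mpr hk, rfl⟩⟩))
  have hLπ : ∀ p ∈ L, NZ (fun x => p (π x)) := fun p hp => hπL p (by simp [hp])
  have hLs : ∀ p ∈ L, ∀ x, p (shift i a x) = p x := by
    intro p hp x
    rw [shift_eq_update, (hL p hp).2.update (Finset.notMem_erase i S)]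
  by_cases hz : ∀ j < d, ∀ᶠ x in 𝓝 0, A j (π x) = 0
  · refine ⟨_, y2, hl1.comp hπS, ?_, ?_⟩
    · right
      refine ⟨d • Pi.single i 1, fun x => u (π x), hπS.an_comp hu, by simpa [hπ.zero] using hu0, ?_⟩
      have hz' : ∀ᶠ x in 𝓝 0, ∀ j ∈ Finset.range d, A j (π x) = 0 := by
        rw [Filter.eventually_all_finset]
        intro j hj
        exact hz j (Finset.mem_range.mp hj)
      filter_upwards [hπ.tendsto.eventually hfe, hz'] with x h1 h2
      rw [h1, hπi, mon_nsmul, mon_single, Finset.sum_eq_zero, zero_add]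
      intro j hj
      rw [h2 j hj, zero_mul]
    · intro p hp
      simpa only [hLs p hp] using hLπ p hp
  · push Not at hz
    obtain ⟨ρ, y3, hρ, hρNZ, γ, c, hc, hγ, hctop, hc1, hAe⟩ := powsub (𝒰 := 𝒰) (T := S.erase i)
      (A := fun j x => A j (π x)) (d := d)
      (fun y hy => powlift (Nat.factorial_ne_zero d) y hy)
      (fun j => ⟨hπ.an_comp (hA j).1, hπ.dep_comp (hA j).2⟩) hAπ hdiff
      (by
        obtain ⟨j, hj, h⟩ := hz
        exact ⟨j, hj, Filter.not_eventually.mpr h⟩)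
      (by funext x; simp [hAtop]) hπ.tend
    have hρS := hρ.mono hTs
    have hρi : ∀ x, ρ x i = x i := hρ.off i (Finset.notMem_erase i S)
    have hl3 := (hl1.comp hπS).comp hρS
    have hsh : Sh S i d γ (fun x => f (shift i a (π (ρ x)))) (fun x => u (π (ρ x))) c :=
      { hf := hl3.an_comp hf
        fd := hl3.dep_comp fd
        hu := (hπS.comp hρS).an_comp hu
        ud := (hπS.comp hρS).dep_comp ud
        u0 := by simpa [hπ.zero, hρ.zero] using hu0
        hc := fun j => (hc j).1
        cd := fun j => (hc j).2
        γs := hγ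
        top := hctop
        eq := by
          have h' : ∀ᶠ x in 𝓝 0, ∀ j ∈ Finset.range d, A j (π (ρ x)) = mon ((d-j) • γ) x * c j x := by
            rw [Filter.eventually_all_finset]
            intro j hj
            exact hAe j (Finset.mem_range.mp hj)
          filter_upwards [(hπS.comp hρS).tendsto.eventually hfe, h'] with x h1 h2
          rw [h1, hπi, hρi]
          congr 1
          refine Finset.sum_congr rfl (fun j hj => ?_)
          rw [h2 j hj] }
    obtain ⟨θ, y4, hθ, hθf, hθL⟩ := GG hN hi ih _ γ _ _ c rfl hsh hc1
      (L.map (fun p => fun x => p (π (ρ x)))) (by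
        intro p hp
        obtain ⟨q, hq, rfl⟩ := List.mem_map.mp hp
        exact ⟨(hπS.comp hρS).an_comp (hL q hq).1, (hπ.comp hρ).dep_comp (hL q hq).2,
          hρNZ _ (hLπ q hq)⟩) y3 hρ.tend
    refine ⟨_, y4, hl3.comp hθ, hθf, ?_⟩
    intro p hp
    have := hθL _ (List.mem_map.mpr ⟨p, hp, rfl⟩)
    simpa only [hLs p hp] using this

theorem prod_list (S : Finset (Fin m)) (L : List ((Fin m → ℝ) → ℝ))
    (hL : ∀ p ∈ L, AnalyticAt ℝ p 0 ∧ Dep S p)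
    (hz : ∀ p ∈ L, ¬ ∀ᶠ x in 𝓝 0, p x = 0) :
    ∃ F, AnalyticAt ℝ F 0 ∧ Dep S F ∧ (¬ ∀ᶠ x in 𝓝 0, F x = 0) ∧ 
      (∀ p ∈ L, ∃ q, AnalyticAt ℝ q 0 ∧ ∀ x, F x = p x * q x) ∧
      ∀ π : (Fin m → ℝ) → (Fin m → ℝ), AnalyticAt ℝ π 0 → π 0 = 0 →
        (∀ᶠ x in 𝓝 0, F (π x) = 0) → ∃ p ∈ L, ∀ᶠ x in 𝓝 0, p (π x) = 0 := by
  induction L with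
  | nil => exact ⟨fun _ => 1, analyticAt_const, fun _ => rfl,
      fun h => by simpa using h.self_of_nhds, by simp,
      fun π _ _ h => by simpa using h.self_of_nhds⟩
  | cons p L ih =>
    obtain ⟨F, hF, hFd, hF0, hFq, hFπ⟩ := ih (fun q hq => hL q (List.mem_cons_of_mem _ hq))
      (fun q hq => hz q (List.mem_cons_of_mem _ hq))
    obtain ⟨hp, hpd⟩ := hL p (List.mem_cons_self ..)
    refine ⟨fun x => p x * F x, hp.mul hF, fun x => by simp only [hpd x, hFd x], ?_, ?_, ?_⟩
    · intro h
      rcases domain hp hF h with h | h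
      · exact hz p (List.mem_cons_self ..) h
      · exact hF0 h
    · intro q hq
      rcases List.mem_cons.mp hq with rfl | hq
      · exact ⟨F, hF, fun x => rfl⟩
      · obtain ⟨r, hr, hr'⟩ := hFq q hq
        exact ⟨fun x => p x * r x, hp.mul hr, fun x => by simp only [hr']; ring⟩
    · intro π hπ h0 h
      have e1 : AnalyticAt ℝ (fun x => p (π x)) 0 := by
        have : AnalyticAt ℝ p (π 0) := by rwa [h0]
        exact this.comp hπ
      have e2 : AnalyticAt ℝ (fun x => F (π x)) 0 := by
        have : AnalyticAt ℝ F (π 0) := by rwa [h0]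
        exact this.comp hπ
      rcases domain e1 e2 h with h | h
      · exact ⟨p, List.mem_cons_self .., h⟩
      · obtain ⟨q, hq, hq'⟩ := hFπ π hπ h0 h
        exact ⟨q, List.mem_cons_of_mem _ hq, hq'⟩

theorem regular {F : (Fin m → ℝ) → ℝ} (hF : AnalyticAt ℝ F 0) (hFd : Dep S F)
    (hF0 : ¬ ∀ᶠ x in 𝓝 0, F x = 0) (hi : i ∈ S) :
    ∃ w : Fin m → ℝ, P (S.erase i) w = w ∧ ∃ d, (D i)^[d] (fun x => F (x + x i • w)) 0 ≠ 0 := by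
  obtain ⟨r, hr, hball⟩ := Metric.eventually_nhds_iff_ball.mp hF.eventually_analyticAt
  have h1 : ∃ᶠ z in 𝓝 0, F z ≠ 0 := Filter.not_eventually.mp hF0
  obtain ⟨z, hz, hzr⟩ := (h1.and_eventually (Metric.ball_mem_nhds 0 hr)).exists
  have h2 : ∀ᶠ z' in 𝓝 z, F z' ≠ 0 ∧ z' ∈ Metric.ball 0 r :=
    ((hball z hzr).continuousAt.eventually_ne hz).and (Metric.isOpen_ball.mem_nhds hzr)
  obtain ⟨z', hz'0, hz', hz'r⟩ := ((dense_ne z).and_eventually h2).exists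
  have hzi := hz'0 i
  refine ⟨(z' i)⁻¹ • P (S.erase i) z', ?_, ?_⟩
  · rw [map_smul, P_P_of_subset (Finset.Subset.refl _)]
  by_contra hcon
  push Not at hcon
  set w := (z' i)⁻¹ • P (S.erase i) z' with hw
  have hwi : w i = 0 := by simp [hw, P_apply]
  have hσ : AnalyticAt ℝ (fun x : Fin m → ℝ => x + x i • w) 0 :=
    analyticAt_id.add ((coord_analytic i 0).smul analyticAt_const)
  have hFσ : AnalyticAt ℝ (fun x => F (x + x i • w)) 0 := by
    have : AnalyticAt ℝ F ((0 : Fin m → ℝ) + (0 : Fin m → ℝ) i • w) := by simpa using hF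
    exact this.comp (f := fun x : Fin m → ℝ => x + x i • w) hσ
  have hv : z' i • (ee i + w) = P S z' := by
    funext j
    by_cases hj : j = i
    · subst hj; simp [hwi, P_apply, hi]
    · simp [hj, hw, P_apply, hzi]
  have hline : ∀ t : ℝ, (t • ee i) + (t • ee i) i • w = t • (ee i + w) := by
    intro t; simp
  set φ : ℝ → ℝ := fun t => F (t • (ee i + w)) with hφ
  have hφ0 : ∀ n, iteratedDeriv n φ 0 = 0 := by
    intro n
    have h := (slice hFσ i n).self_of_nhds
    simp only [hline, zero_smul] at h
    rw [hcon n] at h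
    exact h
  have hφan : AnalyticOnNhd ℝ φ {t | t • (ee i + w) ∈ Metric.ball 0 r} := by
    intro t ht
    have : AnalyticAt ℝ F (t • (ee i + w)) := hball _ ht
    exact this.comp (f := fun t : ℝ => t • (ee i + w)) (analyticAt_id.smul analyticAt_const)
  have hconv : Convex ℝ {t : ℝ | t • (ee i + w) ∈ Metric.ball 0 r} := by
    have := (convex_ball (0 : Fin m → ℝ) r).linear_preimage
      (LinearMap.toSpanSingleton ℝ _ (ee i + w))
    exact this
  have h0mem : (0:ℝ) ∈ {t : ℝ | t • (ee i + w) ∈ Metric.ball 0 r} := by simpa using hr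
  have hz0 : φ =ᶠ[𝓝 0] 0 := by
    have : analyticOrderAt φ 0 = ⊤ := by
      rw [ENat.eq_top_iff_forall_ge]
      intro n
      rw [natCast_le_analyticOrderAt_iff_iteratedDeriv_eq_zero (hφan 0 h0mem)]
      intro k _
      exact hφ0 k
    exact analyticOrderAt_eq_top.mp this
  have := hφan.eqOn_zero_of_preconnected_of_eventuallyEq_zero hconv.isPreconnected h0mem hz0
    (x := z' i) (by
      simp only [Set.mem_ofPred_eq, hv]
      have h3 := (P S).le_of_opNorm_le (P_norm_le S) z'
      simp only [mem_ball_zero_iff] at hz'r ⊢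
      linarith)
  simp only [hφ, hv, hFd z'] at this
  exact hz' this

theorem NN_all (𝒰 : Ultrafilter ℕ) (S : Finset (Fin m)) : NN 𝒰 S := by
  induction S using Finset.strongInduction with
  | H S ihS =>
  rcases S.eq_empty_or_nonempty with rfl | ⟨i, hi⟩
  · intro L hL y hy
    refine ⟨id, y, Lift.refl hy, fun f hf => ?_⟩
    have hc : ∀ x, f x = f 0 := by
      intro x
      rw [← (hL f hf).2]
      exact congrArg f (by funext j; simp [P_apply])
    by_cases h0 : f 0 = 0
    · left; simp [hc, h0]
    · right; exact Normal.of_unit (hL f hf).1 h0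
  · have main : ∀ n, ∀ L : List ((Fin m → ℝ) → ℝ), L.length = n →
        (∀ f ∈ L, AnalyticAt ℝ f 0 ∧ Dep S f) →
        ∀ y : ℕ → Fin m → ℝ, Tendsto y 𝒰 (𝓝 0) →
        ∃ π y', Lift 𝒰 S y π y' ∧ ∀ f ∈ L, NZ (fun x => f (π x)) := by
      intro n
      induction n with
      | zero =>
        intro L hlen _ y hy
        rw [List.length_eq_zero_iff] at hlen
        subst hlen
        exact ⟨id, y, Lift.refl hy, by simp⟩
      | succ n ih =>
        have zero_case : ∀ L : List ((Fin m → ℝ) → ℝ), L.length = n + 1 →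
            (∀ f ∈ L, AnalyticAt ℝ f 0 ∧ Dep S f) → (∃ p ∈ L, ∀ᶠ x in 𝓝 0, p x = 0) →
            ∀ y : ℕ → Fin m → ℝ, Tendsto y 𝒰 (𝓝 0) →
            ∃ π y', Lift 𝒰 S y π y' ∧ ∀ f ∈ L, NZ (fun x => f (π x)) := by
          intro L hlen hL ⟨p, hp, hp0⟩ y hy
          obtain ⟨L1, L2, rfl⟩ := List.append_of_mem hp
          obtain ⟨π, y', hπ, h⟩ := ih (L1 ++ L2) (by simp at hlen ⊢; omega)
            (fun f hf => hL f (by simp at hf ⊢; tauto)) y hy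
          refine ⟨π, y', hπ, fun f hf => ?_⟩
          simp only [List.mem_append, List.mem_cons] at hf
          rcases hf with hf | rfl | hf
          · exact h f (by simp [hf])
          · left; exact hπ.tendsto.eventually hp0
          · exact h f (by simp [hf])
        intro L hlen hL y hy
        by_cases hz : ∃ p ∈ L, ∀ᶠ x in 𝓝 0, p x = 0
        · exact zero_case L hlen hL hz y hy
        · push Not at hz
          obtain ⟨F, hF, hFd, hF0, hFq, hFπ⟩ := prod_list S L hL (fun p hp => Filter.not_eventually.mpr (hz p hp))
          obtain ⟨w, hw, d, hd⟩ := regular hF hFd hF0 hi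
          have hwi : w i = 0 := by rw [← hw]; simp [P_apply]
          have hwS : P S w = w := by
            rw [← hw]; exact P_P_of_subset' (Finset.erase_subset i S) w
          have hσ : Lift 𝒰 S y (fun x => x + x i • w) (fun n => y n - y n i • w) :=
            { an := analyticAt_id.add ((coord_analytic i 0).smul analyticAt_const)
              zero := by simp
              off := fun j hj x => by
                have : w j = 0 := by rw [← hwS]; simp [P_apply, hj]
                simp [this]
              dep := fun x => by
                simp only [map_add, map_smul, P_P_of_subset (Finset.Subset.refl S)]
                simp [P_apply, hi]
              tend := by
                have h1 := (coord_tendsto hy i).smul_const w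
                simpa using hy.sub h1
              eq := by
                refine Eventually.of_forall (fun n => ?_)
                simp [hwi] }
          obtain ⟨π, y', hπ, hFNZ, -⟩ := RR_of ihS hi d _ (hσ.an_comp hF) (hσ.dep_comp hFd) hd []
            (by simp) _ hσ.tend
          have hσπ := hσ.comp hπ
          rcases hFNZ with h0 | hnorm
          · obtain ⟨p, hp, hp0⟩ := hFπ _ hσπ.an hσπ.zero h0
            obtain ⟨θ, y'', hθ, h⟩ := zero_case (L.map (fun p => fun x => p (π x + π x i • w)))
              (by simpa using hlen) (by
                intro q hq
                obtain ⟨r, hr, rfl⟩ := List.mem_map.mp hq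
                exact ⟨hσπ.an_comp (hL r hr).1, hσπ.dep_comp (hL r hr).2⟩)
              ⟨_, List.mem_map.mpr ⟨p, hp, rfl⟩, hp0⟩ y' hπ.tend
            exact ⟨_, y'', hσπ.comp hθ, fun q hq => h _ (List.mem_map.mpr ⟨q, hq, rfl⟩)⟩
          · refine ⟨_, y', hσπ, fun p hp => Or.inr ?_⟩
            obtain ⟨q, hq, hq'⟩ := hFq p hp
            refine normal_of_mul (hσπ.an_comp (hL p hp).1) (hσπ.an_comp hq) ?_
            exact hnorm.congr (Eventually.of_forall (fun x => hq' _))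
    intro L hL y hy
    exact main _ L rfl hL y hy

end RT

end Part9

section Part10
open Filter Topology Asymptotics

namespace RT
variable {m : ℕ}

theorem int_weights (α β : Fin m → ℕ) (z : Fin m → ℝ) (hz0 : ∀ j, z j ≠ 0) (hz1 : ∀ j, |z j| < 1)
    (h : |mon β z| < |mon α z|) :
    ∃ a : Fin m → ℕ, (∀ j, 0 < a j) ∧ ∑ j, α j * a j < ∑ j, β j * a j := by
  have hL : ∀ j, 0 < -Real.log |z j| := fun j => by
    have := Real.log_neg (abs_pos.mpr (hz0 j)) (hz1 j)
    linarith
  have hlog : ∀ γ : Fin m → ℕ, Real.log |mon γ z| = -∑ j, (γ j : ℝ) * (-Real.log |z j|) := by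
    intro γ
    unfold mon
    rw [Finset.abs_prod, Real.log_prod (fun j _ => by simp [hz0 j])]
    simp [abs_pow, Real.log_pow]
  have hβ : mon β z ≠ 0 := mon_ne_zero (fun j _ => hz0 j)
  have h1 := Real.log_lt_log (abs_pos.mpr hβ) h
  rw [hlog, hlog] at h1
  have h2 : ∀ γ : Fin m → ℕ, Tendsto (fun N : ℝ => ∑ j, (γ j : ℝ) * ((⌈(-Real.log |z j|) * N⌉₊ : ℝ) / N))
      atTop (𝓝 (∑ j, (γ j : ℝ) * (-Real.log |z j|))) := by
    intro γ
    refine tendsto_finsetSum _ (fun j _ => ?_)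
    exact (tendsto_nat_ceil_mul_div_atTop (hL j).le).const_mul _
  have h3 := (h2 α).eventually_lt (h2 β) (by linarith)
  obtain ⟨N, hN, hN0⟩ := (h3.and (eventually_gt_atTop 0)).exists
  refine ⟨fun j => ⌈(-Real.log |z j|) * N⌉₊, fun j => Nat.ceil_pos.mpr (mul_pos (hL j) hN0), ?_⟩
  simp only [← mul_div_assoc, ← Finset.sum_div] at hN
  rw [div_lt_div_iff_of_pos_right hN0] at hN
  exact_mod_cast hN

theorem mon_curve (γ a : Fin m → ℕ) (t : ℝ) :
    mon γ (fun j => t ^ a j) = t ^ (∑ j, γ j * a j) := by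
  unfold mon
  rw [← Finset.prod_pow_eq_pow_sum]
  exact Finset.prod_congr rfl (fun j _ => by rw [← pow_mul, mul_comm])

theorem curve_selection {A B : (Fin m → ℝ) → ℝ} (hA : AnalyticAt ℝ A 0) (hB : AnalyticAt ℝ B 0)
    (hA0 : ∀ x, 0 ≤ A x) (hB0 : ∀ x, 0 ≤ B x) (h : ∀ C : ℝ, ∃ᶠ x in 𝓝 0, C * B x < A x) :
    ∃ c : ℝ → Fin m → ℝ, AnalyticAt ℝ c 0 ∧ c 0 = 0 ∧ (∀ᶠ t in 𝓝[>] 0, 0 < A (c t)) ∧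
      ∀ C : ℝ, ∀ᶠ t in 𝓝[>] 0, C * B (c t) ≤ A (c t) := by
  have hy : ∀ n : ℕ, ∃ x : Fin m → ℝ, n * B x < A x ∧ x ∈ Metric.ball 0 (1 / ((n : ℝ) + 1)) := fun n =>
    ((h n).and_eventually (Metric.ball_mem_nhds 0 Nat.one_div_pos_of_nat)).exists
  choose y hyA hyb using hy
  have hyt : Tendsto y atTop (𝓝 0) := by
    rw [tendsto_iff_dist_tendsto_zero]
    exact squeeze_zero (fun _ => dist_nonneg) (fun n => (Metric.mem_ball.mp (hyb n)).le)
      tendsto_one_div_add_atTop_nhds_zero_nat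
  have hle : ((hyperfilter ℕ : Ultrafilter ℕ) : Filter ℕ) ≤ atTop := Nat.hyperfilter_le_atTop
  have hdep : ∀ f : (Fin m → ℝ) → ℝ, Dep Finset.univ f := fun f x => by
    congr 1; funext j; simp [P_apply]
  obtain ⟨π, y', hπ, hNZ⟩ := NN_all (hyperfilter ℕ) (Finset.univ : Finset (Fin m)) [A, B]
    (by
      intro f hf
      simp only [List.mem_cons, List.not_mem_nil, or_false] at hf
      rcases hf with rfl | rfl
      exacts [⟨hA, hdep _⟩, ⟨hB, hdep _⟩]) y (hyt.mono_left hle)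
  have hAN := hNZ A (by simp)
  have hBN := hNZ B (by simp)
  have hpos : ∀ᶠ n in (hyperfilter ℕ : Filter ℕ), n * B (π (y' n)) < A (π (y' n)) := by
    filter_upwards [hπ.eq] with n hn
    rw [hn]; exact hyA n
  unfold NZ Normal at hAN hBN
  dsimp only at hAN hBN
  rcases hAN with hAN | ⟨α, u, hu, hu0, hAe⟩
  · exfalso
    obtain ⟨n, h1, h2⟩ := (hpos.and (hπ.tend.eventually hAN)).exists
    rw [h2] at h1
    have := mul_nonneg (Nat.cast_nonneg (α := ℝ) n) (hB0 (π (y' n)))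
    linarith
  -- facts for any curve
  have gen : ∀ a : Fin m → ℕ, (∀ j, 0 < a j) → 
      AnalyticAt ℝ (fun t : ℝ => (fun j => t ^ a j : Fin m → ℝ)) 0 ∧
      (fun j => (0:ℝ) ^ a j : Fin m → ℝ) = 0 ∧
      Tendsto (fun t : ℝ => (fun j => t ^ a j : Fin m → ℝ)) (𝓝[>] 0) (𝓝 0) := by
    intro a ha
    have e1 : AnalyticAt ℝ (fun t : ℝ => (fun j => t ^ a j : Fin m → ℝ)) 0 := by
      rw [analyticAt_pi_iff]
      exact fun j => analyticAt_id.pow _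
    have e2 : (fun j => (0:ℝ) ^ a j : Fin m → ℝ) = 0 := by
      funext j; simp [(ha j).ne']
    refine ⟨e1, e2, ?_⟩
    have := e1.continuousAt.tendsto
    rw [e2] at this
    exact this.mono_left nhdsWithin_le_nhds
  have upos : ∀ a : Fin m → ℕ, (∀ j, 0 < a j) → 0 < u 0 := by
    intro a ha
    have ht := (gen a ha).2.2
    refine lt_of_le_of_ne ?_ hu0.symm
    refine ge_of_tendsto (hu.continuousAt.tendsto.comp ht) ?_
    filter_upwards [ht.eventually hAe, self_mem_nhdsWithin] with t h1 h2
    have h3 := hA0 (π (fun j => t ^ a j))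
    rw [h1, mon_curve] at h3
    exact nonneg_of_mul_nonneg_right h3 (pow_pos h2 _)
  have Apos : ∀ a : Fin m → ℕ, (∀ j, 0 < a j) → ∀ᶠ t in 𝓝[>] (0:ℝ), 0 < A (π (fun j => t ^ a j)) := by
    intro a ha
    have ht := (gen a ha).2.2
    filter_upwards [ht.eventually hAe, self_mem_nhdsWithin,
      (hu.continuousAt.tendsto.comp ht).eventually (lt_mem_nhds (upos a ha))] with t h1 h2 h3
    rw [h1, mon_curve]
    exact mul_pos (pow_pos h2 _) h3
  have can : ∀ a : Fin m → ℕ, (∀ j, 0 < a j) →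
      AnalyticAt ℝ (fun t : ℝ => π (fun j => t ^ a j)) 0 ∧ π (fun j => (0:ℝ) ^ a j) = 0 := by
    intro a ha
    obtain ⟨e1, e2, -⟩ := gen a ha
    refine ⟨?_, by rw [e2, hπ.zero]⟩
    have : AnalyticAt ℝ π (fun j => (0:ℝ) ^ a j) := by rw [e2]; exact hπ.an
    exact this.comp (f := fun t : ℝ => (fun j => t ^ a j : Fin m → ℝ)) e1
  rcases hBN with hBN | ⟨β, w, hw, hw0, hBe⟩
  · have ha : ∀ j : Fin m, 0 < (fun _ => 1 : Fin m → ℕ) j := fun j => one_pos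
    refine ⟨_, (can _ ha).1, (can _ ha).2, Apos _ ha, fun C => ?_⟩
    filter_upwards [(gen _ ha).2.2.eventually hBN] with t h1
    rw [h1, mul_zero]
    exact hA0 _
  -- find a good point
  have hM : ∀ᶠ n : ℕ in (hyperfilter ℕ : Filter ℕ), 4 * |u 0| / |w 0| < n :=
    (tendsto_natCast_atTop_atTop.eventually (eventually_gt_atTop _)).filter_mono hle
  have hub : ∀ᶠ x in 𝓝 (0 : Fin m → ℝ), |u x| < 2 * |u 0| :=
    hu.continuousAt.abs.eventually (gt_mem_nhds (by have := abs_pos.mpr hu0; linarith))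
  have hwb : ∀ᶠ x in 𝓝 (0 : Fin m → ℝ), |w 0| / 2 < |w x| :=
    hw.continuousAt.abs.eventually (lt_mem_nhds (by have := abs_pos.mpr hw0; linarith))
  have hsm : ∀ᶠ x in 𝓝 (0 : Fin m → ℝ), x ∈ Metric.ball (0 : Fin m → ℝ) 1 :=
    Metric.ball_mem_nhds 0 one_pos
  obtain ⟨n, h1, h2, h3, h4, h5, h6, h7⟩ := (hpos.and (hM.and (hπ.tend.eventually
    (hAe.and (hBe.and (hub.and (hwb.and hsm))))))).exists
  set z := y' n
  have hz : |mon β z| < |mon α z| := by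
    have hu' := abs_pos.mpr hu0
    have hw' := abs_pos.mpr hw0
    have hA' : A (π z) = |mon α z| * |u z| := by rw [← abs_mul, ← h3, abs_of_nonneg (hA0 _)]
    have hB' : B (π z) = |mon β z| * |w z| := by rw [← abs_mul, ← h4, abs_of_nonneg (hB0 _)]
    rw [hA', hB'] at h1
    by_contra hcon
    push Not at hcon
    have e1 : |mon α z| * |u z| ≤ |mon β z| * (2 * |u 0|) :=
      mul_le_mul hcon h5.le (abs_nonneg _) (abs_nonneg _)
    have e2 : 2 * |u 0| ≤ n * |w z| := by
      rw [div_lt_iff₀ hw'] at h2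
      have : (n:ℝ) * (|w 0| / 2) ≤ n * |w z| := mul_le_mul_of_nonneg_left h6.le (Nat.cast_nonneg n)
      linarith
    have e3 := mul_le_mul_of_nonneg_left e2 (abs_nonneg (mon β z))
    linarith
  have hzn : ∀ᶠ x in 𝓝 z, |mon β x| < |mon α x| :=
    ((mon_analytic β z).continuousAt.abs.tendsto).eventually_lt
      ((mon_analytic α z).continuousAt.abs.tendsto) hz
  obtain ⟨z', hz0, hz1, hz2⟩ := ((dense_ne z).and_eventually
    (hzn.and (Metric.isOpen_ball.mem_nhds h7))).exists
  obtain ⟨a, ha, hlt⟩ := int_weights α β z' hz0 (fun j => by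
    have := norm_le_pi_norm z' j
    have h8 : ‖z'‖ < 1 := mem_ball_zero_iff.mp hz2
    exact lt_of_le_of_lt this h8) hz1
  refine ⟨_, (can a ha).1, (can a ha).2, Apos a ha, fun C => ?_⟩
  have ht := (gen a ha).2.2
  obtain ⟨r, hr⟩ := Nat.exists_eq_add_of_lt hlt
  have hlim : Tendsto (fun t : ℝ => C * (t ^ (r + 1) * w (fun j => t ^ a j))) (𝓝[>] 0) (𝓝 0) := by
    have e1 : Tendsto (fun t : ℝ => t ^ (r+1)) (𝓝[>] 0) (𝓝 0) := by
      have := (continuous_pow (M := ℝ) (r+1)).tendsto 0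
      simp only [zero_pow (Nat.succ_ne_zero r)] at this
      exact this.mono_left nhdsWithin_le_nhds
    have e2 := (e1.mul (hw.continuousAt.tendsto.comp ht)).const_mul C
    simpa using e2
  filter_upwards [ht.eventually hAe, ht.eventually hBe, self_mem_nhdsWithin,
    hlim.eventually_lt (hu.continuousAt.tendsto.comp ht) (upos a ha)] with t h1 h2 h3 h4
  rw [h1, h2, mon_curve, mon_curve, hr]
  have := mul_le_mul_of_nonneg_left h4.le (pow_nonneg (le_of_lt h3) (∑ j, α j * a j))
  simp only [Function.comp] at this
  calc _ = t ^ (∑ j, α j * a j) * (C * (t ^ (r + 1) * w fun j => t ^ a j)) := by ring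
    _ ≤ _ := this

end RT

end Part10

section Part11
open Filter Topology Asymptotics

namespace RT

section taylor
variable {E : Type*} [NormedAddCommGroup E] [NormedSpace ℝ E]

theorem ev_punct {p : E → Prop} (h : ∀ᶠ x in 𝓝[≠] (0:E), p x) :
    ∀ᶠ x in 𝓝[≠] (0:E), x ≠ 0 ∧ ∀ᶠ y in 𝓝 x, p y ∧ y ≠ 0 := by
  have h1 := eventually_eventually_nhdsWithin.mpr h
  filter_upwards [h1, self_mem_nhdsWithin] with x hx hx0
  have hx0' : x ≠ 0 := hx0
  refine ⟨hx0', ?_⟩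
  have hmem : ({0}ᶜ : Set E) ∈ 𝓝 x := isOpen_compl_singleton.mem_nhds hx0
  rw [nhdsWithin_eq_nhds.mpr hmem] at hx
  exact hx.and hmem

/-- radial derivative -/
noncomputable def GJ (f : E → ℝ) (j : ℕ) (x : E) : ℝ := iteratedFDeriv ℝ j f x (fun _ => x)

noncomputable def MJ (f : E → ℝ) (j : ℕ) (x v : E) : ℝ :=
  iteratedFDeriv ℝ (j+1) f x (Fin.cons v (fun _ => x))

noncomputable def MP (f : E → ℝ) : ℕ → E → E → ℝ
  | 0, _, _ => 0
  | j+1, x, v => MJ f j x v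

theorem MJ_self (f : E → ℝ) (j : ℕ) (x : E) : MJ f j x x = GJ f (j+1) x := by
  unfold MJ GJ
  congr 1
  funext l
  refine Fin.cases ?_ (fun _ => ?_) l <;> simp

theorem MP_self (f : E → ℝ) (j : ℕ) (x : E) : (j : ℝ) * MP f j x x = j * GJ f j x := by
  cases j with
  | zero => simp
  | succ j => simp only [MP, MJ_self]

theorem GJ_deriv {f : E → ℝ} {x : E} (hf : AnalyticAt ℝ f x) (j : ℕ) :
    ∃ L : E →L[ℝ] ℝ, HasFDerivAt (GJ f j) L x ∧
      ∀ v, L v = MJ f j x v + (j : ℝ) * MP f j x v := by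
  have h1 : HasFDerivAt (iteratedFDeriv ℝ j f) (fderiv ℝ (iteratedFDeriv ℝ j f) x) x := by
    refine DifferentiableAt.hasFDerivAt ?_
    exact (hf.contDiffAt (n := (j+1 : ℕ))).differentiableAt_iteratedFDeriv (by exact_mod_cast Nat.lt_succ_self j)
  have h2 := h1.continuousMultilinearMap_apply (g := fun _ y => y)
    (g' := fun _ => ContinuousLinearMap.id ℝ E) (fun _ => hasFDerivAt_id x)
  refine ⟨_, h2, fun v => ?_⟩
  have e0 : (fderiv ℝ (iteratedFDeriv ℝ j f) x v) (fun _ => x) = MJ f j x v := by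
    unfold MJ
    rw [iteratedFDeriv_succ_apply_left]
    simp
  simp only [add_apply, ContinuousLinearMap.comp_apply,
    ContinuousMultilinearMap.apply_apply, sum_apply, e0,
    ContinuousLinearMap.id_apply]
  congr 1
  cases j with
  | zero => simp
  | succ j =>
    have : ∀ l : Fin (j+1), (iteratedFDeriv ℝ (j+1) f x) (Function.update (fun _ => x) l v) =
        MJ f j x v := by
      intro l
      unfold MJ
      rw [← (hf.contDiffAt).iteratedFDeriv_comp_perm (Fin.cons v (fun _ => x)) (Equiv.swap 0 l)]
      congr 1
      funext i
      by_cases hi : i = l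
      · subst hi; simp
      · rw [Function.update_of_ne hi]
        simp only [Function.comp]
        by_cases h0 : i = 0
        · subst h0
          rw [Equiv.swap_apply_left]
          obtain ⟨l', rfl⟩ := Fin.exists_succ_eq.mpr (Ne.symm hi)
          simp
        · rw [Equiv.swap_apply_of_ne_of_ne h0 hi]
          obtain ⟨i', rfl⟩ := Fin.exists_succ_eq.mpr h0
          simp
    simp [this, MP]

/-- the Taylor sum -/
noncomputable def TT (f : E → ℝ) (k : ℕ) (x : E) : ℝ :=
  ∑ j ∈ Finset.range (k+1), ((-1 : ℝ) ^ j / (Nat.factorial j : ℝ)) * GJ f j x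

theorem TT_deriv {f : E → ℝ} {x : E} (hf : AnalyticAt ℝ f x) (k : ℕ) :
    ∃ L : E →L[ℝ] ℝ, HasFDerivAt (TT f k) L x ∧
      ∀ v, L v = ((-1 : ℝ) ^ k / (Nat.factorial k : ℝ)) * MJ f k x v := by
  induction k with
  | zero =>
    obtain ⟨L, hL, hv⟩ := GJ_deriv hf 0
    have e : TT f 0 = GJ f 0 := by funext y; simp [TT]
    rw [e]
    exact ⟨L, hL, fun v => by simp [hv, MP]⟩
  | succ k ih =>
    obtain ⟨L1, hL1, hv1⟩ := ih
    obtain ⟨L, hL, hv⟩ := GJ_deriv hf (k+1)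
    have e : TT f (k+1) = fun y => TT f k y +
        ((-1 : ℝ) ^ (k+1) / (Nat.factorial (k+1) : ℝ)) * GJ f (k+1) y := by
      funext y; simp only [TT, Finset.sum_range_succ _ (k+1)]
    rw [e]
    refine ⟨_, hL1.add (hL.const_mul _), fun v => ?_⟩
    simp only [add_apply, smul_apply, hv1, hv, MP, smul_eq_mul]
    rw [Nat.factorial_succ]
    have h1 : (k.factorial : ℝ) ≠ 0 := by positivity
    have h2 : ((k:ℝ) + 1) ≠ 0 := by positivity
    push_cast
    field_simp
    ring
end taylor

section inner
variable {E : Type*} [NormedAddCommGroup E] [InnerProductSpace ℝ E]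

theorem norm_deriv {x : E} (hx : x ≠ 0) :
    HasFDerivAt (fun y : E => ‖y‖) (‖x‖⁻¹ • innerSL ℝ x) x := by
  have h := (hasStrictFDerivAt_norm_sq x).hasFDerivAt.sqrt (by simpa using hx)
  simp only [Real.sqrt_sq (norm_nonneg _)] at h
  convert! h using 1
  ext v
  simp
  ring

theorem nsq_analytic (x : E) : AnalyticAt ℝ (fun y : E => ‖y‖ ^ 2) x := by
  have := (innerSL ℝ (E := E)).analyticAt_bilinear (x, x)
  have h2 := this.comp₂ (f := fun y : E => y) (g := fun y : E => y) (x := x) analyticAt_id analyticAt_id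
  refine h2.congr (Eventually.of_forall fun y => ?_)
  exact real_inner_self_eq_norm_sq y

theorem clm_app {F G : Type*} [NormedAddCommGroup F] [NormedSpace ℝ F] [NormedAddCommGroup G]
    [NormedSpace ℝ G] {a : E → F →L[ℝ] G} {b : E → F} {x : E} (ha : AnalyticAt ℝ a x)
    (hb : AnalyticAt ℝ b x) : AnalyticAt ℝ (fun y => a y (b y)) x :=
  ((ContinuousLinearMap.id ℝ (F →L[ℝ] G)).analyticAt_bilinear (a x, b x)).comp₂ ha hb

theorem GJ_form {f g : E → ℝ} (hg : AnalyticAt ℝ g 0)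
    (hf : ∀ᶠ x in 𝓝[≠] (0:E), AnalyticAt ℝ f x ∧ f x = ‖x‖ * g x) (j : ℕ) :
    ∃ K : E → ℝ, AnalyticAt ℝ K 0 ∧ ∀ᶠ x in 𝓝[≠] (0:E), GJ f j x = ‖x‖ * K x := by
  induction j with
  | zero => exact ⟨g, hg, hf.mono fun x hx => by simp [GJ, hx.2]⟩
  | succ j ih =>
    obtain ⟨K, hK, hG⟩ := ih
    refine ⟨fun x => K x + fderiv ℝ K x x - j * K x, ?_, ?_⟩
    · exact (hK.add (clm_app hK.fderiv analyticAt_id)).sub (analyticAt_const.mul hK)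
    · filter_upwards [ev_punct hG, hf, hK.eventually_analyticAt.filter_mono nhdsWithin_le_nhds]
        with x ⟨hx0, hx⟩ hfx hKx
      obtain ⟨L, hL, hv⟩ := GJ_deriv hfx.1 j
      have h1 : HasFDerivAt (GJ f j) _ x :=
        ((norm_deriv hx0).mul hKx.differentiableAt.hasFDerivAt).congr_of_eventuallyEq
          (hx.mono fun y hy => hy.1)
      have h2 := congrArg (fun M : E →L[ℝ] ℝ => M x) (hL.unique h1)
      simp only [hv, MJ_self, MP_self] at h2
      have hn : ‖x‖ ≠ 0 := norm_ne_zero_iff.mpr hx0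
      have h5 := hx.self_of_nhds.1
      simp only [h5, add_apply, smul_apply,
        innerSL_apply_apply, real_inner_self_eq_norm_sq, smul_eq_mul] at h2
      field_simp at h2
      linarith

end inner

end RT

end Part11

section Part12
open Filter Topology Asymptotics

namespace RT

section inner
variable {E : Type*} [NormedAddCommGroup E] [InnerProductSpace ℝ E]

theorem form_deriv {F : Type*} [NormedAddCommGroup F] [NormedSpace ℝ F] [CompleteSpace F]
    {h Q : E → F} (j : ℕ)
    (hQ : AnalyticAt ℝ Q 0) (hh : ∀ᶠ x in 𝓝[≠] (0:E), (‖x‖ ^ 2) ^ j • h x = ‖x‖ • Q x)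
    (hd : ∀ᶠ x in 𝓝[≠] (0:E), DifferentiableAt ℝ h x) :
    ∃ R : E → E →L[ℝ] F, AnalyticAt ℝ R 0 ∧
      ∀ᶠ x in 𝓝[≠] (0:E), (‖x‖ ^ 2) ^ (j+1) • fderiv ℝ h x = ‖x‖ • R x := by
  have hR : AnalyticAt ℝ (fun x : E => (innerSL ℝ x).smulRight (Q x)) 0 := by
    have h1 := (ContinuousLinearMap.smulRightL ℝ E F).analyticAt_bilinear (innerSL ℝ (0:E), Q 0)
    exact h1.comp₂ (f := fun x : E => innerSL ℝ x) (g := Q) ((innerSL ℝ (E := E)).analyticAt 0) hQ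
  refine ⟨fun x => ‖x‖ ^ 2 • fderiv ℝ Q x + (1 - 2 * (j:ℝ)) • (innerSL ℝ x).smulRight (Q x),
    ((nsq_analytic 0).fun_smul hQ.fderiv).add ((analyticAt_const (v := 1 - 2 * (j:ℝ))).fun_smul hR), ?_⟩
  filter_upwards [ev_punct hh, hd, hQ.eventually_analyticAt.filter_mono nhdsWithin_le_nhds]
    with x ⟨hx0, hx⟩ hdx hQx
  have hn : ‖x‖ ≠ 0 := norm_ne_zero_iff.mpr hx0
  have e1 := (norm_deriv hx0).smul hQx.differentiableAt.hasFDerivAt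
  have e2 := ((hasStrictFDerivAt_norm_sq x).hasFDerivAt.pow j).smul hdx.hasFDerivAt
  have e3 := e2.unique (e1.congr_of_eventuallyEq (hx.mono fun y hy => hy.1))
  have hx1 := hx.self_of_nhds.1
  ext v
  have e4 := congrArg (fun M : E →L[ℝ] F => M v) e3
  simp only [add_apply, smul_apply, ContinuousLinearMap.smulRight_apply, innerSL_apply_apply,
    smul_eq_mul] at e4 ⊢
  have e5 : (‖x‖ ^ 2) ^ j • (fderiv ℝ h x) v = ‖x‖ • (fderiv ℝ Q x) v +
      (‖x‖⁻¹ * inner ℝ x v) • Q x - ((j:ℝ) * (‖x‖ ^ 2) ^ (j-1) * (2 * inner ℝ x v)) • h x := by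
    rw [← e4]
    simp
  have e6 : (‖x‖ ^ 2 * ((j:ℝ) * (‖x‖ ^ 2) ^ (j-1) * (2 * inner ℝ x v))) • h x = 
      (2 * j * inner ℝ x v * ‖x‖) • Q x := by
    rw [← smul_smul _ _ (Q x), ← hx1, smul_smul]
    congr 1
    cases j with
    | zero => simp
    | succ j => simp only [Nat.add_sub_cancel]; ring
  rw [pow_succ', mul_smul, e5, smul_sub, smul_add, smul_smul _ _ (h x), e6]
  simp only [smul_add, smul_smul]
  rw [add_sub_assoc, ← sub_smul]
  congr 2
  · ring
  · field_simp

theorem iter_form {f g : E → ℝ} (hg : AnalyticAt ℝ g 0)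
    (hf : ∀ᶠ x in 𝓝[≠] (0:E), AnalyticAt ℝ f x ∧ f x = ‖x‖ * g x) (j : ℕ) :
    ∃ Q : E → E [×j]→L[ℝ] ℝ, AnalyticAt ℝ Q 0 ∧
      ∀ᶠ x in 𝓝[≠] (0:E), (‖x‖ ^ 2) ^ j • iteratedFDeriv ℝ j f x = ‖x‖ • Q x := by
  induction j with
  | zero =>
    refine ⟨fun x => (continuousMultilinearCurryFin0 ℝ E ℝ).symm (g x), ?_, ?_⟩
    · exact ((continuousMultilinearCurryFin0 ℝ E ℝ).symm.toContinuousLinearEquiv.toContinuousLinearMap.analyticAt _).comp hg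
    · filter_upwards [hf] with x hx
      ext v
      simp [hx.2]
  | succ j ih =>
    obtain ⟨Q, hQ, h⟩ := ih
    obtain ⟨R, hR, h'⟩ := form_deriv j hQ h (hf.mono fun x hx =>
      (hx.1.contDiffAt (n := (j+1 : ℕ))).differentiableAt_iteratedFDeriv
        (by exact_mod_cast Nat.lt_succ_self j))
    refine ⟨fun x => (continuousMultilinearCurryLeftEquiv ℝ (fun _ : Fin (j + 1) => E) ℝ).symm (R x),
      ?_, ?_⟩
    · exact ((continuousMultilinearCurryLeftEquiv ℝ (fun _ : Fin (j + 1) => E) ℝ).symm.toContinuousLinearEquiv.toContinuousLinearMap.analyticAt _).comp hR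
    · filter_upwards [h'] with x hx
      rw [iteratedFDeriv_succ_eq_comp_left, Function.comp, ← map_smul, hx, map_smul]

end inner

theorem ord_lemma {F : Type*} [NormedAddCommGroup F] [NormedSpace ℝ F] [CompleteSpace F]
    {φ : ℝ → F} (hφ : AnalyticAt ℝ φ 0)
    (h0 : φ 0 = 0) (hne : ¬ ∀ᶠ t in 𝓝 0, φ t = 0) :
    ∃ C : ℝ, 0 ≤ C ∧ ∀ᶠ t in 𝓝[>] (0:ℝ), t * ‖deriv φ t‖ ≤ C * ‖φ t‖ ∧ ‖φ t‖ ≤ C * (t * ‖deriv φ t‖) := by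
  obtain ⟨n, ψ, hψ, hψ0, he⟩ := hφ.exists_eventuallyEq_pow_smul_nonzero_iff.mpr hne
  simp only [sub_zero] at he
  have hn : n ≠ 0 := by
    rintro rfl
    have := he.self_of_nhds
    simp [h0] at this
    exact hψ0 this.symm
  obtain ⟨n, rfl⟩ := Nat.exists_eq_succ_of_ne_zero hn
  set b := ‖ψ 0‖ with hb
  have hbpos : 0 < b := norm_pos_iff.mpr hψ0
  -- t φ' = t^(n+1) ((n+1) ψ + t ψ')
  have hd : ∀ᶠ t in 𝓝 (0:ℝ), t • deriv φ t = t ^ (n+1) • (((n:ℝ)+1) • ψ t + t • deriv ψ t) := by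
    filter_upwards [eventually_eventually_nhds.mpr he, hψ.eventually_analyticAt] with t h1 h2
    have e := (hasDerivAt_pow (n+1) t).smul h2.differentiableAt.hasDerivAt
    have e' : deriv φ t = _ := (e.congr_of_eventuallyEq h1).deriv
    rw [e']
    simp only [smul_add, smul_smul]
    rw [add_comm]
    congr 2
    · push_cast; ring
    · ring
  have l1 : Tendsto (fun t => ‖ψ t‖) (𝓝 0) (𝓝 b) := hψ.continuousAt.norm
  have l2 : Tendsto (fun t => ‖((n:ℝ)+1) • ψ t + t • deriv ψ t‖) (𝓝 0) (𝓝 (((n:ℝ)+1) * b)) := by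
    have c : ContinuousAt (fun t => ‖((n:ℝ)+1) • ψ t + t • deriv ψ t‖) 0 :=
      ((hψ.continuousAt.const_smul _).add (continuousAt_id.smul hψ.deriv.continuousAt)).norm
    have := c.tendsto
    simp only [zero_smul, add_zero, norm_smul] at this
    rwa [Real.norm_of_nonneg (by positivity)] at this
  have b1 : b < ((n:ℝ)+2) * b := by nlinarith [Nat.cast_nonneg (α := ℝ) n]
  refine ⟨2 * ((n:ℝ) + 2), by positivity, ?_⟩
  filter_upwards [he.filter_mono nhdsWithin_le_nhds, hd.filter_mono nhdsWithin_le_nhds,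
    (l1.eventually (gt_mem_nhds (show b < 2 * b by linarith))).filter_mono nhdsWithin_le_nhds,
    (l1.eventually (lt_mem_nhds (show b/2 < b by linarith))).filter_mono nhdsWithin_le_nhds,
    (l2.eventually (gt_mem_nhds (show ((n:ℝ)+1)*b < ((n:ℝ)+2) * b by linarith))).filter_mono nhdsWithin_le_nhds,
    (l2.eventually (lt_mem_nhds (show b/2 < ((n:ℝ)+1)*b by
      nlinarith [Nat.cast_nonneg (α := ℝ) n]))).filter_mono nhdsWithin_le_nhds,
    self_mem_nhdsWithin] with t h1 h2 h3 h4 h5 h6 h7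
  have h7' : 0 < t := h7
  have hp : 0 < t ^ (n+1) := pow_pos h7' _
  have e1 : t * ‖deriv φ t‖ = t ^ (n+1) * ‖((n:ℝ)+1) • ψ t + t • deriv ψ t‖ := by
    have := congrArg norm h2
    rwa [norm_smul, norm_smul, Real.norm_of_nonneg h7'.le, Real.norm_of_nonneg hp.le] at this
  have e2 : ‖φ t‖ = t ^ (n+1) * ‖ψ t‖ := by
    rw [h1, norm_smul, Real.norm_of_nonneg hp.le]
  rw [e1, e2]
  constructor
  · rw [mul_left_comm]
    refine mul_le_mul_of_nonneg_left ?_ hp.le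
    nlinarith [Nat.cast_nonneg (α := ℝ) n]
  · rw [mul_left_comm]
    refine mul_le_mul_of_nonneg_left ?_ hp.le
    nlinarith [Nat.cast_nonneg (α := ℝ) n]

end RT

end Part12

section Part13
open Filter Topology Asymptotics

namespace RT
variable {m : ℕ}

noncomputable def HS {n : ℕ} (M : EuclideanSpace ℝ (Fin m) [×n]→L[ℝ] ℝ) : ℝ :=
  ∑ ι : Fin n → Fin m, (M (fun l => EuclideanSpace.single (ι l) (1:ℝ))) ^ 2

theorem HS_nonneg {n : ℕ} (M : EuclideanSpace ℝ (Fin m) [×n]→L[ℝ] ℝ) : 0 ≤ HS M :=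
  Finset.sum_nonneg (fun _ _ => sq_nonneg _)

theorem HS_smul {n : ℕ} (c : ℝ) (M : EuclideanSpace ℝ (Fin m) [×n]→L[ℝ] ℝ) :
    HS (c • M) = c ^ 2 * HS M := by
  simp [HS, Finset.mul_sum, mul_pow]

theorem expand {n : ℕ} (M : EuclideanSpace ℝ (Fin m) [×n]→L[ℝ] ℝ)
    (v : Fin n → EuclideanSpace ℝ (Fin m)) :
    M v = ∑ ι : Fin n → Fin m, (∏ l, v l (ι l)) * M (fun l => EuclideanSpace.single (ι l) (1:ℝ)) := by
  have hv : v = fun l => ∑ i : Fin m, v l i • EuclideanSpace.single i (1:ℝ) := by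
    funext l
    ext j
    simp [Pi.single_apply]
  conv_lhs => rw [hv]
  rw [ContinuousMultilinearMap.map_sum]
  refine Finset.sum_congr rfl (fun ι _ => ?_)
  rw [ContinuousMultilinearMap.map_smul_univ, smul_eq_mul]

theorem HS_bound {n : ℕ} (M : EuclideanSpace ℝ (Fin m) [×n]→L[ℝ] ℝ)
    (v : Fin n → EuclideanSpace ℝ (Fin m)) : (M v) ^ 2 ≤ (∏ l, ‖v l‖) ^ 2 * HS M := by
  rw [expand M v]
  refine (Finset.sum_mul_sq_le_sq_mul_sq _ _ _).trans (le_of_eq ?_)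
  unfold HS
  congr 1
  simp only [← Finset.prod_pow, EuclideanSpace.norm_sq_eq, Real.norm_eq_abs, sq_abs]
  rw [Finset.prod_univ_sum]
  simp

theorem curve_selection_E {A B : EuclideanSpace ℝ (Fin m) → ℝ} (hA : AnalyticAt ℝ A 0)
    (hB : AnalyticAt ℝ B 0)
    (hA0 : ∀ x, 0 ≤ A x) (hB0 : ∀ x, 0 ≤ B x) (h : ∀ C : ℝ, ∃ᶠ x in 𝓝 0, C * B x < A x) :
    ∃ c : ℝ → EuclideanSpace ℝ (Fin m), AnalyticAt ℝ c 0 ∧ c 0 = 0 ∧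
      (∀ᶠ t in 𝓝[>] 0, 0 < A (c t)) ∧
      ∀ C : ℝ, ∀ᶠ t in 𝓝[>] 0, C * B (c t) ≤ A (c t) := by
  let e := EuclideanSpace.equiv (Fin m) ℝ
  have he : ∀ y, AnalyticAt ℝ (fun x => e.symm x) y := fun y => e.symm.toContinuousLinearMap.analyticAt y
  have key : ∀ A : EuclideanSpace ℝ (Fin m) → ℝ, AnalyticAt ℝ A 0 →
      AnalyticAt ℝ (fun x => A (e.symm x)) 0 := by
    intro A hA
    have : AnalyticAt ℝ A (e.symm 0) := by simpa using hA
    exact this.comp (f := fun x => e.symm x) (he 0)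
  obtain ⟨c, hc, hc0, h1, h2⟩ := curve_selection (A := fun x => A (e.symm x))
    (B := fun x => B (e.symm x)) (key A hA) (key B hB) (fun x => hA0 _) (fun x => hB0 _) (by
      intro C
      have ht : Tendsto e (𝓝 0) (𝓝 0) := by simpa using e.continuous.tendsto 0
      refine ht.frequently (p := fun x => C * B (e.symm x) < A (e.symm x)) ?_
      simpa using h C)
  exact ⟨fun t => e.symm (c t), (he (c 0)).comp hc, by simp [hc0], h1, h2⟩

theorem core {f g : EuclideanSpace ℝ (Fin m) → ℝ} (hg : AnalyticAt ℝ g 0)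
    (hf : ∀ᶠ x in 𝓝[≠] (0:EuclideanSpace ℝ (Fin m)), AnalyticAt ℝ f x ∧ f x = ‖x‖ * g x) (k : ℕ) :
    ∃ C : ℝ, 0 ≤ C ∧ ∀ᶠ x in 𝓝[≠] (0:EuclideanSpace ℝ (Fin m)),
      (TT f k x) ^ 2 ≤ C * (‖x‖ ^ 2) ^ (k+1) * HS (iteratedFDeriv ℝ (k+1) f x) := by
  choose K hK hG using GJ_form hg hf
  obtain ⟨Q, hQ, hD⟩ := iter_form hg hf (k+1)
  let H : EuclideanSpace ℝ (Fin m) → ℝ := fun x =>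
    ∑ j ∈ Finset.range (k+1), ((-1 : ℝ) ^ j / (Nat.factorial j : ℝ)) * K j x
  have hH : AnalyticAt ℝ H 0 :=
    Finset.analyticAt_fun_sum _ (fun j _ => analyticAt_const.mul (hK j))
  have hT : ∀ᶠ x in 𝓝[≠] (0:EuclideanSpace ℝ (Fin m)), TT f k x = ‖x‖ * H x := by
    have : ∀ᶠ x in 𝓝[≠] (0:EuclideanSpace ℝ (Fin m)), ∀ j ∈ Finset.range (k+1),
        GJ f j x = ‖x‖ * K j x := by
      rw [Filter.eventually_all_finset]
      exact fun j _ => hG j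
    filter_upwards [this] with x hx
    simp only [TT, H, Finset.mul_sum]
    refine Finset.sum_congr rfl (fun j hj => ?_)
    rw [hx j hj]; ring
  let A : EuclideanSpace ℝ (Fin m) → ℝ := fun x => (‖x‖ ^ 2) ^ (k+1) * H x ^ 2
  let B : EuclideanSpace ℝ (Fin m) → ℝ := fun x => HS (Q x)
  have hA : AnalyticAt ℝ A 0 := ((nsq_analytic 0).pow _).mul (hH.pow 2)
  have hB : AnalyticAt ℝ B 0 := by
    refine Finset.analyticAt_fun_sum _ (fun ι _ => AnalyticAt.pow ?_ 2)
    exact ((ContinuousMultilinearMap.apply ℝ (fun _ : Fin (k+1) => EuclideanSpace ℝ (Fin m)) ℝ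
      (fun l => EuclideanSpace.single (ι l) (1:ℝ))).analyticAt _).comp hQ
  have hA0 : ∀ x, 0 ≤ A x := fun x => by positivity
  have hB0 : ∀ x, 0 ≤ B x := fun x => HS_nonneg _
  have hrel : ∀ᶠ x in 𝓝[≠] (0:EuclideanSpace ℝ (Fin m)), ∀ C : ℝ,
      (A x ≤ C * B x ↔
        (TT f k x) ^ 2 ≤ C * (‖x‖ ^ 2) ^ (k+1) * HS (iteratedFDeriv ℝ (k+1) f x)) := by
    filter_upwards [hT, hD, self_mem_nhdsWithin] with x h1 h2 h3 C
    have hn : 0 < ‖x‖ := norm_pos_iff.mpr h3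
    have e1 := congrArg HS h2
    rw [HS_smul, HS_smul] at e1
    have hN : 0 < (‖x‖ ^ 2) ^ (k+1) := by positivity
    simp only [A, B, h1]
    rw [← mul_le_mul_iff_right₀ (show 0 < ‖x‖ ^ 2 by positivity),
      ← mul_le_mul_iff_right₀ (a := (‖x‖ ^ 2) ^ (k+1)) (b := (‖x‖ * H x) ^ 2) hN]
    have e2 : ‖x‖ ^ 2 * (C * HS (Q x)) = (‖x‖ ^ 2) ^ (k+1) * (C * (‖x‖ ^ 2) ^ (k+1) *
        HS (iteratedFDeriv ℝ (k+1) f x)) := by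
      calc _ = C * (‖x‖ ^ 2 * HS (Q x)) := by ring
        _ = _ := by rw [← e1]; ring
    rw [e2]
    have e3 : ‖x‖ ^ 2 * ((‖x‖ ^ 2) ^ (k + 1) * H x ^ 2) =
      (‖x‖ ^ 2) ^ (k + 1) * (‖x‖ * H x) ^ 2 := by ring
    rw [e3]
  suffices hs : ∃ C : ℝ, ∀ᶠ x in 𝓝 (0:EuclideanSpace ℝ (Fin m)), A x ≤ C * B x by
    obtain ⟨C, hC⟩ := hs
    refine ⟨max C 0, le_max_right _ _, ?_⟩
    filter_upwards [hrel, hC.filter_mono nhdsWithin_le_nhds] with x h1 h2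
    exact (h1 _).mp (h2.trans (mul_le_mul_of_nonneg_right (le_max_left _ _) (hB0 x)))
  by_contra hcon
  have hfr : ∀ C : ℝ, ∃ᶠ x in 𝓝 (0:EuclideanSpace ℝ (Fin m)), C * B x < A x := by
    intro C hC
    exact hcon ⟨C, hC.mono fun x hx => not_lt.mp hx⟩
  obtain ⟨c, hc, hc0, hcA, hcB⟩ := curve_selection_E hA hB hA0 hB0 hfr
  have hcne : ∀ᶠ t in 𝓝[>] (0:ℝ), c t ≠ 0 ∧ H (c t) ≠ 0 := by
    filter_upwards [hcA] with t ht
    constructor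
    · intro h
      simp [A, h] at ht
    · intro h
      simp [A, h] at ht
  have hct : Tendsto c (𝓝[>] 0) (𝓝[≠] 0) := by
    refine tendsto_nhdsWithin_iff.mpr ⟨?_, hcne.mono fun t ht => ht.1⟩
    have := hc.continuousAt.tendsto
    rw [hc0] at this
    exact this.mono_left nhdsWithin_le_nhds
  let σ : ℝ → ℝ := fun t => ‖c t‖ ^ 2 * H (c t) ^ 2
  have hσ : AnalyticAt ℝ σ 0 := by
    have h1 : AnalyticAt ℝ (fun x => ‖x‖ ^ 2 * H x ^ 2) (c 0) := by
      rw [hc0]; exact (nsq_analytic 0).mul (hH.pow 2)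
    exact h1.comp hc
  have hσ0 : σ 0 = 0 := by simp [σ, hc0]
  have hσne : ¬ ∀ᶠ t in 𝓝 0, σ t = 0 := by
    intro h
    obtain ⟨t, h1, h2, h3⟩ := ((h.filter_mono nhdsWithin_le_nhds).and hcne).exists
    simp [σ, h2, h3] at h1
  have hcne' : ¬ ∀ᶠ t in 𝓝 0, c t = 0 := by
    intro h
    obtain ⟨t, h1, h2, h3⟩ := ((h.filter_mono nhdsWithin_le_nhds).and hcne).exists
    exact h2 h1
  obtain ⟨C1, hC1, h1⟩ := ord_lemma hσ hσ0 hσne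
  obtain ⟨C2, hC2, h2⟩ := ord_lemma hc hc0 hcne'
  set C3 : ℝ := (2 * C1 * C2) ^ 2 with hC3
  have hfin : ∀ᶠ t in 𝓝[>] (0:ℝ), A (c t) ≤ C3 * B (c t) := by
    filter_upwards [h1, h2, hct.eventually hrel, hct.eventually (ev_punct hT), hct.eventually hf,
      hc.eventually_analyticAt.filter_mono nhdsWithin_le_nhds, self_mem_nhdsWithin, hcne]
      with t ht1 ht2 hrelt ⟨hct0, hTt⟩ hft hcan htpos hne
    rw [hrelt C3]
    have htpos' : 0 < t := htpos
    obtain ⟨L, hL, hLv⟩ := TT_deriv hft.1 k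
    have hτ : HasDerivAt (fun s => TT f k (c s)) (L (deriv c t)) t :=
      hL.comp_hasDerivAt t hcan.differentiableAt.hasDerivAt
    have hστ : ∀ᶠ s in 𝓝 t, σ s = TT f k (c s) ^ 2 := by
      filter_upwards [hcan.continuousAt.eventually hTt] with s hs
      rw [hs.1]; simp only [σ]; ring
    have hσd : deriv σ t = 2 * TT f k (c t) * L (deriv c t) := by
      have e := (hτ.pow 2).congr_of_eventuallyEq hστ
      have e' : deriv σ t = _ := e.deriv
      rw [e']; simp
    set τ := TT f k (c t) with hτdef
    have hσt : σ t = τ ^ 2 := hστ.self_of_nhds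
    have hτ0 : τ ≠ 0 := by
      have : τ = ‖c t‖ * H (c t) := hTt.self_of_nhds.1
      rw [this]
      exact mul_ne_zero (norm_ne_zero_iff.mpr hne.1) hne.2
    set S := HS (iteratedFDeriv ℝ (k+1) f (c t)) with hS
    have hS0 : 0 ≤ S := HS_nonneg _
    -- bound for the derivative
    have hMb : MJ f k (c t) (deriv c t) ^ 2 ≤ (‖deriv c t‖ * ‖c t‖ ^ k) ^ 2 * S := by
      have := HS_bound (iteratedFDeriv ℝ (k+1) f (c t)) (Fin.cons (deriv c t) (fun _ => c t))
      rw [Fin.prod_univ_succ] at this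
      simpa [MJ] using this
    have hLb : L (deriv c t) ^ 2 ≤ (‖deriv c t‖ * ‖c t‖ ^ k) ^ 2 * S := by
      rw [hLv, mul_pow]
      refine (mul_le_of_le_one_left (sq_nonneg _) ?_).trans hMb
      rw [div_pow, ← pow_mul, mul_comm k 2, pow_mul]
      simp only [even_two, Even.neg_pow, one_pow]
      rw [div_le_one (by positivity)]
      have : (1:ℝ) ≤ k.factorial := by exact_mod_cast Nat.factorial_pos k
      nlinarith
    -- `|τ| ≤ 2 C1 t |τ'|`
    have hτb : |τ| ≤ 2 * C1 * (t * |L (deriv c t)|) := by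
      have h := ht1.2
      rw [hσt, hσd, Real.norm_eq_abs, Real.norm_eq_abs, abs_mul, abs_mul, abs_pow, abs_two] at h
      have hp : 0 < |τ| := abs_pos.mpr hτ0
      refine le_of_mul_le_mul_left ?_ hp
      calc |τ| * |τ| = |τ| ^ 2 := by ring
        _ ≤ _ := h
        _ = _ := by ring
    have q1 : τ ^ 2 ≤ (2 * C1) ^ 2 * (t ^ 2 * L (deriv c t) ^ 2) := by
      have := pow_le_pow_left₀ (abs_nonneg τ) hτb 2
      rw [sq_abs, mul_pow, mul_pow t, sq_abs] at this
      exact this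
    have q2 : (t * ‖deriv c t‖) ^ 2 ≤ (C2 * ‖c t‖) ^ 2 :=
      pow_le_pow_left₀ (by positivity) ht2.1 2
    calc τ ^ 2 ≤ (2 * C1) ^ 2 * (t ^ 2 * L (deriv c t) ^ 2) := q1
      _ ≤ (2 * C1) ^ 2 * (t ^ 2 * ((‖deriv c t‖ * ‖c t‖ ^ k) ^ 2 * S)) := by gcongr
      _ = (2 * C1) ^ 2 * ((t * ‖deriv c t‖) ^ 2 * ((‖c t‖ ^ k) ^ 2 * S)) := by ring
      _ ≤ (2 * C1) ^ 2 * ((C2 * ‖c t‖) ^ 2 * ((‖c t‖ ^ k) ^ 2 * S)) := by gcongr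
      _ = C3 * (‖c t‖ ^ 2) ^ (k+1) * S := by rw [hC3]; ring
  obtain ⟨t, ht1, ht2, ht3⟩ := (hfin.and ((hcB (C3 + 1)).and hcA)).exists
  have hb := hB0 (c t)
  have : B (c t) ≤ 0 := by nlinarith
  have hb0 : B (c t) = 0 := le_antisymm this hb
  rw [hb0] at ht1
  linarith

end RT

end Part13



/-- The reversed Taylor theorem for `f(x) = |x|·g(x)` with `g` real analytic
near `0` in `ℝ^m`: the same inequality as in the analytic case holds for all `x ≠ 0` in a
neighbourhood `V` of `0`, where the derivatives of `f` are taken within `U \ {0}` (where `f`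
is smooth). Note `f(0) = 0`. -/
theorem reversed_taylor_norm_times_analytic
    (m k : ℕ) (U : Set (EuclideanSpace ℝ (Fin m))) (hU : IsOpen U)
    (h0 : (0 : EuclideanSpace ℝ (Fin m)) ∈ U)
    (g : EuclideanSpace ℝ (Fin m) → ℝ) (hg : AnalyticOnNhd ℝ g U)
    (f : EuclideanSpace ℝ (Fin m) → ℝ)
    (hfdef : ∀ x, f x = Real.sqrt (∑ i, x i ^ 2) * g x) :
    ∃ (V : Set (EuclideanSpace ℝ (Fin m))) (C : ℝ),
      IsOpen V ∧ (0 : EuclideanSpace ℝ (Fin m)) ∈ V ∧ V ⊆ U ∧ 0 ≤ C ∧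
      ∀ x ∈ V, x ≠ 0 →
        |f 0 - ∑ j ∈ Finset.range (k + 1), ∑ ι : Fin j → Fin m,
            ((-1 : ℝ) ^ j / (Nat.factorial j : ℝ)) * (∏ l, x (ι l)) *
              (iteratedFDerivWithin ℝ j f (U \ {0}) x)
                (fun l => EuclideanSpace.single (ι l) (1:ℝ))|
          ≤ C * (∑ i, x i ^ 2) ^ (((k : ℝ) + 1) / 2) *
              Real.sqrt (∑ ι : Fin (k + 1) → Fin m,
                ((iteratedFDerivWithin ℝ (k + 1) f (U \ {0}) x)
                  (fun l => EuclideanSpace.single (ι l) (1:ℝ))) ^ 2) := by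
  have hnorm : ∀ x : EuclideanSpace ℝ (Fin m), ‖x‖ = Real.sqrt (∑ i, x i ^ 2) := by
    intro x
    rw [EuclideanSpace.norm_eq]
    simp
  have hnsq : ∀ x : EuclideanSpace ℝ (Fin m), ‖x‖ ^ 2 = ∑ i, x i ^ 2 := by
    intro x
    rw [EuclideanSpace.norm_sq_eq]
    simp
  have hfan : ∀ x ∈ U, x ≠ 0 → AnalyticAt ℝ f x := by
    intro x hx hx0
    have hp : 0 < ‖x‖ ^ 2 := by
      have := norm_pos_iff.mpr hx0
      positivity
    have h1 : AnalyticAt ℝ (fun y : EuclideanSpace ℝ (Fin m) => Real.sqrt (‖y‖ ^ 2)) x := by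
      have h2 : AnalyticAt ℝ Real.sqrt (‖x‖ ^ 2) :=
        (Real.contDiffAt_sqrt (n := ⊤) hp.ne').analyticAt
      exact h2.comp (f := fun y : EuclideanSpace ℝ (Fin m) => ‖y‖ ^ 2) (RT.nsq_analytic x)
    refine (h1.mul (hg x hx)).congr (Filter.Eventually.of_forall fun y => ?_)
    rw [hfdef, ← hnsq]
    rfl
  have hev : ∀ᶠ x in nhdsWithin (0 : EuclideanSpace ℝ (Fin m)) {0}ᶜ,
      AnalyticAt ℝ f x ∧ f x = ‖x‖ * g x := by
    filter_upwards [self_mem_nhdsWithin, nhdsWithin_le_nhds (hU.mem_nhds h0)] with x hx hxU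
    exact ⟨hfan x hxU hx, by rw [hfdef, hnorm]⟩
  obtain ⟨C, hC, hb⟩ := RT.core (hg 0 h0) hev k
  rw [eventually_nhdsWithin_iff] at hb
  obtain ⟨V, hV, hVo, hV0⟩ := mem_nhds_iff.mp (hb.and (hU.mem_nhds h0))
  refine ⟨V, Real.sqrt C, hVo, hV0, fun x hx => (hV hx).2, Real.sqrt_nonneg _, ?_⟩
  intro x hx hx0
  have hxU : x ∈ U \ {0} := ⟨(hV hx).2, hx0⟩
  have hop : IsOpen (U \ {0}) := hU.sdiff isClosed_singleton
  have hit : ∀ n, iteratedFDerivWithin ℝ n f (U \ {0}) x = iteratedFDeriv ℝ n f x :=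
    fun n => iteratedFDerivWithin_of_isOpen n hop hxU
  have hmain := (hV hx).1 hx0
  simp only [hit]
  have hf0 : f 0 = 0 := by rw [hfdef]; simp
  have hT : ∑ j ∈ Finset.range (k + 1), ∑ ι : Fin j → Fin m,
            ((-1 : ℝ) ^ j / (Nat.factorial j : ℝ)) * (∏ l, x (ι l)) *
              (iteratedFDeriv ℝ j f x)
                (fun l => EuclideanSpace.single (ι l) (1:ℝ)) = RT.TT f k x := by
    unfold RT.TT RT.GJ
    refine Finset.sum_congr rfl (fun j _ => ?_)
    rw [RT.expand, Finset.mul_sum]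
    exact Finset.sum_congr rfl (fun ι _ => by ring)
  rw [hT, hf0, zero_sub, abs_neg]
  have hrp : (∑ i, x i ^ 2) ^ (((k : ℝ) + 1) / 2) = ‖x‖ ^ (k+1) := by
    rw [← hnsq, ← Real.rpow_natCast, ← Real.rpow_mul (norm_nonneg _), ← Real.rpow_natCast]
    congr 1
    push_cast
    ring
  rw [hrp]
  refine abs_le_of_sq_le_sq ?_ (by positivity)
  rw [mul_pow, mul_pow, Real.sq_sqrt hC, Real.sq_sqrt (Finset.sum_nonneg fun _ _ => sq_nonneg _)]
  calc _ ≤ _ := hmain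
    _ = _ := by unfold RT.HS; ring
end

section
/- Define φ : ℝ → ℝ by φ(y) = exp(−1/y)·sin²(π/y) for y > 0 and φ(y) = 0 for y ≤ 0, and define f : ℝ → ℝ by f(x) = ∫_0^x φ(y) dy. Then f is differentiable with f'(x) = φ(x) for all x; for every positive integer n one has f(1/n) > 0 and f'(1/n) = 0; and consequently there exist no neighbourhood V of 0 in ℝ and constant C ≥ 0 such that |f(x)| ≤ C·|x|·|f'(x)| for all x ∈ V. -/
open Real

/-- The smooth (non-analytic) counterexample: with
`φ(y) = exp(-1/y)·sin²(π/y)` for `y > 0` and `φ(y) = 0` for `y ≤ 0`, and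
`f(x) = ∫₀ˣ φ(y) dy`, the function `f` is differentiable with `f' = φ`, satisfies
`f(1/n) > 0` and `f'(1/n) = 0` for every positive integer `n`, and hence the gradient
inequality `|f(x)| ≤ C·|x|·|f'(x)|` fails on every neighbourhood of `0`. -/
theorem smooth_gradient_inequality_counterexample
    (φ f : ℝ → ℝ)
    (hφ : ∀ y : ℝ, φ y = if 0 < y then Real.exp (-1 / y) * Real.sin (π / y) ^ 2 else 0)
    (hf : ∀ x : ℝ, f x = ∫ y in (0:ℝ)..x, φ y) :
    (∀ x : ℝ, HasDerivAt f (φ x) x) ∧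
    (∀ n : ℕ, 0 < n → 0 < f (1 / n) ∧ deriv f (1 / n) = 0) ∧
    ¬ ∃ V ∈ nhds (0:ℝ), ∃ C : ℝ, 0 ≤ C ∧ ∀ x ∈ V, |f x| ≤ C * |x| * |deriv f x| := by
  have hle : ∀ y, φ y ≤ expNegInvGlue y := by
    intro y
    rw [hφ y]
    split_ifs with h
    · rw [expNegInvGlue, if_neg (not_le.mpr h), show -1 / y = -y⁻¹ by ring]
      have h1 := Real.sin_sq_le_one (π / y)
      have h2 := Real.exp_pos (-y⁻¹)
      nlinarith
    · exact expNegInvGlue.nonneg y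
  have hnn : ∀ y, 0 ≤ φ y := by
    intro y
    rw [hφ y]
    split_ifs <;> positivity
  have hglue : Continuous expNegInvGlue := (expNegInvGlue.contDiff (n := 0)).continuous
  have hcont : Continuous φ := by
    rw [continuous_iff_continuousAt]
    intro x
    by_cases hx : x = 0
    · subst hx
      have h0 : φ 0 = 0 := by simp [hφ]
      rw [ContinuousAt, h0]
      have hg := hglue.tendsto 0
      rw [expNegInvGlue.zero] at hg
      exact squeeze_zero hnn hle hg
    · have he : φ = fun y => expNegInvGlue y * Real.sin (π / y) ^ 2 := by
        funext y
        rw [hφ y, expNegInvGlue]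
        by_cases h : 0 < y
        · rw [if_pos h, if_neg (not_le.mpr h), show -1 / y = -y⁻¹ by ring]
        · rw [if_neg h, if_pos (not_lt.mp h), zero_mul]
      rw [he]
      have h2 : ContinuousAt (fun y : ℝ => π / y) x := continuousAt_const.div continuousAt_id hx
      exact hglue.continuousAt.mul ((Real.continuous_sin.continuousAt.comp h2).pow 2)
  have hderiv : ∀ x : ℝ, HasDerivAt f (φ x) x := by
    intro x
    rw [show f = fun x => ∫ y in (0:ℝ)..x, φ y from funext hf]
    exact hcont.integral_hasStrictDerivAt 0 x |>.hasDerivAt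
  have hn : ∀ n : ℕ, 0 < n → 0 < f (1 / n) ∧ deriv f (1 / n) = 0 := by
    intro n hn
    have hn' : (0:ℝ) < n := by exact_mod_cast hn
    constructor
    · rw [hf]
      have hc : (0:ℝ) < 1 / (n + 1 / 2) := by positivity
      refine intervalIntegral.integral_pos (by positivity) hcont.continuousOn (fun x _ => hnn x)
        ⟨1 / (n + 1 / 2), ⟨hc.le, ?_⟩, ?_⟩
      · apply one_div_le_one_div_of_le hn'
        linarith
      · rw [hφ, if_pos hc]
        have : π / (1 / (n + 1 / 2 : ℝ)) = n * π + π / 2 := by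
          rw [div_div_eq_mul_div]; ring
        rw [this, Real.sin_add_pi_div_two, Real.cos_nat_mul_pi]
        positivity
    · rw [(hderiv _).deriv, hφ, if_pos (by positivity)]
      have : π / (1 / (n : ℝ)) = n * π := by
        rw [div_div_eq_mul_div]; ring
      rw [this, Real.sin_nat_mul_pi]
      simp
  refine ⟨hderiv, hn, ?_⟩
  rintro ⟨V, hV, C, -, h⟩
  have ht := tendsto_one_div_add_atTop_nhds_zero_nat (𝕜 := ℝ)
  obtain ⟨n, hnV⟩ := (ht.eventually hV).exists
  obtain ⟨h1, h2⟩ := hn (n + 1) n.succ_pos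
  push_cast at h1 h2
  have h3 := h _ hnV
  rw [h2, abs_zero, mul_zero, abs_of_pos h1] at h3
  linarith
end

section
/- Let m > 2 be an integer and a_1,…,a_m > 0 real numbers. Define p : ℝ → ℝ by p(x) = (1+a_1x²)⋯(1+a_mx²) − 1, so that p(x) > 0 for x ≠ 0. For k = 1,…,m define φ_k = a_k · ∫_{−∞}^{∞} |x| / ((1+a_kx²)·√(p(x))) dx, and define A = ∫_{−∞}^{∞} |x| / (2√(p(x))) dx. Then all these integrals converge; each φ_k lies in the open interval (0, π); φ_1 + φ_2 + ⋯ + φ_m = π; and A is a finite positive real number. -/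
open MeasureTheory Real

lemma ln_deriv {m : ℕ} (a : Fin m → ℝ) (ha : ∀ i, 0 < a i) (x : ℝ) :
    HasDerivAt (fun x : ℝ => (∏ i, (1 + a i * x ^ 2)) - 1)
      (2 * x * (∏ i, (1 + a i * x ^ 2)) * ∑ i, a i / (1 + a i * x ^ 2)) x := by
  have h : ∀ i ∈ (Finset.univ : Finset (Fin m)),
      HasDerivAt (fun x : ℝ => 1 + a i * x ^ 2) (a i * (2 * x)) x := by
    intro i _
    have := ((hasDerivAt_pow 2 x).const_mul (a i)).const_add 1
    simpa using this
  have h2 := (HasDerivAt.fun_finsetProd h).sub_const 1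
  refine h2.congr_deriv ?_
  symm
  rw [Finset.mul_sum]
  refine Finset.sum_congr rfl fun i hi => ?_
  rw [← Finset.mul_prod_erase _ _ hi, smul_eq_mul]
  have : 1 + a i * x ^ 2 ≠ 0 := by have := ha i; positivity
  generalize ∏ j ∈ Finset.univ.erase i, (1 + a j * x ^ 2) = Q
  generalize 1 + a i * x ^ 2 = c at this
  field_simp

lemma ln_lower {m : ℕ} (hm : 2 < m) (a : Fin m → ℝ) (ha : ∀ i, 0 < a i) :
    ∃ b : ℝ, 0 < b ∧ ∀ x : ℝ,
      (√b * |x| * (1 + b * x ^ 2)) ^ 2 ≤ (∏ i, (1 + a i * x ^ 2)) - 1 := by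
  have : Nonempty (Fin m) := ⟨⟨0, by omega⟩⟩
  obtain ⟨i0, h0⟩ := Finite.exists_min a
  refine ⟨a i0, ha i0, fun x => ?_⟩
  set b := a i0 with hb
  have hb0 : 0 < b := ha i0
  have h1 : (1 + b * x ^ 2) ^ m ≤ ∏ i, (1 + a i * x ^ 2) := by
    have : ∏ _i : Fin m, (1 + b * x ^ 2) ≤ ∏ i, (1 + a i * x ^ 2) := by
      apply Finset.prod_le_prod
      · intro i _; positivity
      · intro i _; have := h0 i; gcongr
    simpa using this
  have h2 : (1 + b * x ^ 2) ^ 3 ≤ (1 + b * x ^ 2) ^ m := by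
    apply pow_le_pow_right₀ _ (by omega)
    have : 0 ≤ b * x ^ 2 := by positivity
    linarith
  have h3 : (√b * |x| * (1 + b * x ^ 2)) ^ 2 = b * x ^ 2 * (1 + b * x ^ 2) ^ 2 := by
    rw [mul_pow, mul_pow, Real.sq_sqrt hb0.le, sq_abs]
  have h4 : 0 ≤ b * x ^ 2 := by positivity
  rw [h3]
  nlinarith [mul_nonneg h4 h4, h4]

/-- For `m > 2` and `a₁,…,a_m > 0`, with
`p(x) = ∏ₖ(1 + aₖx²) - 1`, the angles `φₖ = aₖ ∫_ℝ |x| / ((1+aₖx²)√(p(x))) dx` and the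
invariant `A = ∫_ℝ |x| / (2√(p(x))) dx` of the Lawlor neck satisfy: all integrals converge,
each `φₖ ∈ (0,π)`, `φ₁ + ⋯ + φ_m = π`, and `A > 0`. -/
theorem lawlor_neck_angles
    (m : ℕ) (hm : 2 < m) (a : Fin m → ℝ) (ha : ∀ i, 0 < a i)
    (p : ℝ → ℝ) (hp : ∀ x : ℝ, p x = (∏ i, (1 + a i * x ^ 2)) - 1)
    (φ : Fin m → ℝ)
    (hφ : ∀ i, φ i = a i * ∫ x : ℝ, |x| / ((1 + a i * x ^ 2) * Real.sqrt (p x)))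
    (A : ℝ) (hA : A = ∫ x : ℝ, |x| / (2 * Real.sqrt (p x))) :
    (∀ i, Integrable (fun x : ℝ => |x| / ((1 + a i * x ^ 2) * Real.sqrt (p x)))) ∧
    Integrable (fun x : ℝ => |x| / (2 * Real.sqrt (p x))) ∧
    (∀ i, φ i ∈ Set.Ioo 0 π) ∧
    (∑ i, φ i) = π ∧
    0 < A := by
  obtain ⟨b, hb, hlow⟩ := ln_lower hm a ha
  have hm2 : 1 < m := by omega
  simp only [← hp] at hlow
  have hpf : p = fun x : ℝ => (∏ i, (1 + a i * x ^ 2)) - 1 := funext hp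
  have hpc : Continuous p := by rw [hpf]; fun_prop
  have hsl : ∀ x, √b * |x| * (1 + b * x ^ 2) ≤ √(p x) := fun x => Real.le_sqrt_of_sq_le (hlow x)
  have hsb : 0 < √b := Real.sqrt_pos.2 hb
  have hspos : ∀ x, x ≠ 0 → 0 < √(p x) := fun x hx =>
    lt_of_lt_of_le (by have := abs_pos.2 hx; positivity) (hsl x)
  have hppos : ∀ x, x ≠ 0 → 0 < p x := fun x hx => Real.sqrt_pos.1 (hspos x hx)
  have hone : ∀ i (x : ℝ), 1 ≤ 1 + a i * x ^ 2 := fun i x => by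
    have := ha i
    have : 0 ≤ a i * x ^ 2 := by positivity
    linarith
  have hdom : Integrable (fun x : ℝ => (√b)⁻¹ * (1 + (√b * x) ^ 2)⁻¹) :=
    (integrable_inv_one_add_sq.comp_mul_left' hsb.ne').const_mul _
  have hbd : ∀ x, |x| / √(p x) ≤ (√b)⁻¹ * (1 + (√b * x) ^ 2)⁻¹ := by
    intro x
    by_cases hx : x = 0
    · subst hx; simp
    · rw [div_le_iff₀ (hspos x hx), mul_pow, Real.sq_sqrt hb.le]
      have h := hsl x
      have h1 : 0 < 1 + b * x ^ 2 := by positivity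
      calc |x| = (√b)⁻¹ * (1 + b * x ^ 2)⁻¹ * (√b * |x| * (1 + b * x ^ 2)) := by field_simp
        _ ≤ _ := by gcongr
  have hsm : Measurable fun x => √(p x) := hpc.measurable.sqrt
  have habs : Measurable fun x : ℝ => |x| := continuous_abs.measurable
  have hI0 : Integrable (fun x : ℝ => |x| / √(p x)) := by
    refine hdom.mono' (habs.div hsm).aestronglyMeasurable (.of_forall fun x => ?_)
    rw [Real.norm_of_nonneg (by positivity)]
    exact hbd x
  have hI : ∀ i, Integrable (fun x : ℝ => |x| / ((1 + a i * x ^ 2) * √(p x))) := by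
    intro i
    refine hI0.mono' (habs.div (Measurable.mul (by fun_prop) hsm)).aestronglyMeasurable
      (.of_forall fun x => ?_)
    have h1 := hone i x
    rw [Real.norm_of_nonneg (by positivity), mul_comm, ← div_div]
    exact div_le_self (by positivity) h1
  have hIA : Integrable (fun x : ℝ => |x| / (2 * √(p x))) := by
    refine (hI0.const_mul (1 / 2)).congr (.of_forall fun x => ?_)
    simp only
    rw [← div_div]
    ring
  have hpos : ∀ f : ℝ → ℝ, Integrable f → (∀ x, 0 ≤ f x) → (∀ x, x ≠ 0 → 0 < f x) →
      0 < ∫ x, f x := by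
    intro f hf h0 h1
    rw [integral_pos_iff_support_of_nonneg h0 hf]
    refine lt_of_lt_of_le ?_ (measure_mono (s := Set.Ioi (0 : ℝ)) fun x hx => (h1 x hx.ne').ne')
    simp
  have hφpos : ∀ i, 0 < φ i := by
    intro i
    rw [hφ]
    refine mul_pos (ha i) (hpos _ (hI i) (fun x => ?_) fun x hx => ?_)
    · have := hone i x
      positivity
    · have := hone i x
      have := hspos x hx
      have := abs_pos.2 hx
      positivity
  have hsum : ∑ i, φ i = π := by
    have e1 : ∑ i, φ i = ∫ x : ℝ, ∑ i, a i * (|x| / ((1 + a i * x ^ 2) * √(p x))) := by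
      rw [integral_finsetSum _ fun i _ => (hI i).const_mul _]
      simp only [hφ, integral_const_mul]
    let g : ℝ → ℝ := fun x => ∑ i, a i * (x / ((1 + a i * x ^ 2) * √(p x)))
    have e2 : ∀ x : ℝ, ∑ i, a i * (|x| / ((1 + a i * x ^ 2) * √(p x))) = g |x| := by
      intro x
      have : p |x| = p x := by simp [hp]
      simp [g, this]
    have e3 : ∫ x in Set.Ioi (0 : ℝ), g x = π / 2 - Real.arctan (√(p 0)) := by
      refine integral_Ioi_of_hasDerivAt_of_nonneg (g := fun x => Real.arctan (√(p x))) ?_ ?_ ?_ ?_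
      · exact (Real.continuous_arctan.comp hpc.sqrt).continuousWithinAt
      · intro x hx
        have hx0 : x ≠ 0 := (Set.mem_Ioi.1 hx).ne'
        have h1 := ln_deriv a ha x
        rw [← hpf] at h1
        have h2 := (h1.sqrt (hppos x hx0).ne').arctan
        convert h2 using 1
        have hs := hspos x hx0
        have hP : ∏ i, (1 + a i * x ^ 2) = 1 + p x := by rw [hp]; ring
        have hpp := hppos x hx0
        rw [hP, Real.sq_sqrt hpp.le]
        have : 2 * x * (1 + p x) * (∑ i, a i / (1 + a i * x ^ 2)) / (2 * √(p x))
            = (1 + p x) * (x / √(p x) * (∑ i, a i / (1 + a i * x ^ 2))) := by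
          field_simp
        rw [this, one_div, inv_mul_cancel_left₀ (by positivity), Finset.mul_sum]
        refine Finset.sum_congr rfl fun i _ => ?_
        have := hone i x
        field_simp
      · intro x hx
        have hx0 : 0 < x := hx
        refine Finset.sum_nonneg fun i _ => ?_
        have := hone i x
        have := ha i
        positivity
      · have ht : Filter.Tendsto (fun x => √(p x)) Filter.atTop Filter.atTop := by
          refine Filter.tendsto_atTop_mono' _ ?_ (Filter.tendsto_id.const_mul_atTop hsb)
          filter_upwards [Filter.eventually_ge_atTop 0] with x hx
          refine le_trans ?_ (hsl x)
          rw [abs_of_nonneg hx, id]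
          refine le_mul_of_one_le_right (by positivity) ?_
          have : 0 ≤ b * x ^ 2 := by positivity
          linarith
        exact (Real.tendsto_arctan_atTop.mono_right nhdsWithin_le_nhds).comp ht
    rw [e1]
    simp only [e2]
    rw [integral_comp_abs, e3]
    simp [hp]
    ring
  refine ⟨hI, hIA, fun i => ⟨hφpos i, ?_⟩, hsum, ?_⟩
  · rw [← hsum]
    have : Nontrivial (Fin m) := Fin.nontrivial_iff_two_le.2 hm2
    obtain ⟨j, hj⟩ := exists_ne i
    exact Finset.single_lt_sum hj (Finset.mem_univ i) (Finset.mem_univ j) (hφpos j)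
      fun k _ _ => (hφpos k).le
  · rw [hA]
    refine hpos _ hIA (fun x => by positivity) fun x hx => ?_
    have := hspos x hx
    have := abs_pos.2 hx
    positivity
end

section
/- Let m ≥ 1 be an integer, R > 0, and ρ < 0. Suppose f : {x ∈ ℝ^m : |x| > R} → ℝ is smooth and for every multi-index β there is a constant C_β ≥ 0 such that |∂^β f(x)| ≤ C_β · |x|^{ρ−|β|} for all |x| > R. Set r̃_0 = 1/log(1+R²) and define f̃ on the open ball B = {ỹ ∈ ℝ^m : |ỹ| < r̃_0} by f̃(0) = 0 and f̃(ỹ) = f( (e^{1/|ỹ|} − 1)^{1/2} · ỹ/|ỹ| ) for ỹ ≠ 0. Then f̃ is well-defined and infinitely differentiable (C^∞) on B, and f̃ and all of its partial derivatives of every order vanish at ỹ = 0. -/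
open scoped ContDiff

/-- Weighted symbol-type class: derivatives up to order `n` on `V` are bounded by
`C * w y * ‖y‖⁻¹ ^ K`. -/
def WCls {E F : Type} [NormedAddCommGroup E] [NormedSpace ℝ E] [NormedAddCommGroup F]
    [NormedSpace ℝ F] (V : Set E) (w : E → ℝ) (n : ℕ) (h : E → F) : Prop :=
  ContDiffOn ℝ ∞ h V ∧ ∀ i ≤ n, ∃ (C : ℝ) (K : ℕ), 0 ≤ C ∧ ∀ y ∈ V,
    ‖iteratedFDerivWithin ℝ i h V y‖ ≤ C * (w y * ‖y‖⁻¹ ^ K)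

section WClsLemmas

variable {E F G H : Type} [NormedAddCommGroup E] [NormedSpace ℝ E] [NormedAddCommGroup F]
    [NormedSpace ℝ F] [NormedAddCommGroup G] [NormedSpace ℝ G] [NormedAddCommGroup H]
    [NormedSpace ℝ H] {V : Set E} {w w₁ w₂ : E → ℝ} {n : ℕ}

theorem WCls.mono {h : E → F} (hh : WCls V w₁ n h) (c : ℝ) (hc : 0 ≤ c)
    (hw : ∀ y ∈ V, w₁ y ≤ c * w₂ y) : WCls V w₂ n h := by
  refine ⟨hh.1, fun i hi => ?_⟩
  obtain ⟨C, K, hC, hb⟩ := hh.2 i hi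
  refine ⟨C * c, K, by positivity, fun y hy => (hb y hy).trans ?_⟩
  have := hw y hy
  calc C * (w₁ y * ‖y‖⁻¹ ^ K) ≤ C * (c * w₂ y * ‖y‖⁻¹ ^ K) := by gcongr
    _ = _ := by ring

theorem WCls.congr {h h' : E → F} (hh : WCls V w n h) (he : Set.EqOn h' h V) :
    WCls V w n h' := by
  refine ⟨hh.1.congr he, fun i hi => ?_⟩
  obtain ⟨C, K, hC, hb⟩ := hh.2 i hi
  refine ⟨C, K, hC, fun y hy => ?_⟩
  rw [iteratedFDerivWithin_congr he hy]
  exact hb y hy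

theorem WCls.of_le {h : E → F} {k : ℕ} (hh : WCls V w n h) (hk : k ≤ n) : WCls V w k h :=
  ⟨hh.1, fun i hi => hh.2 i (hi.trans hk)⟩

theorem WCls.fderivWithin (hV : IsOpen V) {h : E → F} (hh : WCls V w (n + 1) h) :
    WCls V w n (fderivWithin ℝ h V) := by
  refine ⟨hh.1.fderivWithin hV.uniqueDiffOn (by simp), fun i hi => ?_⟩
  obtain ⟨C, K, hC, hb⟩ := hh.2 (i + 1) (by omega)
  refine ⟨C, K, hC, fun y hy => ?_⟩
  rw [norm_iteratedFDerivWithin_fderivWithin hV.uniqueDiffOn hy]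
  exact hb y hy

theorem WCls.zero {h : E → F} (h0 : ContDiffOn ℝ ∞ h V)
    (hb : ∃ (C : ℝ) (K : ℕ), 0 ≤ C ∧ ∀ y ∈ V, ‖h y‖ ≤ C * (w y * ‖y‖⁻¹ ^ K)) :
    WCls V w 0 h := by
  refine ⟨h0, fun i hi => ?_⟩
  obtain rfl : i = 0 := by omega
  simpa using hb

theorem WCls.succ (hV : IsOpen V) {h : E → F} (h0 : ContDiffOn ℝ ∞ h V)
    (hb : ∃ (C : ℝ) (K : ℕ), 0 ≤ C ∧ ∀ y ∈ V, ‖h y‖ ≤ C * (w y * ‖y‖⁻¹ ^ K))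
    (hd : WCls V w n (_root_.fderivWithin ℝ h V)) :
    WCls V w (n + 1) h := by
  refine ⟨h0, fun i hi => ?_⟩
  rcases i with _ | i
  · simpa using hb
  · obtain ⟨C, K, hC, hb⟩ := hd.2 i (by omega)
    refine ⟨C, K, hC, fun y hy => ?_⟩
    rw [← norm_iteratedFDerivWithin_fderivWithin hV.uniqueDiffOn hy]
    exact hb y hy

theorem WCls.bilin (hV : IsOpen V) (hV1 : ∀ y ∈ V, 0 < ‖y‖ ∧ ‖y‖ ≤ 1)
    (hw₁ : ∀ y ∈ V, 0 ≤ w₁ y) (hw₂ : ∀ y ∈ V, 0 ≤ w₂ y) (Bl : F →L[ℝ] G →L[ℝ] H)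
    {f : E → F} {g : E → G} (hf : WCls V w₁ n f) (hg : WCls V w₂ n g) :
    WCls V (fun y => w₁ y * w₂ y) n (fun y => Bl (f y) (g y)) := by
  refine ⟨Bl.isBoundedBilinearMap.contDiff.comp_contDiffOn (hf.1.prodMk hg.1), fun i hi => ?_⟩
  choose! C K hC hb using hf.2
  choose! C' K' hC' hb' using hg.2
  let KK := fun j => K j + K' (i - j)
  refine ⟨‖Bl‖ * ∑ j ∈ Finset.range (i + 1), (i.choose j : ℝ) * |C j| * |C' (i - j)|,
    ∑ j ∈ Finset.range (i + 1), KK j, by positivity, fun y hy => ?_⟩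
  obtain ⟨hy0, hy1⟩ := hV1 y hy
  have h1 : 1 ≤ ‖y‖⁻¹ := (one_le_inv₀ hy0).2 hy1
  refine (Bl.norm_iteratedFDerivWithin_le_of_bilinear hf.1 hg.1 hV.uniqueDiffOn hy
    (n := i) (by exact_mod_cast le_top)).trans ?_
  rw [mul_assoc, Finset.sum_mul]
  refine mul_le_mul_of_nonneg_left (Finset.sum_le_sum fun j hj => ?_)
    (norm_nonneg Bl)
  have hj' : j ≤ i := by simpa [Nat.lt_succ_iff] using hj
  have hp : ‖y‖⁻¹ ^ KK j ≤ ‖y‖⁻¹ ^ (∑ j ∈ Finset.range (i + 1), KK j) :=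
    pow_le_pow_right₀ h1 (Finset.single_le_sum (f := KK) (fun _ _ => Nat.zero_le _) hj)
  have e1 := hb j (by omega) y hy
  have e2 := hb' (i - j) (by omega) y hy
  have a1 := hw₁ y hy
  have a2 := hw₂ y hy
  have b1 : C j ≤ |C j| := le_abs_self _
  have b2 : C' (i - j) ≤ |C' (i - j)| := le_abs_self _
  calc (i.choose j : ℝ) * ‖iteratedFDerivWithin ℝ j f V y‖ * ‖iteratedFDerivWithin ℝ (i - j) g V y‖
      ≤ (i.choose j : ℝ) * (|C j| * (w₁ y * ‖y‖⁻¹ ^ K j)) *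
        (|C' (i - j)| * (w₂ y * ‖y‖⁻¹ ^ K' (i - j))) := by
        gcongr
        · exact e1.trans (by gcongr)
        · exact e2.trans (by gcongr)
    _ = (i.choose j : ℝ) * |C j| * |C' (i - j)| * (w₁ y * w₂ y * ‖y‖⁻¹ ^ KK j) := by
        simp only [KK, pow_add]; ring
    _ ≤ _ := by gcongr

theorem WCls.const (c : F) : WCls V (fun _ => 1) n (fun _ => c) := by
  refine ⟨contDiffOn_const, fun i hi => ⟨‖c‖, 0, norm_nonneg _, fun y hy => ?_⟩⟩
  rcases Nat.eq_zero_or_pos i with rfl | hi'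
  · simp
  · rw [iteratedFDerivWithin_const_of_ne hi'.ne']; simp

theorem WCls.clm (hV : IsOpen V) (hV1 : ∀ y ∈ V, 0 < ‖y‖ ∧ ‖y‖ ≤ 1) (L : E →L[ℝ] F) :
    WCls V (fun _ => 1) n (fun y => L y) := by
  have h0 : ContDiffOn ℝ ∞ (fun y => L y) V := L.contDiff.contDiffOn
  have hb : ∃ (C : ℝ) (K : ℕ), 0 ≤ C ∧ ∀ y ∈ V, ‖L y‖ ≤ C * (1 * ‖y‖⁻¹ ^ K) := by
    refine ⟨‖L‖, 0, norm_nonneg _, fun y hy => ?_⟩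
    have := (hV1 y hy).2
    simpa using L.le_of_opNorm_le_of_le le_rfl this
  rcases n with _ | n
  · exact WCls.zero h0 hb
  · refine WCls.succ hV h0 hb ((WCls.const L).congr fun y hy => ?_)
    exact L.hasFDerivWithinAt.fderivWithin (hV.uniqueDiffWithinAt hy)

theorem WCls.const_sub (hV : IsOpen V) (hV1 : ∀ y ∈ V, 0 < ‖y‖ ∧ ‖y‖ ≤ 1)
    {u : E → ℝ} (hu : WCls V (fun _ => 1) n u) (c : ℝ)
    (hb : ∀ y ∈ V, ‖c - u y‖ ≤ 1) : WCls V (fun _ => 1) n (fun y => c - u y) := by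
  have h0 : ContDiffOn ℝ ∞ (fun y => c - u y) V := contDiffOn_const.sub hu.1
  have hb : ∃ (C : ℝ) (K : ℕ), 0 ≤ C ∧ ∀ y ∈ V, ‖c - u y‖ ≤ C * (1 * ‖y‖⁻¹ ^ K) :=
    ⟨1, 0, by simp, by simpa using hb⟩
  rcases n with _ | n
  · exact WCls.zero h0 hb
  · refine WCls.succ hV h0 hb ?_
    have := WCls.bilin hV hV1 (by simp) (by simp) (ContinuousLinearMap.lsmul ℝ ℝ)
      (WCls.const (-1 : ℝ)) (hu.fderivWithin hV)
    refine (this.mono (w₂ := fun _ => 1) 1 (by simp) (by simp)).congr fun y hy => ?_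
    rw [_root_.fderivWithin_const_sub (hV.uniqueDiffWithinAt hy)]
    simp

theorem WCls.rpow (hV : IsOpen V) (hV1 : ∀ y ∈ V, 0 < ‖y‖ ∧ ‖y‖ ≤ 1)
    {u : E → ℝ} (hu : ∀ n, WCls V (fun _ => 1) n u) (hpos : ∀ y ∈ V, 0 < u y)
    (hb : ∀ s : ℝ, ∃ (C : ℝ) (K : ℕ), 0 ≤ C ∧ ∀ y ∈ V, u y ^ s ≤ C * ‖y‖⁻¹ ^ K) (s : ℝ) :
    WCls V (fun _ => 1) n (fun y => u y ^ s) := by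
  have h0 : ∀ s : ℝ, ContDiffOn ℝ ∞ (fun y => u y ^ s) V := fun s =>
    (hu 0).1.rpow_const_of_ne fun y hy => (hpos y hy).ne'
  have hb' : ∀ s : ℝ, ∃ (C : ℝ) (K : ℕ), 0 ≤ C ∧ ∀ y ∈ V, ‖u y ^ s‖ ≤ C * (1 * ‖y‖⁻¹ ^ K) := by
    intro s
    obtain ⟨C, K, hC, h⟩ := hb s
    refine ⟨C, K, hC, fun y hy => ?_⟩
    rw [Real.norm_of_nonneg (Real.rpow_nonneg (hpos y hy).le _), one_mul]
    exact h y hy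
  induction n generalizing s with
  | zero => exact WCls.zero (h0 s) (hb' s)
  | succ n ih =>
    refine WCls.succ hV (h0 s) (hb' s) ?_
    have := WCls.bilin hV hV1 (by simp) (by simp) (ContinuousLinearMap.lsmul ℝ ℝ)
      (WCls.const s) (WCls.bilin hV hV1 (by simp) (by simp) (ContinuousLinearMap.lsmul ℝ ℝ)
        (ih (s - 1)) ((hu (n + 1)).fderivWithin hV))
    refine (this.mono (w₂ := fun _ => 1) 1 (by simp) (by simp)).congr fun y hy => ?_
    have hd := ((hu 0).1.differentiableOn (by simp) y hy).hasFDerivWithinAt.rpow_const (p := s)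
      (Or.inl (hpos y hy).ne')
    rw [hd.fderivWithin (hV.uniqueDiffWithinAt hy)]
    simp only [ContinuousLinearMap.lsmul_apply, mul_smul]

theorem WCls.exp (hV : IsOpen V) (hV1 : ∀ y ∈ V, 0 < ‖y‖ ∧ ‖y‖ ≤ 1)
    {u : E → ℝ} (hu : ∀ n, WCls V (fun _ => 1) n u) :
    WCls V (fun y => Real.exp (u y)) n (fun y => Real.exp (u y)) := by
  have h0 : ContDiffOn ℝ ∞ (fun y => Real.exp (u y)) V := (hu 0).1.exp
  have hb : ∃ (C : ℝ) (K : ℕ), 0 ≤ C ∧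
      ∀ y ∈ V, ‖Real.exp (u y)‖ ≤ C * (Real.exp (u y) * ‖y‖⁻¹ ^ K) :=
    ⟨1, 0, by simp, by simp⟩
  induction n with
  | zero => exact WCls.zero h0 hb
  | succ n ih =>
    refine WCls.succ hV h0 hb ?_
    have := WCls.bilin hV hV1 (fun y _ => (Real.exp_pos _).le) (by simp)
      (ContinuousLinearMap.lsmul ℝ ℝ) ih ((hu (n + 1)).fderivWithin hV)
    refine (this.mono (w₂ := fun y => Real.exp (u y)) 1 (by simp) (by simp)).congr fun y hy => ?_
    have hd := ((hu 0).1.differentiableOn (by simp) y hy).hasFDerivWithinAt.exp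
    rw [hd.fderivWithin (hV.uniqueDiffWithinAt hy)]
    simp

/-- Composition with a function with symbol-type decay. -/
theorem WCls.comp (hV : IsOpen V) (hV1 : ∀ y ∈ V, 0 < ‖y‖ ∧ ‖y‖ ≤ 1)
    {U : Set E} (hU : IsOpen U) (hU0 : ∀ x ∈ U, x ≠ 0)
    {Φ : E → E} (hmap : Set.MapsTo Φ V U)
    (hΦ : ∀ n, WCls V (fun y => ‖Φ y‖) n Φ) (n : ℕ) :
    ∀ (F : Type) [NormedAddCommGroup F] [NormedSpace ℝ F] (f : E → F) (σ : ℝ),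
      ContDiffOn ℝ ∞ f U →
      (∀ i : ℕ, ∃ C : ℝ, 0 ≤ C ∧ ∀ x ∈ U,
        ‖iteratedFDerivWithin ℝ i f U x‖ ≤ C * ‖x‖ ^ (σ - i)) →
      WCls V (fun y => ‖Φ y‖ ^ σ) n (fun y => f (Φ y)) := by
  induction n with
  | zero =>
    intro F _ _ f σ hf hd
    refine WCls.zero (hf.comp (hΦ 0).1 hmap) ?_
    obtain ⟨C, hC, h⟩ := hd 0
    exact ⟨C, 0, hC, fun y hy => by simpa using h _ (hmap hy)⟩
  | succ n ih =>
    intro F _ _ f σ hf hd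
    refine WCls.succ hV (hf.comp (hΦ 0).1 hmap) ?_ ?_
    · obtain ⟨C, hC, h⟩ := hd 0
      exact ⟨C, 0, hC, fun y hy => by simpa using h _ (hmap hy)⟩
    · have h1 := ih (E →L[ℝ] F) (_root_.fderivWithin ℝ f U) (σ - 1)
        (hf.fderivWithin hU.uniqueDiffOn (by simp)) (by
          intro i
          obtain ⟨C, hC, h⟩ := hd (i + 1)
          refine ⟨C, hC, fun x hx => ?_⟩
          rw [norm_iteratedFDerivWithin_fderivWithin hU.uniqueDiffOn hx]
          convert h x hx using 3
          push_cast; ring)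
      have h2 := WCls.bilin hV hV1 (fun y _ => Real.rpow_nonneg (norm_nonneg _) _)
        (fun y _ => norm_nonneg _) (ContinuousLinearMap.compL ℝ E E F) h1
        ((hΦ (n + 1)).fderivWithin hV)
      refine (h2.mono (w₂ := fun y => ‖Φ y‖ ^ σ) 1 (by simp) ?_).congr ?_
      · intro y hy
        have hp : 0 < ‖Φ y‖ := norm_pos_iff.2 (hU0 _ (hmap hy))
        rw [one_mul, Real.rpow_sub_one hp.ne', div_mul_cancel₀ _ hp.ne']
      · intro y hy
        exact fderivWithin_comp (g := f) (f := Φ) y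
          (hf.differentiableOn (by simp) _ (hmap hy))
          ((hΦ 0).1.differentiableOn (by simp) y hy) hmap (hV.uniqueDiffWithinAt hy)

/-- Extension over the origin of a function all of whose derivatives are `O(‖y‖²)`. -/
theorem extend_zero {B : Set E} (hB : IsOpen B) (g : E → F) (hg0 : g 0 = 0)
    (hg : ∀ y ∈ B, y ≠ 0 → ContDiffAt ℝ ∞ g y)
    (hb : ∀ n : ℕ, ∃ C : ℝ, ∀ᶠ y in nhds (0 : E), y ≠ 0 →
      ‖iteratedFDeriv ℝ n g y‖ ≤ C * ‖y‖ ^ 2) :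
    ContDiffOn ℝ ∞ g B ∧ ∀ n : ℕ, iteratedFDeriv ℝ n g 0 = 0 := by
  have key : ∀ n : ℕ, iteratedFDeriv ℝ n g 0 = 0 →
      HasFDerivAt (iteratedFDeriv ℝ n g) (0 : E →L[ℝ] _) 0 := by
    intro n hn
    obtain ⟨C, hC⟩ := hb n
    rw [hasFDerivAt_iff_isLittleO_nhds_zero]
    simp only [zero_add, hn, sub_zero, _root_.zero_apply]
    have h1 : (fun y : E => iteratedFDeriv ℝ n g y) =O[nhds 0] fun y => ‖y‖ ^ 2 := by
      refine Asymptotics.IsBigO.of_bound C ?_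
      filter_upwards [hC] with y hy
      by_cases h : y = 0
      · simp [h, hn]
      · simpa using hy h
    exact h1.trans_isLittleO (Asymptotics.isLittleO_norm_pow_id one_lt_two)
  have hz : ∀ n : ℕ, iteratedFDeriv ℝ n g 0 = 0 := by
    intro n
    induction n with
    | zero => ext; simp [hg0]
    | succ n ih =>
      rw [← norm_eq_zero, ← norm_fderiv_iteratedFDeriv, (key n ih).fderiv]
      exact ContinuousLinearMap.opNorm_zero
  refine ⟨contDiffOn_of_differentiableOn fun k _ => ?_, hz⟩
  have : DifferentiableOn ℝ (iteratedFDeriv ℝ k g) B := by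
    intro y hy
    by_cases h : y = 0
    · subst h; exact (key k (hz k)).differentiableAt.differentiableWithinAt
    · exact ((hg y hy h).differentiableAt_iteratedFDeriv
        (by exact_mod_cast ENat.natCast_lt_top k)).differentiableWithinAt
  exact this.congr (iteratedFDerivWithin_of_isOpen k hB)

end WClsLemmas

/-- A multilinear map on Euclidean space is bounded by the sum of its coordinates. -/
theorem norm_le_sum_coord (m n : ℕ)
    (A : ContinuousMultilinearMap ℝ (fun _ : Fin n => EuclideanSpace ℝ (Fin m)) ℝ) :
    ‖A‖ ≤ ∑ v : Fin n → Fin m, |A (fun l => EuclideanSpace.single (v l) (1:ℝ))| := by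
  refine A.opNorm_le_bound (by positivity) fun x => ?_
  have hx : x = fun l => ∑ j : Fin m, x l j • EuclideanSpace.single j (1:ℝ) := by
    funext l
    have := (EuclideanSpace.basisFun (Fin m) ℝ).sum_repr (x l)
    simpa using this.symm
  have h2 : A x = ∑ v : Fin n → Fin m, (∏ l, x l (v l)) *
      A (fun l => EuclideanSpace.single (v l) (1:ℝ)) := by
    conv_lhs => rw [hx]
    rw [A.map_sum]
    refine Finset.sum_congr rfl fun v _ => ?_
    rw [A.map_smul_univ (fun l => x l (v l)), smul_eq_mul]
  rw [h2, Finset.sum_mul]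
  refine (norm_sum_le _ _).trans (Finset.sum_le_sum fun v _ => ?_)
  rw [norm_mul, mul_comm, Real.norm_eq_abs, norm_prod]
  gcongr with l
  exact PiLp.norm_apply_le (x l) (v l)

section Phi

variable {m : ℕ}



/-- the inverse coordinate change -/
noncomputable def Phi (m : ℕ) (y : EuclideanSpace ℝ (Fin m)) : EuclideanSpace ℝ (Fin m) :=
  (Real.sqrt (Real.exp (1 / ‖y‖) - 1) / ‖y‖) • y

theorem norm_Phi (y : EuclideanSpace ℝ (Fin m)) (hy : y ≠ 0) : ‖Phi m y‖ = Real.sqrt (Real.exp (1 / ‖y‖) - 1) := by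
  have : 0 < ‖y‖ := norm_pos_iff.2 hy
  rw [Phi, norm_smul, norm_div, norm_norm, div_mul_cancel₀ _ this.ne', Real.norm_of_nonneg
    (Real.sqrt_nonneg _)]

theorem contDiffAt_Phi (y : EuclideanSpace ℝ (Fin m)) (hy : y ≠ 0) : ContDiffAt ℝ ∞ (Phi m) y := by
  have h0 : 0 < ‖y‖ := norm_pos_iff.2 hy
  have hn : ContDiffAt ℝ ∞ (fun y : EuclideanSpace ℝ (Fin m) => ‖y‖) y := contDiffAt_norm ℝ hy
  have h1 : Real.exp (1 / ‖y‖) - 1 ≠ 0 := by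
    have : 1 < Real.exp (1 / ‖y‖) := Real.one_lt_exp_iff.2 (by positivity)
    linarith
  unfold Phi
  exact (((((contDiffAt_const.div hn h0.ne').exp).sub contDiffAt_const).sqrt h1).div hn
    h0.ne').smul contDiffAt_id

theorem sqrt_factor {r : ℝ} (hr : 0 < r) : Real.sqrt (Real.exp (1 / r) - 1) =
    Real.exp (1 / 2 * r⁻¹) * (1 - Real.exp (-1 * r⁻¹)) ^ (1 / 2 : ℝ) := by
  rw [← Real.sqrt_eq_rpow]
  have : Real.exp (1 / r) - 1 = Real.exp (1 / 2 * r⁻¹) ^ 2 * (1 - Real.exp (-1 * r⁻¹)) := by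
    rw [mul_sub, ← Real.exp_nat_mul, ← Real.exp_add]
    congr 1
    · rw [mul_one]; congr 1; push_cast; ring
    · symm; rw [Real.exp_eq_one_iff]; push_cast; ring
  rw [this, Real.sqrt_mul (by positivity), Real.sqrt_sq (Real.exp_pos _).le]

theorem half_le {r : ℝ} (hr : 0 < r) (hr1 : r ≤ 1) : 1 / 2 ≤ 1 - Real.exp (-1 * r⁻¹) := by
  have h1 : 1 ≤ r⁻¹ := (one_le_inv₀ hr).2 hr1
  have h2 : Real.exp (-1 * r⁻¹) ≤ Real.exp (-1) := Real.exp_le_exp.2 (by linarith)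
  have h3 := Real.exp_neg_one_lt_half
  linarith

theorem exp_le_Phi (y : EuclideanSpace ℝ (Fin m)) (h0 : 0 < ‖y‖) (h1 : ‖y‖ ≤ 1) :
    Real.exp (1 / 2 * ‖y‖⁻¹) ≤ 2 * ‖Phi m y‖ := by
  rw [norm_Phi y (norm_pos_iff.1 h0), sqrt_factor h0]
  have h2 := half_le h0 h1
  have h3 : 1 - Real.exp (-1 * ‖y‖⁻¹) ≤ (1 - Real.exp (-1 * ‖y‖⁻¹)) ^ (1 / 2 : ℝ) :=
    Real.self_le_rpow_of_le_one (by linarith) (by linarith [Real.exp_pos (-1 * ‖y‖⁻¹)])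
      (by norm_num)
  have h4 : 1 / 2 ≤ (1 - Real.exp (-1 * ‖y‖⁻¹)) ^ (1 / 2 : ℝ) := h2.trans h3
  nlinarith [Real.exp_pos (1 / 2 * ‖y‖⁻¹)]

theorem WCls_Phi {V : Set (EuclideanSpace ℝ (Fin m))} (hV : IsOpen V) (hV1 : ∀ y ∈ V, 0 < ‖y‖ ∧ ‖y‖ ≤ 1) (n : ℕ) :
    WCls V (fun y => ‖Phi m y‖) n (Phi m) := by
  have hid : ∀ n, WCls V (fun _ => 1) n (fun y : EuclideanSpace ℝ (Fin m) => y) := fun n =>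
    WCls.clm hV hV1 (ContinuousLinearMap.id ℝ (EuclideanSpace ℝ (Fin m)))
  have hsq : ∀ n, WCls V (fun _ => 1) n (fun y : EuclideanSpace ℝ (Fin m) => ‖y‖ ^ 2) := fun n =>
    ((WCls.bilin hV hV1 (by simp) (by simp) (innerSL ℝ) (hid n) (hid n)).mono
      (w₂ := fun _ => 1) 1 (by simp) (by simp)).congr fun y hy => by
        exact (real_inner_self_eq_norm_sq y).symm
  have hinv : ∀ n, WCls V (fun _ => 1) n (fun y : EuclideanSpace ℝ (Fin m) => ‖y‖⁻¹) := fun n => by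
    refine (WCls.rpow hV hV1 hsq (fun y hy => pow_pos (hV1 y hy).1 2) ?_ (-1 / 2)).congr ?_
    · intro s
      refine ⟨1, ⌈-2 * s⌉₊, by simp, fun y hy => ?_⟩
      obtain ⟨h0, h1⟩ := hV1 y hy
      have h2 : 1 ≤ ‖y‖⁻¹ := (one_le_inv₀ h0).2 h1
      rw [one_mul, ← Real.rpow_natCast, ← Real.rpow_natCast, ← Real.rpow_mul h0.le]
      have : ‖y‖ ^ (((2 : ℕ) : ℝ) * s) = ‖y‖⁻¹ ^ (-2 * s) := by
        rw [Real.inv_rpow h0.le, ← Real.rpow_neg h0.le]; congr 1; push_cast; ring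
      rw [this]
      exact Real.rpow_le_rpow_of_exponent_le h2 (Nat.le_ceil _)
    · intro y hy
      obtain ⟨h0, h1⟩ := hV1 y hy
      simp only
      rw [← Real.rpow_natCast, ← Real.rpow_mul h0.le]
      norm_num [Real.rpow_neg_one]
  have hcinv : ∀ (c : ℝ) n, WCls V (fun _ => 1) n (fun y : EuclideanSpace ℝ (Fin m) => c * ‖y‖⁻¹) := fun c n =>
    (WCls.bilin hV hV1 (by simp) (by simp) (ContinuousLinearMap.mul ℝ ℝ) (WCls.const c)
      (hinv n)).mono (w₂ := fun _ => 1) 1 (by simp) (by simp)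
  have hexp : ∀ n, WCls V (fun _ => 1) n (fun y : EuclideanSpace ℝ (Fin m) => Real.exp (-1 * ‖y‖⁻¹)) := fun n =>
    (WCls.exp hV hV1 (hcinv (-1))).mono 1 (by simp) fun y hy => by
      rw [mul_one, Real.exp_le_one_iff]
      have := (hV1 y hy).1
      have : 0 < ‖y‖⁻¹ := by positivity
      linarith
  have hu : ∀ n, WCls V (fun _ => 1) n (fun y : EuclideanSpace ℝ (Fin m) => 1 - Real.exp (-1 * ‖y‖⁻¹)) := fun n =>
    (hexp n).const_sub hV hV1 1 fun y hy => by
      have h2 := half_le (hV1 y hy).1 (hV1 y hy).2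
      rw [Real.norm_of_nonneg (by linarith)]
      linarith [Real.exp_pos (-1 * ‖y‖⁻¹)]
  have ha : ∀ n, WCls V (fun _ => 1) n
      (fun y : EuclideanSpace ℝ (Fin m) => (1 - Real.exp (-1 * ‖y‖⁻¹)) ^ (1 / 2 : ℝ)) := fun n => by
    refine WCls.rpow hV hV1 hu (fun y hy => ?_) ?_ _
    · linarith [half_le (hV1 y hy).1 (hV1 y hy).2]
    · intro s
      refine ⟨(1 / 2) ^ s + 1, 0, by positivity, fun y hy => ?_⟩
      have h2 := half_le (hV1 y hy).1 (hV1 y hy).2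
      have h3 := Real.exp_pos (-1 * ‖y‖⁻¹)
      have h4 : (0 : ℝ) < (1 / 2) ^ s := by positivity
      rw [pow_zero, mul_one]
      rcases le_total 0 s with hs | hs
      · have := Real.rpow_le_one (by linarith) (by linarith) hs
          (x := 1 - Real.exp (-1 * ‖y‖⁻¹))
        linarith
      · have := Real.rpow_le_rpow_of_nonpos (by norm_num) h2 hs
        linarith
  have hE : WCls V (fun y : EuclideanSpace ℝ (Fin m) => Real.exp (1 / 2 * ‖y‖⁻¹)) n
      (fun y : EuclideanSpace ℝ (Fin m) => Real.exp (1 / 2 * ‖y‖⁻¹)) := WCls.exp hV hV1 (hcinv (1 / 2))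
  have h1 := WCls.bilin hV hV1 (fun y _ => (Real.exp_pos _).le) (by simp)
    (ContinuousLinearMap.mul ℝ ℝ) hE (ha n)
  have h2 := WCls.bilin hV hV1 (fun y _ => by positivity) (by simp)
    (ContinuousLinearMap.mul ℝ ℝ) h1 (hinv n)
  have h3 := WCls.bilin hV hV1 (fun y _ => by positivity) (by simp)
    (ContinuousLinearMap.lsmul ℝ ℝ) h2 (hid n)
  refine (h3.mono (w₂ := fun y => ‖Phi m y‖) 2 (by simp) fun y hy => ?_).congr fun y hy => ?_
  · simpa using exp_le_Phi y (hV1 y hy).1 (hV1 y hy).2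
  · rw [Phi, sqrt_factor (hV1 y hy).1, div_eq_mul_inv]
    simp only [ContinuousLinearMap.lsmul_apply, ContinuousLinearMap.mul_apply']

/-- the exponential weight beats every power -/
theorem weight_bound (ρ : ℝ) (hρ : ρ < 0) (K : ℕ) : ∃ C : ℝ, 0 ≤ C ∧ ∀ y : EuclideanSpace ℝ (Fin m), 0 < ‖y‖ → ‖y‖ ≤ 1 →
    ‖Phi m y‖ ^ ρ * ‖y‖⁻¹ ^ K ≤ C * ‖y‖ ^ 2 := by
  refine ⟨(1 / 2) ^ ρ * ((K + 2).factorial / (-ρ / 2) ^ (K + 2)), ?_, fun y h0 h1 => ?_⟩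
  · have : 0 < -ρ / 2 := by linarith
    positivity
  have hc : 0 < -ρ / 2 := by linarith
  have hle := exp_le_Phi y h0 h1
  have e1 : ‖Phi m y‖ ^ ρ ≤ (1 / 2 * Real.exp (1 / 2 * ‖y‖⁻¹)) ^ ρ :=
    Real.rpow_le_rpow_of_nonpos (by positivity) (by linarith) hρ.le
  have e2 : (1 / 2 * Real.exp (1 / 2 * ‖y‖⁻¹)) ^ ρ
      = (1 / 2) ^ ρ * (Real.exp ((-ρ / 2) * ‖y‖⁻¹))⁻¹ := by
    rw [Real.mul_rpow (by norm_num) (Real.exp_pos _).le, ← Real.exp_mul, ← Real.exp_neg]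
    congr 2; ring
  have e3 := Real.pow_div_factorial_le_exp (x := (-ρ / 2) * ‖y‖⁻¹) (by positivity) (K + 2)
  have e4 : (Real.exp ((-ρ / 2) * ‖y‖⁻¹))⁻¹ ≤
      (((-ρ / 2) * ‖y‖⁻¹) ^ (K + 2) / (K + 2).factorial)⁻¹ := inv_anti₀ (by positivity) e3
  calc ‖Phi m y‖ ^ ρ * ‖y‖⁻¹ ^ K
      ≤ ((1 / 2) ^ ρ * (((-ρ / 2) * ‖y‖⁻¹) ^ (K + 2) / (K + 2).factorial)⁻¹) * ‖y‖⁻¹ ^ K := by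
        rw [e2] at e1
        gcongr
        exact e1.trans (by gcongr)
    _ = _ := by
        rw [inv_div, mul_pow, pow_add ‖y‖⁻¹]
        generalize (-ρ / 2) = c at *
        field_simp

end Phi

/-- Let `m ≥ 1`, `R > 0`, `ρ < 0`, and let `f` be smooth on
`{x ∈ ℝ^m : |x| > R}` with `|∂^β f(x)| ≤ C_β |x|^{ρ-|β|}` for every multi-index `β`. Then
with `r̃₀ = 1/log(1+R²)`, the function `f̃` on the ball `B = {|ỹ| < r̃₀}` given by
`f̃(0) = 0` and `f̃(ỹ) = f((e^{1/|ỹ|}-1)^{1/2}·ỹ/|ỹ|)` for `ỹ ≠ 0` is `C^∞` on `B`,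
and all of its derivatives of every order vanish at `ỹ = 0`. -/
theorem smooth_extension_over_infinity
    (m : ℕ) (hm : 1 ≤ m) (R : ℝ) (hR : 0 < R) (ρ : ℝ) (hρ : ρ < 0)
    (U : Set (EuclideanSpace ℝ (Fin m)))
    (hU : U = {x : EuclideanSpace ℝ (Fin m) | R < ‖x‖})
    (f : EuclideanSpace ℝ (Fin m) → ℝ)
    (hf : ContDiffOn ℝ (⊤ : ℕ∞) f U)
    (hdecay : ∀ n : ℕ, ∀ v : Fin n → Fin m, ∃ C : ℝ, 0 ≤ C ∧ ∀ x ∈ U,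
      |(iteratedFDerivWithin ℝ n f U x)
          (fun l => EuclideanSpace.single (v l) (1:ℝ))|
        ≤ C * ‖x‖ ^ (ρ - n))
    (g : EuclideanSpace ℝ (Fin m) → ℝ)
    (hg0 : g 0 = 0)
    (hg : ∀ y : EuclideanSpace ℝ (Fin m), y ≠ 0 →
      g y = f ((Real.sqrt (Real.exp (1 / ‖y‖) - 1) / ‖y‖) • y))
    (B : Set (EuclideanSpace ℝ (Fin m)))
    (hB : B = Metric.ball 0 (1 / Real.log (1 + R ^ 2))) :
    ContDiffOn ℝ (⊤ : ℕ∞) g B ∧ ∀ n : ℕ, iteratedFDerivWithin ℝ n g B 0 = 0 := by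

  subst hU hB
  have hUo : IsOpen {x : EuclideanSpace ℝ (Fin m) | R < ‖x‖} :=
    isOpen_lt continuous_const continuous_norm
  have hlog : 0 < Real.log (1 + R ^ 2) := Real.log_pos (by nlinarith)
  have hr0 : 0 < 1 / Real.log (1 + R ^ 2) := by positivity
  set r0 := 1 / Real.log (1 + R ^ 2) with hr0def
  have hmap : ∀ y : EuclideanSpace ℝ (Fin m), y ≠ 0 → ‖y‖ < r0 →
      Phi m y ∈ {x : EuclideanSpace ℝ (Fin m) | R < ‖x‖} := by
    intro y hy hlt
    have h0 : 0 < ‖y‖ := norm_pos_iff.2 hy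
    have h1 : Real.log (1 + R ^ 2) < 1 / ‖y‖ := by
      rw [hr0def, lt_one_div h0 hlog] at hlt
      exact hlt
    have h2 := (Real.log_lt_iff_lt_exp (by positivity)).1 h1
    rw [Set.mem_ofPred_eq, norm_Phi y hy]
    exact Real.lt_sqrt_of_sq_lt (by linarith)
  have hgf : ∀ y : EuclideanSpace ℝ (Fin m), y ≠ 0 → g y = f (Phi m y) := hg
  have hdec : ∀ i : ℕ, ∃ C : ℝ, 0 ≤ C ∧ ∀ x ∈ {x : EuclideanSpace ℝ (Fin m) | R < ‖x‖},
      ‖iteratedFDerivWithin ℝ i f {x : EuclideanSpace ℝ (Fin m) | R < ‖x‖} x‖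
        ≤ C * ‖x‖ ^ (ρ - i) := by
    intro i
    choose C hC hb using hdecay i
    refine ⟨∑ v, C v, Finset.sum_nonneg fun v _ => hC v, fun x hx => ?_⟩
    refine (norm_le_sum_coord m i _).trans ?_
    rw [Finset.sum_mul]
    exact Finset.sum_le_sum fun v _ => hb v x hx
  set V : Set (EuclideanSpace ℝ (Fin m)) := Metric.ball 0 (min r0 1) \ {0} with hVdef
  have hV : IsOpen V := Metric.isOpen_ball.sdiff isClosed_singleton
  have hVm : ∀ y ∈ V, y ≠ 0 ∧ ‖y‖ < r0 ∧ ‖y‖ ≤ 1 := by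
    rintro y ⟨h1, h2⟩
    rw [mem_ball_zero_iff, lt_min_iff] at h1
    exact ⟨h2, h1.1, h1.2.le⟩
  have hV1 : ∀ y ∈ V, 0 < ‖y‖ ∧ ‖y‖ ≤ 1 := fun y hy =>
    ⟨norm_pos_iff.2 (hVm y hy).1, (hVm y hy).2.2⟩
  have hW : ∀ n, WCls V (fun y => ‖Phi m y‖ ^ ρ) n g := fun n =>
    (WCls.comp hV hV1 hUo (fun x hx h => by
        rw [Set.mem_ofPred_eq, h, norm_zero] at hx; linarith)
      (fun y hy => hmap y (hVm y hy).1 (hVm y hy).2.1) (WCls_Phi hV hV1) n ℝ f ρ hf hdec).congr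
      fun y hy => hgf y (hVm y hy).1
  have main := extend_zero (B := Metric.ball 0 r0) Metric.isOpen_ball g hg0 ?_ ?_
  · refine ⟨main.1, fun n => ?_⟩
    rw [iteratedFDerivWithin_of_isOpen n Metric.isOpen_ball (Metric.mem_ball_self hr0)]
    exact main.2 n
  · intro y hy hy0
    rw [mem_ball_zero_iff] at hy
    have h1 : ContDiffAt ℝ ∞ (f ∘ Phi m) y :=
      (hf.contDiffAt (hUo.mem_nhds (hmap y hy0 hy))).comp y (contDiffAt_Phi y hy0)
    refine h1.congr_of_eventuallyEq ?_
    filter_upwards [isOpen_ne.mem_nhds hy0] with z hz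
    exact hgf z hz
  · intro n
    obtain ⟨C, K, hC, hb⟩ := (hW n).2 n le_rfl
    obtain ⟨C', hC', hb'⟩ := weight_bound (m := m) ρ hρ K
    refine ⟨C * C', ?_⟩
    filter_upwards [Metric.ball_mem_nhds (0 : EuclideanSpace ℝ (Fin m))
      (lt_min hr0 one_pos)] with y hy hy0
    have hyV : y ∈ V := ⟨hy, hy0⟩
    have := hb y hyV
    rw [iteratedFDerivWithin_of_isOpen n hV hyV] at this
    refine this.trans ?_
    rw [mul_assoc]
    exact mul_le_mul_of_nonneg_left (hb' y (hV1 y hyV).1 (hV1 y hyV).2) hC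
end
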